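/- Let u ∈ C⁴(B₁(0)) be a 2-convex solution of (σ₂/σ₁)(λ(D²u)) = ψ(x,u) in the unit ball B₁(0) ⊂ ℝ³, where ψ : B₁(0) × ℝ → (0,∞) is of class C^{1,1}. Then for all constants M, K > 0 there is a constant C > 0 depending only on ‖ψ‖_{C^{1,1}} ≤ K, ‖1/ψ‖_{L^∞} ≤ K and ‖u‖_{C¹(B₁(0))} ≤ M such that |D²u(0)| ≤ C. -/

import Mathlib

open Metric Set

/-- The Hessian matrix of `u : ℝⁿ → ℝ` at `x`, with entries the second partial derivatives. -/
noncomputable def hessian (n : ℕ) (u : (Fin n → ℝ) → ℝ) (x : Fin n → ℝ) :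
    Matrix (Fin n) (Fin n) ℝ :=
  fun i j => iteratedFDeriv ℝ 2 u x ![Pi.single i 1, Pi.single j 1]

/-- `Δu = σ₁(λ(D²u))`: the trace of the Hessian. -/
noncomputable def lapl (n : ℕ) (u : (Fin n → ℝ) → ℝ) (x : Fin n → ℝ) : ℝ :=
  ∑ i, hessian n u x i i

/-- `σ₂(λ(D²u)) = ((tr D²u)² − tr((D²u)²))/2`, the second elementary symmetric function of the
eigenvalues of the (symmetric) Hessian. -/
noncomputable def sigma2 (n : ℕ) (u : (Fin n → ℝ) → ℝ) (x : Fin n → ℝ) : ℝ :=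
  ((lapl n u x) ^ 2 - ∑ i, ∑ j, hessian n u x i j * hessian n u x j i) / 2

/-- Eigenvalues of the Hessian of a 2-convex solution: `S` is their sum, and `σ₂ = g S`. -/
structure EigenData (S g m₁ m₂ m₃ : ℝ) : Prop where
  S_pos : 0 < S
  g_pos : 0 < g
  sum_eq : m₁ + m₂ + m₃ = S
  sq_eq : S ^ 2 - (m₁ ^ 2 + m₂ ^ 2 + m₃ ^ 2) = 2 * g * S

namespace EigenData

variable {S g m₁ m₂ m₃ : ℝ}

lemma rotate (h : EigenData S g m₁ m₂ m₃) : EigenData S g m₂ m₃ m₁ :=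
  ⟨h.S_pos, h.g_pos, by linarith [h.sum_eq], by linarith [h.sq_eq]⟩

lemma three_mul_le (h : EigenData S g m₁ m₂ m₃) : 3 * g ≤ S := by
  have h1 := h.S_pos
  have h3 := h.sum_eq
  have h4 := h.sq_eq
  have : 0 ≤ S * (S - 3 * g) := by
    subst h3
    nlinarith [sq_nonneg (m₁ - m₂), sq_nonneg (m₁ - m₃), sq_nonneg (m₂ - m₃)]
  nlinarith [nonneg_of_mul_nonneg_right this h1]

/-- The product of two of the eigenvalues of the linearized operator. -/
lemma mul_eq (h : EigenData S g m₁ m₂ m₃) :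
    (S - g - m₁) * (S - g - m₂) = 3 * g ^ 2 / 4 + (m₃ - g / 2) ^ 2 := by
  have h3 := h.sum_eq
  have h4 := h.sq_eq
  have h5 : m₃ = S - m₁ - m₂ := by linarith
  subst h5
  linear_combination (1 / 2) * h4

lemma coeff_pos (h : EigenData S g m₁ m₂ m₃) : 0 < S - g - m₁ := by
  have h2 := h.g_pos
  have e12 := h.mul_eq
  have e13 := h.rotate.rotate.mul_eq
  have e := h.three_mul_le
  have h3 := h.sum_eq
  by_contra hc
  push Not at hc
  have p12 : 0 < (S - g - m₁) * (S - g - m₂) := by rw [e12]; positivity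
  have p13 : 0 < (S - g - m₃) * (S - g - m₁) := by rw [e13]; positivity
  have : S - g - m₂ < 0 := by
    by_contra hh
    push Not at hh
    nlinarith
  have : S - g - m₃ < 0 := by
    by_contra hh
    push Not at hh
    nlinarith
  linarith

lemma coeff_le (h : EigenData S g m₁ m₂ m₃) : S - g - m₁ ≤ 2 * S := by
  have h1 := h.rotate.coeff_pos
  have h2 := h.rotate.rotate.coeff_pos
  have := h.sum_eq
  have := h.g_pos
  linarith

/-- The determinant `F₁F₂F₃` dominates `F₁ f`. -/
lemma coeff_mul_eq (h : EigenData S g m₁ m₂ m₃) :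
    (S - g - m₁) * (3 * g ^ 2 / 4 + (m₁ - g / 2) ^ 2)
      = (S - g - m₁) * (S - g - m₂) * (S - g - m₃) := by
  have := h.rotate.mul_eq
  rw [← this]; ring

lemma three_prod_eq (h : EigenData S g m₁ m₂ m₃) :
    3 * ((S - g - m₁) * (S - g - m₂) * (S - g - m₃)) =
      ((S - g - m₁) * m₁ ^ 2 + (S - g - m₂) * m₂ ^ 2 + (S - g - m₃) * m₃ ^ 2)
        + g ^ 2 * S - 3 * g ^ 3 := by
  have e1 := h.coeff_mul_eq
  have e2 := h.rotate.coeff_mul_eq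
  have e3 := h.rotate.rotate.coeff_mul_eq
  have h3 := h.sum_eq
  have h4 := h.sq_eq
  have h5 : m₃ = S - m₁ - m₂ := by linarith
  subst h5
  linear_combination -e1 - e2 - e3 - g * h4

lemma prod_ge (h : EigenData S g m₁ m₂ m₃) :
    g ^ 2 * S ≤ 4 * ((S - g - m₁) * (S - g - m₂) * (S - g - m₃)) := by
  have e1 := h.coeff_mul_eq
  have e2 := h.rotate.coeff_mul_eq
  have e3 := h.rotate.rotate.coeff_mul_eq
  have p1 := h.coeff_pos
  have p2 := h.rotate.coeff_pos
  have p3 := h.rotate.rotate.coeff_pos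
  have h3 := h.sum_eq
  have := h.three_mul_le
  have q1 := mul_nonneg p1.le (sq_nonneg (m₁ - g / 2))
  have q2 := mul_nonneg p2.le (sq_nonneg (m₂ - g / 2))
  have q3 := mul_nonneg p3.le (sq_nonneg (m₃ - g / 2))
  have hg := h.g_pos
  have : g ^ 2 * (2 * S - 3 * g) ≤ 4 * ((S - g - m₁) * (S - g - m₂) * (S - g - m₃)) := by
    have h5 : m₃ = S - m₁ - m₂ := by linarith
    subst h5
    nlinarith
  nlinarith [mul_nonneg (sq_nonneg g) (sub_nonneg.2 h.three_mul_le)]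

lemma coeff_lower (h : EigenData S g m₁ m₂ m₃) :
    g ^ 2 ≤ 2 * (S - 3 * g / 2) * (S - g - m₁) := by
  have e1 := h.coeff_mul_eq
  have p1 := h.coeff_pos
  have p2 := h.rotate.coeff_pos
  have p3 := h.rotate.rotate.coeff_pos
  have h3 := h.sum_eq
  have h4 := h.sq_eq
  have hS := h.S_pos
  have hg := h.g_pos
  have h31 := h.three_mul_le
  have e2 := h.rotate.coeff_mul_eq
  have e3 := h.rotate.rotate.coeff_mul_eq
  have q1 := mul_nonneg p1.le (sq_nonneg (m₁ - g / 2))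
  have q2 := mul_nonneg p2.le (sq_nonneg (m₂ - g / 2))
  have q3 := mul_nonneg p3.le (sq_nonneg (m₃ - g / 2))
  have hV : g ^ 2 * (S - 3 * g / 2) ≤ 2 * ((S - g - m₁) * (S - g - m₂) * (S - g - m₃)) := by
    have h5 : m₃ = S - m₁ - m₂ := by linarith
    subst h5
    nlinarith
  have hA : 0 < S - 3 * g / 2 := by linarith
  have hm : 3 * g ^ 2 / 4 + (m₁ - g / 2) ^ 2 ≤ (S - 3 * g / 2) ^ 2 := by
    have h5 : m₃ = S - m₁ - m₂ := by linarith
    subst h5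
    nlinarith [sq_nonneg (m₂ - g / 2), sq_nonneg (S - m₁ - m₂ - g / 2)]
  have : g ^ 2 * (S - 3 * g / 2) ≤ 2 * ((S - g - m₁) * (S - 3 * g / 2) ^ 2) := by
    rw [← e1] at hV
    nlinarith [mul_le_mul_of_nonneg_left hm p1.le]
  have : (S - 3 * g / 2) * g ^ 2 ≤ (S - 3 * g / 2) * (2 * (S - 3 * g / 2) * (S - g - m₁)) := by
    nlinarith
  exact le_of_mul_le_mul_left this hA

set_option maxHeartbeats 400000 in
/-- The homogeneous Jacobi inequality, for one index of the tensor of third derivatives. -/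
lemma jacobi_homogeneous (h : EigenData S g m₁ m₂ m₃) {t₁ t₂ t₃ : ℝ}
    (ht : (S - g - m₁) * t₁ + (S - g - m₂) * t₂ + (S - g - m₃) * t₃ = 0) :
    4 * (S - g - m₁) * (t₁ + t₂ + t₃) ^ 2 ≤
      3 * (S - 3 * g / 2) * (t₁ ^ 2 + 3 * t₂ ^ 2 + 3 * t₃ ^ 2 - (t₁ + t₂ + t₃) ^ 2) := by
  have hF := h.coeff_pos
  have h31 := h.three_mul_le
  have hg := h.g_pos
  have hAp : 0 < S - 3 * g / 2 := by linarith [h.S_pos]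
  have h3 := h.sum_eq
  have h4 := h.sq_eq
  obtain ⟨w, hw⟩ : ∃ w, w = t₁ + t₂ + t₃ := ⟨_, rfl⟩
  obtain ⟨p, hp⟩ : ∃ p, p = t₂ + t₃ := ⟨_, rfl⟩
  obtain ⟨m, hm⟩ : ∃ m, m = t₂ - t₃ := ⟨_, rfl⟩
  obtain ⟨F, hFd⟩ : ∃ F, F = S - g - m₁ := ⟨_, rfl⟩
  obtain ⟨A, hA⟩ : ∃ A, A = S - 3 * g / 2 := ⟨_, rfl⟩
  obtain ⟨D, hD⟩ : ∃ D, D = A - 3 * F / 2 := ⟨_, rfl⟩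
  obtain ⟨E, hE⟩ : ∃ E, E = (m₃ - m₂) / 2 := ⟨_, rfl⟩
  have et3 : t₃ = (p - m) / 2 := by rw [hp, hm]; ring
  have et2 : t₂ = (p + m) / 2 := by rw [hp, hm]; ring
  have et1 : t₁ = w - p := by rw [hp, hw]; ring
  have em1 : m₁ = S - g - F := by linarith
  have em3 : m₃ = (g + F) / 2 + E := by linarith
  have em2 : m₂ = (g + F) / 2 - E := by linarith
  have eS : S = A + 3 * g / 2 := by linarith
  have hlin : D * p + E * m = - F * w := by
    rw [et1, et2, et3, em1, em2, em3, eS] at ht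
    rw [hD]
    linear_combination ht
  have hE2 : E ^ 2 ≤ F * (A - 3 * F / 4) := by
    rw [em1, em2, em3, eS] at h4
    linear_combination (3 / 4) * sq_nonneg g - (1 / 2) * h4
  rw [← hFd, ← hA, ← hw]
  rw [← hFd] at hF
  rw [← hA] at hAp
  have hq : t₁ ^ 2 + 3 * t₂ ^ 2 + 3 * t₃ ^ 2 - w ^ 2
      = 5 / 2 * p ^ 2 + 3 / 2 * m ^ 2 - 2 * p * w := by
    rw [et1, et2, et3]; ring
  rw [hq]
  have hFA : 3 * F ≤ 4 * A := by nlinarith [sq_nonneg E]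
  have hR : 2 * D ^ 2 / 5 + 2 * E ^ 2 / 3 ≤ 2 / 15 * (3 * A ^ 2 - 4 * A * F + 3 * F ^ 2) := by
    rw [hD]; linear_combination (2 / 3) * hE2
  have hRp : 0 < 3 * A ^ 2 - 4 * A * F + 3 * F ^ 2 := by nlinarith [sq_nonneg (A - F)]
  have hCS : (D * (p - 2 * w / 5) + E * m) ^ 2 ≤
      (5 / 2 * (p - 2 * w / 5) ^ 2 + 3 / 2 * m ^ 2) * (2 * D ^ 2 / 5 + 2 * E ^ 2 / 3) := by
    have : 0 ≤ (5 * (p - 2 * w / 5) * E - 3 * m * D) ^ 2 / 15 := by positivity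
    linear_combination this
  have hl2 : D * (p - 2 * w / 5) + E * m = -(2 / 5) * (A + F) * w := by
    rw [hD] at hlin ⊢
    linear_combination hlin
  rw [hl2] at hCS
  have hZ : 0 ≤ 5 / 2 * (p - 2 * w / 5) ^ 2 + 3 / 2 * m ^ 2 := by positivity
  obtain ⟨Q, hQ⟩ : ∃ Q, Q = 5 / 2 * p ^ 2 + 3 / 2 * m ^ 2 - 2 * p * w := ⟨_, rfl⟩
  have hZQ : 5 / 2 * (p - 2 * w / 5) ^ 2 + 3 / 2 * m ^ 2 = Q + 2 / 5 * w ^ 2 := by rw [hQ]; ring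
  rw [← hQ]
  rw [hZQ] at hCS hZ
  have h5 := hCS.trans (mul_le_mul_of_nonneg_left hR hZ)
  have h6 : 4 * A * F * w ^ 2 ≤ Q * (3 * A ^ 2 - 4 * A * F + 3 * F ^ 2) := by
    linear_combination (15 / 2) * h5
  have h7 : F * w ^ 2 * (4 * (3 * A ^ 2 - 4 * A * F + 3 * F ^ 2)) ≤ 12 * A ^ 2 * F * w ^ 2 := by
    have : 0 ≤ F * w ^ 2 * (F * (4 * A - 3 * F)) := by
      have : 0 ≤ 4 * A - 3 * F := by linarith
      positivity
    linear_combination 4 * this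
  have h8 : (4 * F * w ^ 2) * (3 * A ^ 2 - 4 * A * F + 3 * F ^ 2) ≤
      (3 * A * Q) * (3 * A ^ 2 - 4 * A * F + 3 * F ^ 2) := by
    linear_combination h7 + 3 * mul_le_mul_of_nonneg_left h6 hAp.le
  exact le_of_mul_le_mul_right h8 hRp

set_option maxHeartbeats 400000 in
/-- The Jacobi inequality for one index, with an inhomogeneous linearized equation. -/
lemma jacobi (h : EigenData S g m₁ m₂ m₃) {P γ t₁ t₂ t₃ : ℝ} (hP : 1 ≤ P) (hg : 1 ≤ P * g)
    (hγ : |γ| ≤ P)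
    (ht : (S - g - m₁) * t₁ + (S - g - m₂) * t₂ + (S - g - m₃) * t₃ = γ * S) :
    7 / 6 * ((S - g - m₁) / S) * (t₁ + t₂ + t₃) ^ 2 - 1100 * P ^ 4 * S ^ 2 ≤
      t₁ ^ 2 + 3 * t₂ ^ 2 + 3 * t₃ ^ 2 - (t₁ + t₂ + t₃) ^ 2 := by
  have hF := h.coeff_pos
  have h31 := h.three_mul_le
  have hgp := h.g_pos
  have hS := h.S_pos
  obtain ⟨A, hA⟩ : ∃ A, A = S - 3 * g / 2 := ⟨_, rfl⟩
  have hAp : 0 < A := by linarith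
  have hAS : S ≤ 2 * A := by linarith
  have hAS' : A ≤ S := by linarith
  have hPA : 1 ≤ P * A := hg.trans (mul_le_mul_of_nonneg_left (by linarith) (by linarith))
  obtain ⟨τ, hτ⟩ : ∃ τ, τ = γ * S / (2 * A) := ⟨_, rfl⟩
  have hτ' : τ * (2 * A) = γ * S := by rw [hτ]; field_simp
  have hτP : |τ| ≤ P := by
    rw [hτ, abs_div, abs_mul, abs_of_pos hS, abs_of_pos (by positivity : 0 < 2 * A),
      div_le_iff₀ (by positivity)]
    exact mul_le_mul hγ hAS hS.le (by linarith)
  have hτ2 : τ ^ 2 ≤ P ^ 2 := by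
    rw [← sq_abs τ]; exact pow_le_pow_left₀ (abs_nonneg _) hτP 2
  obtain ⟨s₁, hs1⟩ : ∃ s, s = t₁ - τ := ⟨_, rfl⟩
  obtain ⟨s₂, hs2⟩ : ∃ s, s = t₂ - τ := ⟨_, rfl⟩
  obtain ⟨s₃, hs3⟩ : ∃ s, s = t₃ - τ := ⟨_, rfl⟩
  have hs : (S - g - m₁) * s₁ + (S - g - m₂) * s₂ + (S - g - m₃) * s₃ = 0 := by
    rw [hs1, hs2, hs3]
    have : (S - g - m₁) + (S - g - m₂) + (S - g - m₃) = 2 * A := by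
      linarith [h.sum_eq]
    linear_combination ht - hτ' - τ * this
  have hJ := h.jacobi_homogeneous hs
  have hlow := h.coeff_lower
  have h43 : 3 * (S - g - m₁) ≤ 4 * A := by
    have := h.sum_eq
    have := h.sq_eq
    have h5 : m₃ = S - m₁ - m₂ := by linarith
    subst h5
    have : 0 ≤ (S - g - m₁) * (4 * A - 3 * (S - g - m₁)) := by
      rw [hA]; nlinarith [sq_nonneg (S - m₁ - m₂ - m₂), sq_nonneg g]
    linarith [nonneg_of_mul_nonneg_right this hF]
  rw [← hA] at hJ hlow
  obtain ⟨F, hFd⟩ : ∃ F, F = S - g - m₁ := ⟨_, rfl⟩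
  rw [← hFd] at hJ hlow h43 hF ⊢
  obtain ⟨κ, hκ⟩ : ∃ κ, κ = F / A := ⟨_, rfl⟩
  have hκ0 : 0 < κ := by rw [hκ]; positivity
  have hκA : κ * A = F := by rw [hκ]; field_simp
  have hκle : κ ≤ 4 / 3 := by rw [hκ, div_le_iff₀ hAp]; linarith
  obtain ⟨w, hw⟩ : ∃ w, w = s₁ + s₂ + s₃ := ⟨_, rfl⟩
  obtain ⟨p, hp⟩ : ∃ p, p = s₂ + s₃ := ⟨_, rfl⟩
  obtain ⟨q, hq⟩ : ∃ q, q = s₁ ^ 2 + 3 * s₂ ^ 2 + 3 * s₃ ^ 2 - w ^ 2 := ⟨_, rfl⟩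
  rw [← hw, ← hq] at hJ
  have hJ' : 4 / 3 * κ * w ^ 2 ≤ q := by
    rw [← hκA] at hJ
    have : A * (4 / 3 * κ * w ^ 2) ≤ A * q := by linear_combination hJ / 3
    exact le_of_mul_le_mul_left this hAp
  have hκlow : 1 ≤ 2 * (P * A) ^ 2 * κ := by
    have h1 : g ^ 2 ≤ 2 * A ^ 2 * κ := by rw [← hκA] at hlow; linear_combination hlow
    have h2 : 1 ≤ (P * g) ^ 2 := one_le_pow₀ hg
    calc 1 ≤ (P * g) ^ 2 := h2
      _ = P ^ 2 * g ^ 2 := by ring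
      _ ≤ P ^ 2 * (2 * A ^ 2 * κ) := by gcongr
      _ = _ := by ring
  obtain ⟨N, hN⟩ : ∃ N, N = (P * A) ^ 2 := ⟨_, rfl⟩
  have hN1 : 1 ≤ N := by rw [hN]; exact one_le_pow₀ hPA
  rw [← hN] at hκlow
  have hp2 : p ^ 2 ≤ q + 2 / 3 * w ^ 2 := by
    have e1 : s₁ = w - p := by linarith
    have e3 : s₃ = p - s₂ := by linarith
    rw [hq, e1, e3]
    nlinarith [sq_nonneg (3 * p - 2 * w), sq_nonneg (2 * s₂ - p)]
  have hq0 : 0 ≤ q := le_trans (by positivity) hJ'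
  have ew : t₁ + t₂ + t₃ = w + 3 * τ := by rw [hw, hs1, hs2, hs3]; ring
  have eq : t₁ ^ 2 + 3 * t₂ ^ 2 + 3 * t₃ ^ 2 - (t₁ + t₂ + t₃) ^ 2
      = q - 4 * τ * (w - p) - 2 * τ ^ 2 := by
    rw [hq, hw, hp, hs1, hs2, hs3]; ring
  rw [eq, ew]
  have hw2 : w ^ 2 ≤ 2 * N * (κ * w ^ 2) := by linear_combination w ^ 2 * hκlow
  have hc1 : 4 * τ * w ≤ w ^ 2 / (100 * N) + 400 * N * τ ^ 2 := by
    rw [← sub_nonneg]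
    have : w ^ 2 / (100 * N) + 400 * N * τ ^ 2 - 4 * τ * w
      = (w - 200 * N * τ) ^ 2 / (100 * N) := by field_simp; ring
    rw [this]; positivity
  have hc2 : -(4 * τ * p) ≤ p ^ 2 / (100 * N) + 400 * N * τ ^ 2 := by
    rw [← sub_nonneg]
    have : p ^ 2 / (100 * N) + 400 * N * τ ^ 2 - -(4 * τ * p)
      = (p + 200 * N * τ) ^ 2 / (100 * N) := by field_simp; ring
    rw [this]; positivity
  have hd1 : w ^ 2 / (100 * N) ≤ κ * w ^ 2 / 50 := by
    rw [div_le_iff₀ (by positivity)]; linear_combination hw2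
  have hd2 : p ^ 2 / (100 * N) ≤ q / 100 + κ * w ^ 2 / 75 := by
    rw [div_le_iff₀ (by positivity)]
    linear_combination hp2 + mul_nonneg hq0 (sub_nonneg.2 hN1) + (2 / 3) * hw2
  have hFS : F / S ≤ κ := by
    rw [hκ]; exact div_le_div_of_nonneg_left hF.le hAp hAS'
  have hww : (w + 3 * τ) ^ 2 ≤ 16 / 15 * w ^ 2 + 144 * τ ^ 2 := by
    linear_combination (1 / 15) * sq_nonneg (w - 45 * τ)
  have h7 : 7 / 6 * (F / S) * (w + 3 * τ) ^ 2 ≤ 7 / 6 * κ * (16 / 15 * w ^ 2 + 144 * τ ^ 2) := by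
    gcongr
  have h8 : κ * τ ^ 2 ≤ 4 / 3 * P ^ 2 := by
    exact mul_le_mul hκle hτ2 (sq_nonneg τ) (by norm_num)
  have hNτ : N * τ ^ 2 ≤ P ^ 4 * S ^ 2 := by
    rw [hN]
    calc (P * A) ^ 2 * τ ^ 2 ≤ (P * S) ^ 2 * P ^ 2 := by gcongr
      _ = _ := by ring
  have hP2 : P ^ 2 ≤ P ^ 4 * S ^ 2 := by
    have : 1 ≤ (P * S) ^ 2 := one_le_pow₀ (hPA.trans (by gcongr))
    linear_combination P ^ 2 * this
  have hκw : 0 ≤ κ * w ^ 2 := by positivity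
  have hPS : 0 ≤ P ^ 4 * S ^ 2 := by positivity
  linear_combination h7 + 168 * h8 + hc1 + hd1 + hc2 + hd2 + 99 / 100 * hJ' + 2 * hτ2 + 800 * hNτ
    + 226 * hP2 + 19 / 450 * hκw + 74 * hPS

end EigenData

section

open Matrix

/-- The quadratic form of a coefficient matrix. -/
def quadForm (F : Fin 3 → Fin 3 → ℝ) (ξ η : Fin 3 → ℝ) : ℝ :=
  ∑ i, ∑ j, F i j * ξ i * η j

/-- The coefficients `(S - g) I - H` of the linearization of `σ₂ - g σ₁`. -/
def linCoeff (S g : ℝ) (H : Matrix (Fin 3) (Fin 3) ℝ) (i j : Fin 3) : ℝ :=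
  (S - g) * (if i = j then 1 else 0) - H i j

/-- The trace of `F H²` for `F = linCoeff S g H`. -/
def traceFHH (S g : ℝ) (H : Matrix (Fin 3) (Fin 3) ℝ) : ℝ :=
  ∑ k, quadForm (linCoeff S g H) (H k) (H k)

/-- The determinant of `linCoeff S g H` when `σ₂(H) = g S`; it is the volume density of the
gradient graph. -/
noncomputable def volDensity (S g : ℝ) (H : Matrix (Fin 3) (Fin 3) ℝ) : ℝ :=
  (traceFHH S g H + g ^ 2 * S - 3 * g ^ 3) / 3

/-- A symmetric matrix with positive trace `S` and `σ₂ = g S`. -/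
structure HessData (S g : ℝ) (H : Matrix (Fin 3) (Fin 3) ℝ) : Prop where
  symm : ∀ i j, H i j = H j i
  S_pos : 0 < S
  g_pos : 0 < g
  trace_eq : ∑ i, H i i = S
  sq_eq : S ^ 2 - ∑ i, ∑ j, H i j ^ 2 = 2 * g * S

/-- An orthonormal eigenbasis (the columns of `O`) with eigenvalues `m`. -/
structure EigenFrame (S g : ℝ) (H O : Matrix (Fin 3) (Fin 3) ℝ) (m : Fin 3 → ℝ) : Prop where
  col : Oᵀ * O = 1
  row : O * Oᵀ = 1
  diag : H = O * diagonal m * Oᵀ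
  eigen : EigenData S g (m 0) (m 1) (m 2)

lemma HessData.exists_eigenFrame {S g : ℝ} {H : Matrix (Fin 3) (Fin 3) ℝ} (h : HessData S g H) :
    ∃ O m, EigenFrame S g H O m := by
  have hH : H.IsHermitian := by
    ext i j
    simpa using h.symm j i
  let O : Matrix (Fin 3) (Fin 3) ℝ := hH.eigenvectorUnitary
  have hcol : Oᵀ * O = 1 := by
    have := Unitary.coe_star_mul_self hH.eigenvectorUnitary
    rwa [star_eq_conjTranspose, conjTranspose_eq_transpose_of_trivial] at this
  have hrow : O * Oᵀ = 1 := mul_eq_one_comm.1 hcol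
  have hdiag : H = O * diagonal hH.eigenvalues * Oᵀ := by
    have := hH.spectral_theorem
    rw [Unitary.conjStarAlgAut_apply] at this
    simpa [star_eq_conjTranspose, conjTranspose_eq_transpose_of_trivial] using this
  refine ⟨O, hH.eigenvalues, hcol, hrow, hdiag, h.S_pos, h.g_pos, ?_, ?_⟩
  · have h1 : trace H = trace (diagonal hH.eigenvalues) := by
      conv_lhs => rw [hdiag]
      rw [trace_mul_comm, ← Matrix.mul_assoc, hcol, Matrix.one_mul]
    have h2 := h.trace_eq
    rw [trace_diagonal, Fin.sum_univ_three] at h1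
    rw [← h1, ← h2]; rfl
  · have h1 : trace (H * H)
        = trace (diagonal hH.eigenvalues * diagonal hH.eigenvalues) := by
      conv_lhs => rw [hdiag]
      rw [show O * diagonal hH.eigenvalues * Oᵀ * (O * diagonal hH.eigenvalues * Oᵀ)
        = O * (diagonal hH.eigenvalues * (Oᵀ * O) * diagonal hH.eigenvalues * Oᵀ) by
          simp only [Matrix.mul_assoc], hcol, trace_mul_comm, Matrix.mul_one,
        Matrix.mul_assoc _ Oᵀ O, hcol, Matrix.mul_one]
    have h2 : trace (H * H) = ∑ i, ∑ j, H i j ^ 2 := by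
      simp only [trace, Matrix.diag_apply, mul_apply]
      refine Finset.sum_congr rfl fun i _ => Finset.sum_congr rfl fun j _ => ?_
      rw [h.symm j i, sq]
    rw [diagonal_mul_diagonal, trace_diagonal, Fin.sum_univ_three] at h1
    rw [← h.sq_eq, ← h2, h1]
    ring

namespace EigenFrame

variable {S g : ℝ} {H O : Matrix (Fin 3) (Fin 3) ℝ} {m : Fin 3 → ℝ}

lemma dot (h : EigenFrame S g H O m) (ξ η : Fin 3 → ℝ) :
    (Oᵀ *ᵥ ξ) ⬝ᵥ (Oᵀ *ᵥ η) = ξ ⬝ᵥ η := by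
  rw [dotProduct_mulVec, vecMul_transpose, mulVec_mulVec, h.row, one_mulVec]

lemma mulVec (h : EigenFrame S g H O m) (ξ : Fin 3 → ℝ) (a : Fin 3) :
    (Oᵀ *ᵥ (H *ᵥ ξ)) a = m a * (Oᵀ *ᵥ ξ) a := by
  rw [h.diag, mulVec_mulVec, ← Matrix.mul_assoc, ← Matrix.mul_assoc, h.col, Matrix.one_mul,
    ← mulVec_mulVec, mulVec_diagonal]

lemma coeff_pos (h : EigenFrame S g H O m) (a : Fin 3) : 0 < S - g - m a := by
  fin_cases a
  · exact h.eigen.coeff_pos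
  · exact h.eigen.rotate.coeff_pos
  · exact h.eigen.rotate.rotate.coeff_pos

lemma coeff_le (h : EigenFrame S g H O m) (a : Fin 3) : S - g - m a ≤ 2 * S := by
  fin_cases a
  · exact h.eigen.coeff_le
  · exact h.eigen.rotate.coeff_le
  · exact h.eigen.rotate.rotate.coeff_le

lemma coeff_lower (h : EigenFrame S g H O m) (a : Fin 3) : g ^ 2 ≤ 2 * S * (S - g - m a) := by
  have key : ∀ {a b c : ℝ}, EigenData S g a b c → g ^ 2 ≤ 2 * S * (S - g - a) := fun h => by
    nlinarith [h.coeff_lower, mul_nonneg h.g_pos.le h.coeff_pos.le]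
  fin_cases a
  · exact key h.eigen
  · exact key h.eigen.rotate
  · exact key h.eigen.rotate.rotate

lemma quadForm_eq (h : EigenFrame S g H O m) (ξ η : Fin 3 → ℝ) :
    quadForm (linCoeff S g H) ξ η
      = ∑ a, (S - g - m a) * ((Oᵀ *ᵥ ξ) a * (Oᵀ *ᵥ η) a) := by
  have h1 : quadForm (linCoeff S g H) ξ η = (S - g) * (ξ ⬝ᵥ η) - ξ ⬝ᵥ (H *ᵥ η) := by
    simp only [quadForm, linCoeff, dotProduct, Matrix.mulVec, Finset.mul_sum,
      ← Finset.sum_sub_distrib]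
    refine Finset.sum_congr rfl fun i _ => ?_
    rw [Finset.sum_congr rfl (fun j _ => show
      ((S - g) * (if i = j then 1 else 0) - H i j) * ξ i * η j
        = (if i = j then (S - g) * (ξ i * η j) else 0) - ξ i * (H i j * η j) by
          split_ifs <;> ring), Finset.sum_sub_distrib]
    simp
  rw [h1, ← h.dot ξ η, ← h.dot ξ (H *ᵥ η)]
  simp only [dotProduct, h.mulVec, Finset.mul_sum, ← Finset.sum_sub_distrib]
  exact Finset.sum_congr rfl fun a _ => by ring

lemma traceFHH_eq (h : EigenFrame S g H O m) :
    traceFHH S g H = ∑ a, (S - g - m a) * m a ^ 2 := by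
  have hs : Hᵀ = H := by
    rw [h.diag]; simp [Matrix.mul_assoc]
  have hr : ∀ k a, (Oᵀ *ᵥ (H k)) a = m a * O k a := by
    intro k a
    have : H k = H *ᵥ Pi.single k 1 := by
      rw [mulVec_single_one]
      ext i
      exact congrFun (congrFun hs.symm k) i
    rw [this, h.mulVec, mulVec_single_one]
    rfl
  have hc : ∀ a, ∑ k, O k a * O k a = 1 := by
    intro a
    have := congrFun (congrFun h.col a) a
    simpa [mul_apply] using this
  simp only [traceFHH, h.quadForm_eq, hr]
  rw [Finset.sum_comm]
  refine Finset.sum_congr rfl fun a _ => ?_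
  calc ∑ k, (S - g - m a) * (m a * O k a * (m a * O k a))
      = ∑ k, (S - g - m a) * m a ^ 2 * (O k a * O k a) :=
        Finset.sum_congr rfl fun k _ => by ring
    _ = _ := by rw [← Finset.mul_sum, hc, mul_one]

lemma volDensity_eq (h : EigenFrame S g H O m) :
    volDensity S g H = (S - g - m 0) * (S - g - m 1) * (S - g - m 2) := by
  have := h.eigen.three_prod_eq
  rw [volDensity, h.traceFHH_eq, Fin.sum_univ_three]
  linarith

lemma coeff_mul_eq (h : EigenFrame S g H O m) (a : Fin 3) :
    (S - g - m a) * (3 * g ^ 2 / 4 + (m a - g / 2) ^ 2) = volDensity S g H := by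
  rw [h.volDensity_eq]
  fin_cases a
  · exact h.eigen.coeff_mul_eq
  · exact h.eigen.rotate.coeff_mul_eq.trans (by ring)
  · exact h.eigen.rotate.rotate.coeff_mul_eq.trans (by ring)

end EigenFrame

namespace HessData

variable {S g : ℝ} {H : Matrix (Fin 3) (Fin 3) ℝ}

lemma three_mul_le (h : HessData S g H) : 3 * g ≤ S := by
  obtain ⟨O, m, hf⟩ := h.exists_eigenFrame
  exact hf.eigen.three_mul_le

lemma quadForm_nonneg (h : HessData S g H) (ξ : Fin 3 → ℝ) :
    0 ≤ quadForm (linCoeff S g H) ξ ξ := by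
  obtain ⟨O, m, hf⟩ := h.exists_eigenFrame
  rw [hf.quadForm_eq]
  exact Finset.sum_nonneg fun a _ => mul_nonneg (hf.coeff_pos a).le (mul_self_nonneg _)

lemma quadForm_le (h : HessData S g H) (ξ : Fin 3 → ℝ) :
    quadForm (linCoeff S g H) ξ ξ ≤ 2 * S * ∑ i, ξ i ^ 2 := by
  obtain ⟨O, m, hf⟩ := h.exists_eigenFrame
  have : ∑ i, ξ i ^ 2 = ∑ a, (Oᵀ *ᵥ ξ) a ^ 2 := by
    have := hf.dot ξ ξ
    simp only [dotProduct, ← sq] at this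
    exact this.symm
  rw [hf.quadForm_eq, this, Finset.mul_sum]
  refine Finset.sum_le_sum fun a _ => ?_
  rw [← sq]
  exact mul_le_mul_of_nonneg_right (hf.coeff_le a) (sq_nonneg _)

lemma le_quadForm (h : HessData S g H) (ξ : Fin 3 → ℝ) :
    g ^ 2 * ∑ i, ξ i ^ 2 ≤ 2 * S * quadForm (linCoeff S g H) ξ ξ := by
  obtain ⟨O, m, hf⟩ := h.exists_eigenFrame
  have : ∑ i, ξ i ^ 2 = ∑ a, (Oᵀ *ᵥ ξ) a ^ 2 := by
    have := hf.dot ξ ξ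
    simp only [dotProduct, ← sq] at this
    exact this.symm
  rw [hf.quadForm_eq, this, Finset.mul_sum, Finset.mul_sum]
  refine Finset.sum_le_sum fun a _ => ?_
  rw [← sq, ← mul_assoc]
  exact mul_le_mul_of_nonneg_right (hf.coeff_lower a) (sq_nonneg _)

lemma volDensity_ge (h : HessData S g H) : g ^ 2 * S ≤ 4 * volDensity S g H := by
  obtain ⟨O, m, hf⟩ := h.exists_eigenFrame
  rw [hf.volDensity_eq]
  exact hf.eigen.prod_ge

/-- `F` is bounded on gradients of `|Du|² / 2` by the trace of `F H²`. -/
lemma quadForm_mulVec_le (h : HessData S g H) (y : Fin 3 → ℝ) :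
    quadForm (linCoeff S g H) (fun i => ∑ k, H i k * y k) (fun i => ∑ k, H i k * y k)
      ≤ traceFHH S g H * ∑ i, y i ^ 2 := by
  obtain ⟨O, m, hf⟩ := h.exists_eigenFrame
  have : ∑ i, y i ^ 2 = ∑ a, (Oᵀ *ᵥ y) a ^ 2 := by
    have := hf.dot y y
    simp only [dotProduct, ← sq] at this
    exact this.symm
  have e : (fun i => ∑ k, H i k * y k) = H *ᵥ y := rfl
  rw [hf.quadForm_eq, this, hf.traceFHH_eq, e, Finset.sum_mul]
  refine Finset.sum_le_sum fun a _ => ?_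
  rw [hf.mulVec, ← sq, mul_pow, ← mul_assoc]
  refine mul_le_mul_of_nonneg_left ?_ (mul_nonneg (hf.coeff_pos a).le (sq_nonneg _))
  exact Finset.single_le_sum (f := fun a => (Oᵀ *ᵥ y) a ^ 2) (fun _ _ => sq_nonneg _)
    (Finset.mem_univ a)

/-- A linear map whose Gram matrix is the metric of the gradient graph. -/
lemma exists_sqrt_metric (h : HessData S g H) :
    ∃ Q : Matrix (Fin 3) (Fin 3) ℝ, |Q.det| = volDensity S g H ∧
      ∀ x : Fin 3 → ℝ, ∑ i, (Q *ᵥ x) i ^ 2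
        = 3 * g ^ 2 / 4 * ∑ i, x i ^ 2 + ∑ i, (∑ k, H i k * x k - g / 2 * x i) ^ 2 := by
  obtain ⟨O, m, hf⟩ := h.exists_eigenFrame
  have hp : ∀ a, 0 ≤ 3 * g ^ 2 / 4 + (m a - g / 2) ^ 2 := fun a => by positivity
  refine ⟨diagonal (fun a => √(3 * g ^ 2 / 4 + (m a - g / 2) ^ 2)) * Oᵀ, ?_, fun x => ?_⟩
  · have hV : 0 ≤ volDensity S g H := by
      nlinarith [h.volDensity_ge, h.S_pos, mul_nonneg (sq_nonneg g) h.S_pos.le]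
    rw [← abs_of_nonneg hV, ← sq_eq_sq_iff_abs_eq_abs, det_mul, mul_pow]
    have hO : Oᵀ.det ^ 2 = 1 := by
      have := congrArg det hf.col
      rwa [det_mul, det_transpose, det_one, ← sq, ← det_transpose] at this
    rw [hO, mul_one, det_diagonal, Fin.prod_univ_three, mul_pow, mul_pow,
      Real.sq_sqrt (hp _), Real.sq_sqrt (hp _), Real.sq_sqrt (hp _)]
    have e0 := hf.coeff_mul_eq 0
    have e1 := hf.coeff_mul_eq 1
    have e2 := hf.coeff_mul_eq 2
    have p : 0 < (S - g - m 0) * (S - g - m 1) * (S - g - m 2) :=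
      mul_pos (mul_pos (hf.coeff_pos 0) (hf.coeff_pos 1)) (hf.coeff_pos 2)
    refine mul_left_cancel₀ p.ne' ?_
    calc _ = ((S - g - m 0) * (3 * g ^ 2 / 4 + (m 0 - g / 2) ^ 2))
          * ((S - g - m 1) * (3 * g ^ 2 / 4 + (m 1 - g / 2) ^ 2))
          * ((S - g - m 2) * (3 * g ^ 2 / 4 + (m 2 - g / 2) ^ 2)) := by ring
      _ = _ := by rw [e0, e1, e2, hf.volDensity_eq]; ring
  · have h1 : ∑ i, x i ^ 2 = ∑ a, (Oᵀ *ᵥ x) a ^ 2 := by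
      have := hf.dot x x
      simp only [dotProduct, ← sq] at this
      exact this.symm
    have h2 : ∑ i, (∑ k, H i k * x k - g / 2 * x i) ^ 2
        = ∑ a, ((m a - g / 2) * (Oᵀ *ᵥ x) a) ^ 2 := by
      have := hf.dot (H *ᵥ x - (g / 2) • x) (H *ᵥ x - (g / 2) • x)
      simp only [dotProduct, ← sq, mulVec_sub, mulVec_smul, Pi.sub_apply, hf.mulVec,
        Pi.smul_apply, smul_eq_mul] at this
      simp only [sub_mul]
      exact this.symm
    rw [h1, h2, Finset.mul_sum, ← Finset.sum_add_distrib]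
    refine Finset.sum_congr rfl fun a _ => ?_
    rw [← mulVec_mulVec, mulVec_diagonal, mul_pow, Real.sq_sqrt (hp a)]
    ring

set_option maxHeartbeats 400000 in
/-- The gradient of the squared extrinsic distance `f₀|x|² + |Y|²` on the gradient graph, measured
by `F`, with a perturbation of the coefficients. -/
lemma quadForm_grad_dist_le (h : HessData S g H) {P g₀ B : ℝ} (hP : 1 ≤ P) (hg : 1 ≤ P * g)
    (hg₀ : 1 ≤ P * g₀) (hB : 0 ≤ B) (h₁ : |g - g₀| ≤ B) (h₂ : |g ^ 2 - g₀ ^ 2| ≤ B)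
    (x y : Fin 3 → ℝ) :
    quadForm (linCoeff S g H)
        (fun i => 3 * g₀ ^ 2 / 4 * x i + (∑ k, H i k * y k - g₀ / 2 * y i))
        (fun i => 3 * g₀ ^ 2 / 4 * x i + (∑ k, H i k * y k - g₀ / 2 * y i))
      ≤ volDensity S g H * (3 * g₀ ^ 2 / 4 * ∑ i, x i ^ 2 + ∑ i, y i ^ 2)
          * ((1 + 2 * B) * (1 + 2 * P ^ 2 * B) + 4 * P ^ 4 * (B + 2 * B ^ 2)) := by
  obtain ⟨O, m, hf⟩ := h.exists_eigenFrame
  have hx : ∑ i, x i ^ 2 = ∑ a, (Oᵀ *ᵥ x) a ^ 2 := by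
    have := hf.dot x x
    simp only [dotProduct, ← sq] at this
    exact this.symm
  have hy : ∑ i, y i ^ 2 = ∑ a, (Oᵀ *ᵥ y) a ^ 2 := by
    have := hf.dot y y
    simp only [dotProduct, ← sq] at this
    exact this.symm
  have e : (fun i => 3 * g₀ ^ 2 / 4 * x i + (∑ k, H i k * y k - g₀ / 2 * y i))
      = (3 * g₀ ^ 2 / 4) • x + (H *ᵥ y - (g₀ / 2) • y) := rfl
  rw [hf.quadForm_eq, hx, hy, e, Finset.mul_sum, ← Finset.sum_add_distrib, Finset.mul_sum,
    Finset.sum_mul]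
  refine Finset.sum_le_sum fun a _ => ?_
  have hF := hf.coeff_pos a
  have hFV := hf.coeff_mul_eq a
  simp only [mulVec_add, mulVec_sub, mulVec_smul, Pi.add_apply, Pi.sub_apply, hf.mulVec,
    Pi.smul_apply, smul_eq_mul]
  obtain ⟨X, hX⟩ : ∃ X, X = (Oᵀ *ᵥ x) a := ⟨_, rfl⟩
  obtain ⟨Y, hY⟩ : ∃ Y, Y = (Oᵀ *ᵥ y) a := ⟨_, rfl⟩
  obtain ⟨V, hV⟩ : ∃ V, V = volDensity S g H := ⟨_, rfl⟩
  obtain ⟨F, hFd⟩ : ∃ F, F = S - g - m a := ⟨_, rfl⟩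
  obtain ⟨l, hl⟩ : ∃ l, l = m a - g / 2 := ⟨_, rfl⟩
  obtain ⟨f, hfd⟩ : ∃ f, f = 3 * g ^ 2 / 4 := ⟨_, rfl⟩
  obtain ⟨f₀, hf₀⟩ : ∃ f, f = 3 * g₀ ^ 2 / 4 := ⟨_, rfl⟩
  obtain ⟨τ, hτ⟩ : ∃ τ, τ = (g - g₀) / 2 := ⟨_, rfl⟩
  obtain ⟨α, hα⟩ : ∃ α, α = f₀ - f := ⟨_, rfl⟩
  rw [← hX, ← hY, ← hV, ← hFd, ← hf₀]
  rw [← hl, ← hV, ← hFd, ← hfd] at hFV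
  rw [← hFd] at hF
  have ev : f₀ * X + (m a * Y - g₀ / 2 * Y) = (f * X + l * Y) + (α * X + τ * Y) := by
    rw [hl, hα, hτ]; ring
  have hτB : |τ| ≤ B := by
    rw [hτ, abs_div, abs_two]; linarith [abs_nonneg (g - g₀)]
  have hαB : |α| ≤ B := by
    rw [hα, hf₀, hfd, abs_sub_comm, show 3 * g ^ 2 / 4 - 3 * g₀ ^ 2 / 4
      = 3 / 4 * (g ^ 2 - g₀ ^ 2) by ring, abs_mul, abs_of_pos (by norm_num : (0:ℝ) < 3 / 4)]
    linarith [abs_nonneg (g ^ 2 - g₀ ^ 2)]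
  have hfP : 1 ≤ 2 * P ^ 2 * f := by
    have : 1 ≤ (P * g) ^ 2 := one_le_pow₀ hg
    rw [hfd]; linear_combination (3 / 2) * this
  have hf₀P : 1 ≤ 2 * P ^ 2 * f₀ := by
    have : 1 ≤ (P * g₀) ^ 2 := one_le_pow₀ hg₀
    rw [hf₀]; linear_combination (3 / 2) * this
  have hV0 : 0 ≤ V := by
    rw [← hFV, hfd]; positivity
  have hFle : F ≤ 2 * P ^ 2 * V := by
    have h1 : F * f ≤ V := by
      rw [← hFV]; linear_combination mul_nonneg hF.le (sq_nonneg l)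
    linear_combination F * hfP + 2 * P ^ 2 * h1
  rw [ev]
  obtain ⟨z, hz⟩ : ∃ z, z = f * X + l * Y := ⟨_, rfl⟩
  have hzV : F * z ^ 2 ≤ V * (f * X ^ 2 + Y ^ 2) := by
    have : z ^ 2 ≤ (f + l ^ 2) * (f * X ^ 2 + Y ^ 2) := by
      have hf0 : 0 ≤ f := by rw [hfd]; positivity
      rw [hz]; linear_combination mul_nonneg hf0 (sq_nonneg (Y - l * X))
    rw [← hFV, mul_assoc]
    exact mul_le_mul_of_nonneg_left this hF.le
  obtain ⟨R, hR⟩ : ∃ R, R = f₀ * X ^ 2 + Y ^ 2 := ⟨_, rfl⟩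
  have hX2 : X ^ 2 ≤ 2 * P ^ 2 * (f₀ * X ^ 2) := by
    linear_combination X ^ 2 * hf₀P
  have hP2 : 1 ≤ 2 * P ^ 2 := by linarith [one_le_pow₀ hP (n := 2)]
  have hXYR : X ^ 2 + Y ^ 2 ≤ 2 * P ^ 2 * R := by
    rw [hR]; linear_combination hX2 + Y ^ 2 * hP2
  have hα' := abs_le.1 hαB
  have hτ' := abs_le.1 hτB
  have hfR : f * X ^ 2 + Y ^ 2 ≤ (1 + 2 * P ^ 2 * B) * R := by
    have h1 : f * X ^ 2 ≤ f₀ * X ^ 2 + B * X ^ 2 := by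
      linear_combination mul_nonneg (by linarith : 0 ≤ α + B) (sq_nonneg X) + X ^ 2 * hα
    have h2 : B * X ^ 2 ≤ B * (2 * P ^ 2 * R) :=
      mul_le_mul_of_nonneg_left (by linarith [sq_nonneg Y]) hB
    rw [add_mul, one_mul]
    calc _ ≤ R + B * X ^ 2 := by rw [hR]; linarith
      _ ≤ _ := by linarith
  have hc : ∀ s w : ℝ, |s| ≤ B → 2 * z * (s * w) ≤ B * (z ^ 2 + w ^ 2) := by
    intro s w hs
    obtain ⟨h1, h2⟩ := abs_le.1 hs
    linear_combination (1 / 2) * mul_nonneg (by linarith : 0 ≤ B - s) (sq_nonneg (z + w))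
      + (1 / 2) * mul_nonneg (by linarith : 0 ≤ B + s) (sq_nonneg (z - w))
  have hsq : ∀ s w : ℝ, |s| ≤ B → (s * w) ^ 2 ≤ B ^ 2 * w ^ 2 := by
    intro s w hs
    rw [mul_pow]
    exact mul_le_mul_of_nonneg_right (sq_le_sq' (abs_le.1 hs).1 (abs_le.1 hs).2) (sq_nonneg w)
  have hv : (z + (α * X + τ * Y)) * (z + (α * X + τ * Y))
      ≤ (1 + 2 * B) * z ^ 2 + (B + 2 * B ^ 2) * (X ^ 2 + Y ^ 2) := by
    have a1 := hc α X hαB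
    have a2 := hc τ Y hτB
    have a3 := hsq α X hαB
    have a4 := hsq τ Y hτB
    linear_combination a1 + a2 + 2 * a3 + 2 * a4 + sq_nonneg (α * X - τ * Y)
  rw [← hz, ← hR]
  have hR0 : 0 ≤ R := by rw [hR, hf₀]; positivity
  calc _ ≤ F * ((1 + 2 * B) * z ^ 2 + (B + 2 * B ^ 2) * (X ^ 2 + Y ^ 2)) :=
        mul_le_mul_of_nonneg_left hv hF.le
    _ = (1 + 2 * B) * (F * z ^ 2) + (B + 2 * B ^ 2) * F * (X ^ 2 + Y ^ 2) := by ring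
    _ ≤ (1 + 2 * B) * (V * ((1 + 2 * P ^ 2 * B) * R))
        + (B + 2 * B ^ 2) * (2 * P ^ 2 * V) * (2 * P ^ 2 * R) := by
          refine add_le_add (mul_le_mul_of_nonneg_left
            (hzV.trans (mul_le_mul_of_nonneg_left hfR hV0)) (by positivity)) ?_
          gcongr
    _ = _ := by ring

end HessData

end

section

open Matrix

/-- The components of a covariant 3-tensor in the frame given by the columns of `O`. -/
def rotateTensor (O : Matrix (Fin 3) (Fin 3) ℝ) (T : Fin 3 → Fin 3 → Fin 3 → ℝ)
    (a b c : Fin 3) : ℝ :=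
  ∑ i, ∑ j, ∑ k, O i a * O j b * O k c * T i j k

lemma rotateTensor_swap₁₂ {O : Matrix (Fin 3) (Fin 3) ℝ} {T : Fin 3 → Fin 3 → Fin 3 → ℝ}
    (hT : ∀ i j k, T i j k = T j i k) (a b c : Fin 3) :
    rotateTensor O T a b c = rotateTensor O T b a c := by
  unfold rotateTensor
  rw [Finset.sum_comm]
  refine Finset.sum_congr rfl fun i _ => Finset.sum_congr rfl fun j _ =>
    Finset.sum_congr rfl fun k _ => ?_
  rw [hT j i k]; ring

lemma rotateTensor_swap₂₃ {O : Matrix (Fin 3) (Fin 3) ℝ} {T : Fin 3 → Fin 3 → Fin 3 → ℝ}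
    (hT : ∀ i j k, T i j k = T i k j) (a b c : Fin 3) :
    rotateTensor O T a b c = rotateTensor O T a c b := by
  unfold rotateTensor
  refine Finset.sum_congr rfl fun i _ => ?_
  rw [Finset.sum_comm]
  refine Finset.sum_congr rfl fun k _ => Finset.sum_congr rfl fun j _ => ?_
  rw [hT i j k]; ring

namespace EigenFrame

variable {S g : ℝ} {H O : Matrix (Fin 3) (Fin 3) ℝ} {m : Fin 3 → ℝ}

lemma sum_sq (h : EigenFrame S g H O m) (v : Fin 3 → ℝ) :
    ∑ a, (∑ i, O i a * v i) ^ 2 = ∑ i, v i ^ 2 := by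
  have := h.dot v v
  simpa only [dotProduct, ← sq, Matrix.mulVec, transpose_apply] using this

lemma sum_rotateTensor_sq (h : EigenFrame S g H O m) (T : Fin 3 → Fin 3 → Fin 3 → ℝ) :
    ∑ a, ∑ b, ∑ c, rotateTensor O T a b c ^ 2 = ∑ i, ∑ j, ∑ k, T i j k ^ 2 := by
  have e : ∀ a b c, rotateTensor O T a b c
      = ∑ i, O i a * ∑ j, O j b * ∑ k, O k c * T i j k := fun a b c => by
    simp only [rotateTensor, Finset.mul_sum, mul_assoc]
  simp only [e]
  calc ∑ a, ∑ b, ∑ c, (∑ i, O i a * ∑ j, O j b * ∑ k, O k c * T i j k) ^ 2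
      = ∑ b, ∑ c, ∑ a, (∑ i, O i a * ∑ j, O j b * ∑ k, O k c * T i j k) ^ 2 := by
        rw [Finset.sum_comm]
        exact Finset.sum_congr rfl fun b _ => Finset.sum_comm
    _ = ∑ b, ∑ c, ∑ i, (∑ j, O j b * ∑ k, O k c * T i j k) ^ 2 := by
        simp only [h.sum_sq]
    _ = ∑ c, ∑ i, ∑ b, (∑ j, O j b * ∑ k, O k c * T i j k) ^ 2 := by
        rw [Finset.sum_comm]
        exact Finset.sum_congr rfl fun c _ => Finset.sum_comm
    _ = ∑ c, ∑ i, ∑ j, (∑ k, O k c * T i j k) ^ 2 := by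
        simp only [h.sum_sq]
    _ = ∑ i, ∑ j, ∑ c, (∑ k, O k c * T i j k) ^ 2 := by
        rw [Finset.sum_comm]
        exact Finset.sum_congr rfl fun c _ => Finset.sum_comm
    _ = _ := by simp only [h.sum_sq]

lemma weighted_trace (T : Fin 3 → Fin 3 → Fin 3 → ℝ) (f : Fin 3 → ℝ) (c : Fin 3) :
    ∑ a, f a * rotateTensor O T a a c
      = ∑ k, O k c * ∑ i, ∑ j, (O * diagonal f * Oᵀ) i j * T i j k := by
  have e : ∀ i j, (O * diagonal f * Oᵀ) i j = ∑ a, O i a * f a * O j a := fun i j => by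
    rw [mul_apply]; simp only [mul_diagonal, transpose_apply]
  simp only [rotateTensor, e, Finset.mul_sum, Finset.sum_mul]
  rw [Finset.sum_comm]
  calc _ = ∑ i, ∑ j, ∑ k, ∑ a, f a * (O i a * O j a * O k c * T i j k) := by
        refine Finset.sum_congr rfl fun i _ => ?_
        rw [Finset.sum_comm]
        exact Finset.sum_congr rfl fun j _ => Finset.sum_comm
    _ = ∑ k, ∑ i, ∑ j, ∑ a, f a * (O i a * O j a * O k c * T i j k) := by
        rw [Finset.sum_comm]
        conv_rhs => rw [Finset.sum_comm]
        rw [Finset.sum_comm]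
        exact Finset.sum_congr rfl fun i _ => Finset.sum_comm
    _ = _ := by
        refine Finset.sum_congr rfl fun k _ => Finset.sum_congr rfl fun i _ =>
          Finset.sum_congr rfl fun j _ => Finset.sum_congr rfl fun a _ => ?_
        ring

end EigenFrame

/-- For a symmetric tensor, `∑ T² - |tr T|²` splits into contributions of each index. -/
lemma sum_sq_sub_trace_sq_ge {T : Fin 3 → Fin 3 → Fin 3 → ℝ}
    (h₁ : ∀ i j k, T i j k = T j i k) (h₂ : ∀ i j k, T i j k = T i k j) {d : Fin 3 → ℝ}
    (d0 : d 0 ≤ T 0 0 0 ^ 2 + 3 * T 1 1 0 ^ 2 + 3 * T 2 2 0 ^ 2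
      - (T 0 0 0 + T 1 1 0 + T 2 2 0) ^ 2)
    (d1 : d 1 ≤ T 1 1 1 ^ 2 + 3 * T 2 2 1 ^ 2 + 3 * T 0 0 1 ^ 2
      - (T 1 1 1 + T 2 2 1 + T 0 0 1) ^ 2)
    (d2 : d 2 ≤ T 2 2 2 ^ 2 + 3 * T 0 0 2 ^ 2 + 3 * T 1 1 2 ^ 2
      - (T 2 2 2 + T 0 0 2 + T 1 1 2) ^ 2) :
    ∑ c, d c ≤ ∑ i, ∑ j, ∑ k, T i j k ^ 2 - ∑ c, (∑ a, T a a c) ^ 2 := by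
  simp only [Fin.sum_univ_three]
  have e1 : T 0 1 0 = T 0 0 1 := h₂ 0 1 0
  have e2 : T 1 0 0 = T 0 0 1 := (h₁ 1 0 0).trans e1
  have e3 : T 0 2 0 = T 0 0 2 := h₂ 0 2 0
  have e4 : T 2 0 0 = T 0 0 2 := (h₁ 2 0 0).trans e3
  have e5 : T 1 0 1 = T 1 1 0 := h₂ 1 0 1
  have e6 : T 0 1 1 = T 1 1 0 := (h₁ 0 1 1).trans e5
  have e7 : T 1 2 1 = T 1 1 2 := h₂ 1 2 1
  have e8 : T 2 1 1 = T 1 1 2 := (h₁ 2 1 1).trans e7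
  have e9 : T 2 0 2 = T 2 2 0 := h₂ 2 0 2
  have e10 : T 0 2 2 = T 2 2 0 := (h₁ 0 2 2).trans e9
  have e11 : T 2 1 2 = T 2 2 1 := h₂ 2 1 2
  have e12 : T 1 2 2 = T 2 2 1 := (h₁ 1 2 2).trans e11
  rw [e1, e2, e3, e4, e5, e6, e7, e8, e9, e10, e11, e12]
  have p1 : 0 ≤ T 0 1 2 ^ 2 + T 0 2 1 ^ 2 + T 1 0 2 ^ 2 + T 1 2 0 ^ 2 + T 2 0 1 ^ 2
    + T 2 1 0 ^ 2 := by positivity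
  linear_combination d0 + d1 + d2 + p1

/-- The pointwise Jacobi inequality for `σ₂ = g σ₁` in dimension three. -/
lemma HessData.jacobi {S g : ℝ} {H : Matrix (Fin 3) (Fin 3) ℝ} (h : HessData S g H) {P : ℝ}
    (hP : 1 ≤ P) (hg : 1 ≤ P * g) {γ : Fin 3 → ℝ} (hγ : ∀ k, |γ k| ≤ P)
    {T : Fin 3 → Fin 3 → Fin 3 → ℝ}
    (h₁ : ∀ i j k, T i j k = T j i k) (h₂ : ∀ i j k, T i j k = T i k j)
    (hT : ∀ k, ∑ i, ∑ j, linCoeff S g H i j * T i j k = γ k * S)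
    {w : Fin 3 → ℝ} (hw : ∀ k, w k = ∑ i, T i i k) :
    7 / 6 * quadForm (linCoeff S g H) w w / S - 60000 * P ^ 4 * S ^ 2
      ≤ ∑ i, ∑ j, ∑ k, T i j k ^ 2 - ∑ k, w k ^ 2 := by
  obtain ⟨O, m, hf⟩ := h.exists_eigenFrame
  have hγ' : ∀ c, |∑ k, O k c * γ k| ≤ 2 * P := by
    intro c
    have h1 := hf.sum_sq γ
    have h2 : (∑ k, O k c * γ k) ^ 2 ≤ ∑ a, (∑ i, O i a * γ i) ^ 2 :=
      Finset.single_le_sum (f := fun a => (∑ i, O i a * γ i) ^ 2) (fun _ _ => sq_nonneg _)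
        (Finset.mem_univ c)
    have h3 : ∑ i, γ i ^ 2 ≤ ∑ _i : Fin 3, P ^ 2 := Finset.sum_le_sum fun i _ => by
      rw [← sq_abs]; exact pow_le_pow_left₀ (abs_nonneg _) (hγ i) 2
    simp only [Finset.sum_const, Finset.card_univ, Fintype.card_fin, nsmul_eq_mul] at h3
    push_cast at h3
    refine abs_le_of_sq_le_sq ?_ (by linarith)
    nlinarith [sq_nonneg P]
  have htr : ∀ c, ∑ a, rotateTensor O T a a c = ∑ k, O k c * w k := by
    intro c
    have := EigenFrame.weighted_trace (O := O) T (fun _ => 1) c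
    simp only [one_mul, diagonal_one, Matrix.mul_one, hf.row] at this
    rw [this]
    refine Finset.sum_congr rfl fun k _ => ?_
    rw [hw k]
    simp [Matrix.one_apply]
  have hlin : ∀ c, ∑ a, (S - g - m a) * rotateTensor O T a a c = (∑ k, O k c * γ k) * S := by
    intro c
    have e : O * diagonal (fun a => S - g - m a) * Oᵀ = fun i j => linCoeff S g H i j := by
      have h1 : diagonal (fun a => S - g - m a)
          = (S - g) • (1 : Matrix (Fin 3) (Fin 3) ℝ) - diagonal m := by
        ext i j
        by_cases hij : i = j
        · subst hij; simp
        · simp [hij]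
      rw [h1, Matrix.mul_sub, Matrix.sub_mul, ← hf.diag, mul_smul_comm, smul_mul_assoc,
        Matrix.mul_one, hf.row]
      ext i j
      simp [linCoeff, Matrix.one_apply]
    rw [EigenFrame.weighted_trace, e, Finset.sum_mul]
    refine Finset.sum_congr rfl fun k _ => ?_
    rw [hT k, mul_assoc]
  have hq : quadForm (linCoeff S g H) w w
      = ∑ c, (S - g - m c) * (∑ a, rotateTensor O T a a c) ^ 2 := by
    rw [hf.quadForm_eq]
    refine Finset.sum_congr rfl fun c _ => ?_
    rw [htr c, sq]; rfl
  have hw2 : ∑ k, w k ^ 2 = ∑ c, (∑ a, rotateTensor O T a a c) ^ 2 := by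
    rw [← hf.sum_sq w]
    exact Finset.sum_congr rfl fun c _ => by rw [htr c]
  rw [← hf.sum_rotateTensor_sq, hw2, hq]
  have hP2 : 1 ≤ 2 * P := by linarith
  have hg2 : 1 ≤ 2 * P * g := by nlinarith [h.g_pos]
  have l0 := hlin 0
  have l1 := hlin 1
  have l2 := hlin 2
  simp only [Fin.sum_univ_three (fun a => (S - g - m a) * rotateTensor O T a a _)] at l0 l1 l2
  have j0 := hf.eigen.jacobi hP2 hg2 (hγ' 0) l0
  have j1 := hf.eigen.rotate.jacobi hP2 hg2 (hγ' 1) (t₁ := rotateTensor O T 1 1 1)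
    (t₂ := rotateTensor O T 2 2 1) (t₃ := rotateTensor O T 0 0 1) (by rw [← l1]; ring)
  have j2 := hf.eigen.rotate.rotate.jacobi hP2 hg2 (hγ' 2) (t₁ := rotateTensor O T 2 2 2)
    (t₂ := rotateTensor O T 0 0 2) (t₃ := rotateTensor O T 1 1 2) (by rw [← l2]; ring)
  have key := sum_sq_sub_trace_sq_ge (T := rotateTensor O T) (rotateTensor_swap₁₂ h₁)
    (rotateTensor_swap₂₃ h₂)
    (d := fun c => 7 / 6 * ((S - g - m c) / S) * (∑ a, rotateTensor O T a a c) ^ 2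
      - 1100 * (2 * P) ^ 4 * S ^ 2)
    (le_trans (le_of_eq (by simp only [Fin.sum_univ_three])) j0)
    (le_trans (le_of_eq (by simp only [Fin.sum_univ_three]; ring)) j1)
    (le_trans (le_of_eq (by simp only [Fin.sum_univ_three]; ring)) j2)
  refine le_trans ?_ key
  rw [Finset.sum_sub_distrib]
  simp only [Finset.sum_const, Finset.card_univ, Fintype.card_fin, nsmul_eq_mul]
  have e2 : 7 / 6 * (∑ c, (S - g - m c) * (∑ a, rotateTensor O T a a c) ^ 2) / S
      = ∑ c, 7 / 6 * ((S - g - m c) / S) * (∑ a, rotateTensor O T a a c) ^ 2 := by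
    rw [Finset.mul_sum, Finset.sum_div]
    exact Finset.sum_congr rfl fun c _ => by ring
  rw [e2]
  have : 0 ≤ P ^ 4 * S ^ 2 := by positivity
  push_cast
  linarith

end

section

open MeasureTheory

/-- The `i`-th partial derivative. -/
noncomputable def pd (i : Fin 3) (f : (Fin 3 → ℝ) → ℝ) (x : Fin 3 → ℝ) : ℝ :=
  fderiv ℝ f x (Pi.single i 1)

/-- The gradient as a coordinate vector. -/
noncomputable def grad (f : (Fin 3 → ℝ) → ℝ) (x : Fin 3 → ℝ) (i : Fin 3) : ℝ := pd i f x

section PartialDerivatives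

variable {f g : (Fin 3 → ℝ) → ℝ} {x : Fin 3 → ℝ} (i : Fin 3)

lemma pd_const (c : ℝ) : pd i (fun _ => c) x = 0 := by simp [pd]

lemma pd_coord (j : Fin 3) : pd i (fun y => y j) x = if i = j then 1 else 0 := by
  have h : HasFDerivAt (fun y : Fin 3 → ℝ => y j)
      (ContinuousLinearMap.proj (R := ℝ) (φ := fun _ : Fin 3 => ℝ) j) x :=
    (ContinuousLinearMap.proj (R := ℝ) (φ := fun _ : Fin 3 => ℝ) j).hasFDerivAt
  rw [pd, h.fderiv, ContinuousLinearMap.proj_apply, Pi.single_apply]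
  simp only [eq_comm]

lemma pd_add (hf : DifferentiableAt ℝ f x) (hg : DifferentiableAt ℝ g x) :
    pd i (fun y => f y + g y) x = pd i f x + pd i g x := by
  simp only [pd]
  rw [fderiv_fun_add hf hg]; rfl

lemma pd_sub (hf : DifferentiableAt ℝ f x) (hg : DifferentiableAt ℝ g x) :
    pd i (fun y => f y - g y) x = pd i f x - pd i g x := by
  simp only [pd]
  rw [fderiv_fun_sub hf hg]; rfl

lemma pd_mul (hf : DifferentiableAt ℝ f x) (hg : DifferentiableAt ℝ g x) :
    pd i (fun y => f y * g y) x = f x * pd i g x + g x * pd i f x := by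
  simp only [pd]
  rw [fderiv_fun_mul hf hg]; rfl

lemma pd_const_mul (hf : DifferentiableAt ℝ f x) (c : ℝ) :
    pd i (fun y => c * f y) x = c * pd i f x := by
  rw [pd_mul i (differentiableAt_const c) hf, pd_const]; ring

lemma pd_sum {ι : Type*} {s : Finset ι} {f : ι → (Fin 3 → ℝ) → ℝ}
    (hf : ∀ k ∈ s, DifferentiableAt ℝ (f k) x) :
    pd i (fun y => ∑ k ∈ s, f k y) x = ∑ k ∈ s, pd i (f k) x := by
  simp only [pd]
  rw [fderiv_fun_sum hf, _root_.sum_apply]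

lemma pd_comp {φ : ℝ → ℝ} {a : ℝ} (hφ : HasDerivAt φ a (f x)) (hf : DifferentiableAt ℝ f x) :
    pd i (fun y => φ (f y)) x = a * pd i f x := by
  have := (hφ.comp_hasFDerivAt x hf.hasFDerivAt).fderiv
  simp only [pd]
  rw [show (fun y => φ (f y)) = φ ∘ f from rfl, this]
  simp

lemma ContDiff.pd {n m : WithTop ℕ∞} (hf : ContDiff ℝ n f) (hmn : m + 1 ≤ n) :
    ContDiff ℝ m (pd i f) :=
  (hf.fderiv_right hmn).clm_apply contDiff_const

lemma pd_comm (hf : ContDiff ℝ 2 f) (j : Fin 3) :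
    pd i (pd j f) x = pd j (pd i f) x := by
  have hd : DifferentiableAt ℝ (fderiv ℝ f) x :=
    ((hf.fderiv_right (m := 1) le_rfl).differentiable one_ne_zero) x
  have key : ∀ k l, _root_.pd k (_root_.pd l f) x
      = fderiv ℝ (fderiv ℝ f) x (Pi.single k 1) (Pi.single l 1) := fun k l => by
    change fderiv ℝ (fun y => fderiv ℝ f y (Pi.single l 1)) x (Pi.single k 1) = _
    rw [fderiv_clm_apply hd (differentiableAt_const _)]
    simp
  rw [key, key]
  exact second_derivative_symmetric
    (fun y => (hf.differentiable two_ne_zero y).hasFDerivAt) hd.hasFDerivAt _ _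

lemma pd_congr {U : Set (Fin 3 → ℝ)} (hU : IsOpen U) (h : ∀ y ∈ U, f y = g y) (hx : x ∈ U) :
    pd i f x = pd i g x := by
  simp only [pd]
  rw [Filter.EventuallyEq.fderiv_eq (Filter.eventuallyEq_of_mem (hU.mem_nhds hx) h)]

lemma continuous_pd (hf : ContDiff ℝ 1 f) : Continuous (pd i f) :=
  (hf.pd i (m := 0) (by norm_num)).continuous

end PartialDerivatives

lemma isOpen_compl_closedBall' (r : ℝ) : IsOpen (closedBall (0 : Fin 3 → ℝ) r)ᶜ :=
  isClosed_closedBall.isOpen_compl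

lemma pd_eq_zero_of_support {r : ℝ} {f : (Fin 3 → ℝ) → ℝ}
    (hs : ∀ x ∉ closedBall (0 : Fin 3 → ℝ) r, f x = 0) (i : Fin 3) :
    ∀ x ∉ closedBall (0 : Fin 3 → ℝ) r, pd i f x = 0 := fun x hx => by
  rw [pd_congr i (isOpen_compl_closedBall' r) hs hx, pd_const]

lemma integral_pd_eq_zero {r : ℝ} {f : (Fin 3 → ℝ) → ℝ} (hf : ContDiff ℝ 1 f)
    (hs : ∀ x ∉ closedBall (0 : Fin 3 → ℝ) r, f x = 0) (i : Fin 3) :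
    ∫ x in closedBall (0 : Fin 3 → ℝ) r, pd i f x = 0 := by
  have hc : HasCompactSupport f :=
    HasCompactSupport.intro (isCompact_closedBall 0 r) hs
  have hc' : HasCompactSupport (pd i f) :=
    HasCompactSupport.intro (isCompact_closedBall 0 r) (pd_eq_zero_of_support hs i)
  rw [setIntegral_eq_integral_of_forall_compl_eq_zero (pd_eq_zero_of_support hs i)]
  have h1 : Integrable f := hf.continuous.integrable_of_hasCompactSupport hc
  have h2 : Integrable (pd i f) := (continuous_pd i hf).integrable_of_hasCompactSupport hc'
  have := integral_mul_fderiv_eq_neg_fderiv_mul_of_integrable (μ := volume)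
    (f := fun _ : Fin 3 → ℝ => (1 : ℝ)) (g := f) (v := Pi.single i 1)
    (by simp) (by simp only [one_mul]; exact h2) (by simpa using h1)
    (fun x _ => differentiableAt_const _) (fun x _ => hf.differentiable one_ne_zero x)
  simpa [pd] using this

/-- The divergence form operator `div (F ∇v)`. -/
noncomputable def divF (F : (Fin 3 → ℝ) → Fin 3 → Fin 3 → ℝ) (v : (Fin 3 → ℝ) → ℝ)
    (x : Fin 3 → ℝ) : ℝ :=
  ∑ i, pd i (fun y => ∑ j, F y i j * pd j v y) x

section Divergence

variable {F : (Fin 3 → ℝ) → Fin 3 → Fin 3 → ℝ} {v w : (Fin 3 → ℝ) → ℝ}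

lemma contDiff_flux (hF : ∀ i j, ContDiff ℝ 1 (fun x => F x i j)) (hv : ContDiff ℝ 2 v)
    (i : Fin 3) : ContDiff ℝ 1 (fun y => ∑ j, F y i j * pd j v y) :=
  ContDiff.sum fun j _ => (hF i j).mul (hv.pd j le_rfl)

lemma continuous_divF (hF : ∀ i j, ContDiff ℝ 1 (fun x => F x i j)) (hv : ContDiff ℝ 2 v) :
    Continuous (divF F v) :=
  continuous_finsetSum _ fun i _ => continuous_pd i (contDiff_flux hF hv i)

/-- Green's formula. -/
lemma integral_divF {r : ℝ} {a : (Fin 3 → ℝ) → ℝ} (hF : ∀ i j, ContDiff ℝ 1 (fun x => F x i j))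
    (hv : ContDiff ℝ 2 v) (ha : ContDiff ℝ 1 a)
    (hs : (∀ x ∉ closedBall (0 : Fin 3 → ℝ) r, a x = 0) ∨
      ∀ x ∉ closedBall (0 : Fin 3 → ℝ) r, v x = 0) :
    ∫ x in closedBall (0 : Fin 3 → ℝ) r,
      (a x * divF F v x + quadForm (F x) (grad a x) (grad v x)) = 0 := by
  have hX : ∀ i, ContDiff ℝ 1 (fun y => a y * ∑ j, F y i j * pd j v y) := fun i =>
    ha.mul (contDiff_flux hF hv i)
  have hpt : ∀ x, a x * divF F v x + quadForm (F x) (grad a x) (grad v x)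
      = ∑ i, pd i (fun y => a y * ∑ j, F y i j * pd j v y) x := fun x => by
    have : ∀ i, pd i (fun y => a y * ∑ j, F y i j * pd j v y) x
        = a x * pd i (fun y => ∑ j, F y i j * pd j v y) x
          + (∑ j, F x i j * pd j v x) * pd i a x := fun i =>
      pd_mul i (ha.differentiable one_ne_zero x)
        ((contDiff_flux hF hv i).differentiable one_ne_zero x)
    rw [Finset.sum_congr rfl fun i _ => this i, Finset.sum_add_distrib, ← Finset.mul_sum]
    refine congrArg₂ _ rfl (Finset.sum_congr rfl fun i _ => ?_)
    rw [Finset.sum_mul]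
    exact Finset.sum_congr rfl fun j _ => by simp only [grad]; ring
  simp only [hpt]
  rw [integral_finsetSum _ fun i _ =>
    ((continuous_pd i (hX i)).continuousOn.integrableOn_compact (isCompact_closedBall 0 r))]
  refine Finset.sum_eq_zero fun i _ => integral_pd_eq_zero (hX i) (fun x hx => ?_) i
  rcases hs with hs | hs
  · rw [hs x hx, zero_mul]
  · simp [pd_eq_zero_of_support hs _ x hx]

lemma quadForm_comm {G : Fin 3 → Fin 3 → ℝ} (hG : ∀ i j, G i j = G j i) (ξ η : Fin 3 → ℝ) :
    quadForm G ξ η = quadForm G η ξ := by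
  unfold quadForm
  rw [Finset.sum_comm]
  exact Finset.sum_congr rfl fun i _ => Finset.sum_congr rfl fun j _ => by rw [hG j i]; ring

lemma continuous_quadForm (hF : ∀ i j, Continuous (fun x => F x i j)) (hv : ContDiff ℝ 1 v)
    (hw : ContDiff ℝ 1 w) : Continuous fun x => quadForm (F x) (grad v x) (grad w x) :=
  continuous_finsetSum _ fun i _ => continuous_finsetSum _ fun j _ =>
    ((hF i j).mul (continuous_pd i hv)).mul (continuous_pd j hw)

/-- The operator `div (F ∇·)` is symmetric. -/
lemma integral_divF_comm {r : ℝ} (hF : ∀ i j, ContDiff ℝ 1 (fun x => F x i j))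
    (hsymm : ∀ x i j, F x i j = F x j i)
    (hv : ContDiff ℝ 2 v) (hw : ContDiff ℝ 2 w)
    (hs : ∀ x ∉ closedBall (0 : Fin 3 → ℝ) r, w x = 0) :
    ∫ x in closedBall (0 : Fin 3 → ℝ) r, (w x * divF F v x - v x * divF F w x) = 0 := by
  have hv1 := hv.of_le one_le_two
  have hw1 := hw.of_le one_le_two
  have e1 := integral_divF hF hv hw1 (Or.inl hs)
  have e2 := integral_divF hF hw hv1 (Or.inr hs)
  have hc := fun i j => (hF i j).continuous
  have i1 : IntegrableOn (fun x => w x * divF F v x + quadForm (F x) (grad w x) (grad v x))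
      (closedBall (0 : Fin 3 → ℝ) r) :=
    ((hw.continuous.mul (continuous_divF hF hv)).add
      (continuous_quadForm hc hw1 hv1)).continuousOn.integrableOn_compact (isCompact_closedBall 0 r)
  have i2 : IntegrableOn (fun x => v x * divF F w x + quadForm (F x) (grad v x) (grad w x))
      (closedBall (0 : Fin 3 → ℝ) r) :=
    ((hv.continuous.mul (continuous_divF hF hw)).add
      (continuous_quadForm hc hv1 hw1)).continuousOn.integrableOn_compact (isCompact_closedBall 0 r)
  have e3 := integral_sub i1 i2
  rw [e1, e2, sub_zero] at e3
  rw [← e3]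
  refine integral_congr_ae (Filter.Eventually.of_forall fun x => ?_)
  change _ = _ - _
  rw [quadForm_comm (hsymm x) (grad w x)]
  ring

lemma divF_eq (hF : ∀ i j, ContDiff ℝ 1 (fun x => F x i j)) (hv : ContDiff ℝ 2 v)
    (x : Fin 3 → ℝ) :
    divF F v x = ∑ i, ∑ j, F x i j * pd i (pd j v) x
      + ∑ j, (∑ i, pd i (fun y => F y i j) x) * pd j v x := by
  have h : ∀ i, pd i (fun y => ∑ j, F y i j * pd j v y) x
      = ∑ j, (F x i j * pd i (pd j v) x + pd j v x * pd i (fun y => F y i j) x) := fun i => by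
    rw [pd_sum i fun j _ => ((hF i j).mul (hv.pd j le_rfl)).differentiable one_ne_zero x]
    exact Finset.sum_congr rfl fun j _ => pd_mul i ((hF i j).differentiable one_ne_zero x)
      ((hv.pd j (m := 1) le_rfl).differentiable one_ne_zero x)
  simp only [divF, h, Finset.sum_add_distrib]
  congr 1
  rw [Finset.sum_comm]
  refine Finset.sum_congr rfl fun j _ => ?_
  rw [Finset.sum_mul]
  exact Finset.sum_congr rfl fun i _ => mul_comm _ _

lemma grad_mul (hv : ContDiff ℝ 1 v) (hw : ContDiff ℝ 1 w) (x : Fin 3 → ℝ) :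
    grad (fun y => v y * w y) x = fun i => v x * grad w x i + w x * grad v x i :=
  funext fun i => pd_mul i (hv.differentiable one_ne_zero x) (hw.differentiable one_ne_zero x)

lemma divF_comp (hF : ∀ i j, ContDiff ℝ 1 (fun x => F x i j)) (hv : ContDiff ℝ 2 v)
    {φ φ' φ'' : ℝ → ℝ} (hφ : ∀ x, HasDerivAt φ (φ' (v x)) (v x))
    (hφ' : ∀ x, HasDerivAt φ' (φ'' (v x)) (v x)) (hc : ContDiff ℝ 2 fun y => φ (v y))
    (x : Fin 3 → ℝ) :
    divF F (fun y => φ (v y)) x = φ' (v x) * divF F v x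
      + φ'' (v x) * quadForm (F x) (grad v x) (grad v x) := by
  have hv1 : ∀ y, DifferentiableAt ℝ v y := hv.differentiable two_ne_zero
  have e1 : ∀ j, pd j (fun y => φ (v y)) = fun y => φ' (v y) * pd j v y :=
    fun j => funext fun y => pd_comp j (hφ y) (hv1 y)
  have e2 : ∀ i j, pd i (fun y => φ' (v y) * pd j v y) x
      = φ' (v x) * pd i (pd j v) x + pd j v x * (φ'' (v x) * pd i v x) := fun i j => by
    have hd : DifferentiableAt ℝ (fun y => φ' (v y)) x :=
      ((hφ' x).comp_hasFDerivAt x (hv1 x).hasFDerivAt).differentiableAt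
    rw [pd_mul i hd ((hv.pd j (m := 1) le_rfl).differentiable one_ne_zero x), pd_comp i (hφ' x) (hv1 x)]
  rw [divF_eq hF hc, divF_eq hF hv]
  simp only [e1, e2, quadForm, grad, Fin.sum_univ_three]
  ring

end Divergence

end

/-- The matrix of second partial derivatives. -/
noncomputable def hs (u : (Fin 3 → ℝ) → ℝ) (x : Fin 3 → ℝ) : Matrix (Fin 3) (Fin 3) ℝ :=
  fun i j => pd i (pd j u) x

/-- The Laplacian. -/
noncomputable def lap (u : (Fin 3 → ℝ) → ℝ) (x : Fin 3 → ℝ) : ℝ := ∑ i, pd i (pd i u) x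

/-- The coefficients of the linearized operator. -/
noncomputable def coeff (u g : (Fin 3 → ℝ) → ℝ) (x : Fin 3 → ℝ) (i j : Fin 3) : ℝ :=
  linCoeff (lap u x) (g x) (hs u x) i j

/-- A solution `u` of `σ₂(D²u) = g Δu` on the ball of radius `3/4` with
quantitative bounds `P`; here `b` plays the role of `log Δu`. -/
structure Sol (P : ℝ) (u g b : (Fin 3 → ℝ) → ℝ) : Prop where
  one_le : 1 ≤ P
  u_smooth : ContDiff ℝ 4 u
  g_smooth : ContDiff ℝ 2 g
  b_smooth : ContDiff ℝ 2 b
  lap_pos : ∀ x ∈ ball (0 : Fin 3 → ℝ) (3 / 4), 0 < lap u x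
  eq : ∀ x ∈ ball (0 : Fin 3 → ℝ) (3 / 4),
    lap u x ^ 2 - ∑ i, ∑ j, hs u x i j ^ 2 = 2 * g x * lap u x
  g_lower : ∀ x ∈ ball (0 : Fin 3 → ℝ) (3 / 4), 1 ≤ P * g x
  g_le : ∀ x ∈ ball (0 : Fin 3 → ℝ) (3 / 4), g x ≤ P
  g_grad : ∀ x ∈ ball (0 : Fin 3 → ℝ) (3 / 4), ∀ i, |pd i g x| ≤ P
  g_lap : ∀ x ∈ ball (0 : Fin 3 → ℝ) (3 / 4), |lap g x| ≤ P * lap u x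
  u_grad : ∀ x ∈ ball (0 : Fin 3 → ℝ) (3 / 4), ∀ i, |pd i u x| ≤ P
  b_grad : ∀ x ∈ ball (0 : Fin 3 → ℝ) (3 / 4), ∀ i, pd i (lap u) x = lap u x * pd i b x
  one_le_b : ∀ x ∈ ball (0 : Fin 3 → ℝ) (3 / 4), 1 ≤ b x
  b_le : ∀ x ∈ ball (0 : Fin 3 → ℝ) (3 / 4), b x ≤ P * lap u x

lemma pd_comm' {f : (Fin 3 → ℝ) → ℝ} (hf : ContDiff ℝ 2 f) (i j : Fin 3) :
    pd i (pd j f) = pd j (pd i f) := funext fun _ => pd_comm i hf j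

section Smoothness

variable {u g : (Fin 3 → ℝ) → ℝ}

lemma contDiff_hs (hu : ContDiff ℝ 4 u) (i j : Fin 3) : ContDiff ℝ 2 fun x => hs u x i j :=
  (hu.pd j (m := 3) (by norm_num)).pd i (by norm_num)

lemma contDiff_lap (hu : ContDiff ℝ 4 u) : ContDiff ℝ 2 (lap u) :=
  ContDiff.sum fun i _ => contDiff_hs hu i i

lemma hs_symm (hu : ContDiff ℝ 4 u) (x : Fin 3 → ℝ) (i j : Fin 3) : hs u x i j = hs u x j i :=
  pd_comm i (hu.of_le (by norm_num)) j

lemma contDiff_coeff (hu : ContDiff ℝ 4 u) (hg : ContDiff ℝ 2 g) (i j : Fin 3) :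
    ContDiff ℝ 2 fun x => coeff u g x i j :=
  (((contDiff_lap hu).sub hg).mul contDiff_const).sub (contDiff_hs hu i j)

lemma coeff_symm (hu : ContDiff ℝ 4 u) (x : Fin 3 → ℝ) (i j : Fin 3) :
    coeff u g x i j = coeff u g x j i := by
  simp only [coeff, linCoeff, hs_symm hu x i j, eq_comm]

lemma pd_coeff (hu : ContDiff ℝ 4 u) (hg : ContDiff ℝ 2 g) (x : Fin 3 → ℝ) (i j k : Fin 3) :
    pd k (fun y => coeff u g y i j) x
      = (pd k (lap u) x - pd k g x) * (if i = j then 1 else 0) - pd k (pd i (pd j u)) x := by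
  have h1 := (contDiff_lap hu).differentiable two_ne_zero x
  have h2 := hg.differentiable two_ne_zero x
  have h3 := (contDiff_hs hu i j).differentiable two_ne_zero x
  have h4 : DifferentiableAt ℝ (fun y => lap u y - g y) x := h1.fun_sub h2
  have e : (fun y => coeff u g y i j)
      = fun y => (if i = j then (1 : ℝ) else 0) * (lap u y - g y) - hs u y i j :=
    funext fun y => by simp only [coeff, linCoeff]; ring
  rw [e, pd_sub k (h4.const_mul _) h3, pd_const_mul k h4, pd_sub k h1 h2]
  simp only [hs]
  ring

lemma third_swap₁₂ (hu : ContDiff ℝ 4 u) (x : Fin 3 → ℝ) (i j k : Fin 3) :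
    pd k (pd i (pd j u)) x = pd k (pd j (pd i u)) x := by
  rw [pd_comm' (hu.of_le (by norm_num)) i j]

lemma third_swap₂₃ (hu : ContDiff ℝ 4 u) (x : Fin 3 → ℝ) (i j k : Fin 3) :
    pd k (pd i (pd j u)) x = pd j (pd i (pd k u)) x := by
  have h : ∀ l, ContDiff ℝ 2 (pd l u) := fun l => hu.pd l (by norm_num)
  rw [pd_comm' (h j) k i, pd_comm' (hu.of_le (by norm_num)) k j, pd_comm' (h k) i j]

lemma pd_lap (hu : ContDiff ℝ 4 u) (x : Fin 3 → ℝ) (k : Fin 3) :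
    pd k (lap u) x = ∑ i, pd k (pd i (pd i u)) x :=
  pd_sum k fun i _ => (contDiff_hs hu i i).differentiable two_ne_zero x

lemma sum_fourth (hu : ContDiff ℝ 4 u) (x : Fin 3 → ℝ) (i j : Fin 3) :
    ∑ k, pd k (pd k (pd i (pd j u))) x = pd i (pd j (lap u)) x := by
  have hu2 : ContDiff ℝ 2 u := hu.of_le (by norm_num)
  have h : ∀ l, ContDiff ℝ 3 (pd l u) := fun l => hu.pd l (by norm_num)
  have h2 : ∀ l, ContDiff ℝ 2 (pd l u) := fun l => (h l).of_le (by norm_num)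
  have h' : ∀ l m, ContDiff ℝ 2 (pd l (pd m u)) := fun l m => (h m).pd l (by norm_num)
  have e : pd j (lap u) = fun y => ∑ k, pd j (pd k (pd k u)) y := funext fun y => pd_lap hu y j
  rw [e, pd_sum i fun k _ => ((h' k k).pd j (m := 1) (by norm_num)).differentiable one_ne_zero x]
  refine Finset.sum_congr rfl fun k _ => ?_
  rw [pd_comm' (h2 j) k i, pd_comm' (h' k j) k i, pd_comm' hu2 k j, pd_comm' (h2 k) k j]

lemma sum_pd_coeff (hu : ContDiff ℝ 4 u) (hg : ContDiff ℝ 2 g) (x : Fin 3 → ℝ) (j : Fin 3) :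
    ∑ i, pd i (fun y => coeff u g y i j) x = - pd j g x := by
  have e1 : ∀ i, pd i (pd i (pd j u)) x = pd j (pd i (pd i u)) x := fun i =>
    third_swap₂₃ hu x i j i
  simp only [pd_coeff hu hg, Finset.sum_sub_distrib, e1]
  rw [← pd_lap hu x j]
  simp

lemma divF_coeff_eq (hu : ContDiff ℝ 4 u) (hg : ContDiff ℝ 2 g) {v : (Fin 3 → ℝ) → ℝ}
    (hv : ContDiff ℝ 2 v) (x : Fin 3 → ℝ) :
    divF (coeff u g) v x = ∑ i, ∑ j, coeff u g x i j * pd i (pd j v) x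
      - ∑ j, pd j g x * pd j v x := by
  rw [divF_eq (fun i j => (contDiff_coeff hu hg i j).of_le one_le_two) hv]
  simp only [sum_pd_coeff hu hg, neg_mul, Finset.sum_neg_distrib]
  ring

end Smoothness

namespace Sol

variable {P : ℝ} {u g b : (Fin 3 → ℝ) → ℝ} {x : Fin 3 → ℝ}

lemma g_pos (h : Sol P u g b) (hx : x ∈ ball (0 : Fin 3 → ℝ) (3 / 4)) : 0 < g x := by
  have h1 := h.g_lower x hx
  have h2 := h.one_le
  by_contra h3
  nlinarith

lemma hessData (h : Sol P u g b) (hx : x ∈ ball (0 : Fin 3 → ℝ) (3 / 4)) :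
    HessData (lap u x) (g x) (hs u x) where
  symm := hs_symm h.u_smooth x
  S_pos := h.lap_pos x hx
  g_pos := h.g_pos hx
  trace_eq := rfl
  sq_eq := h.eq x hx

/-- The equation differentiated once. -/
lemma linearized (h : Sol P u g b) (hx : x ∈ ball (0 : Fin 3 → ℝ) (3 / 4)) (k : Fin 3) :
    ∑ i, ∑ j, coeff u g x i j * pd k (pd i (pd j u)) x = pd k g x * lap u x := by
  have hS := (contDiff_lap h.u_smooth).differentiable two_ne_zero x
  have hg := h.g_smooth.differentiable two_ne_zero x
  have hH : ∀ i j, DifferentiableAt ℝ (fun y => hs u y i j) x := fun i j =>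
    (contDiff_hs h.u_smooth i j).differentiable two_ne_zero x
  have e := pd_congr k isOpen_ball (f := fun y => lap u y * lap u y
      - ∑ i, ∑ j, hs u y i j * hs u y i j) (g := fun y => 2 * (g y * lap u y))
    (fun y hy => by have := h.eq y hy; simp only [← sq]; linarith) hx
  rw [pd_sub k (hS.fun_mul hS) (DifferentiableAt.fun_sum fun i _ => DifferentiableAt.fun_sum
      fun j _ => (hH i j).fun_mul (hH i j)), pd_mul k hS hS, pd_const_mul k (hg.fun_mul hS),
    pd_mul k hg hS, pd_sum k fun i _ => DifferentiableAt.fun_sum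
      fun j _ => (hH i j).fun_mul (hH i j)] at e
  have e1 : ∀ i, pd k (fun y => ∑ j, hs u y i j * hs u y i j) x
      = ∑ j, 2 * (hs u x i j * pd k (pd i (pd j u)) x) := fun i => by
    rw [pd_sum k fun j _ => (hH i j).fun_mul (hH i j)]
    exact Finset.sum_congr rfl fun j _ => by rw [pd_mul k (hH i j) (hH i j)]; simp only [hs]; ring
  simp only [e1, ← Finset.mul_sum] at e
  have e2 : ∑ i, ∑ j, coeff u g x i j * pd k (pd i (pd j u)) x
      = (lap u x - g x) * pd k (lap u) x
        - ∑ i, ∑ j, hs u x i j * pd k (pd i (pd j u)) x := by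
    rw [pd_lap h.u_smooth, Finset.mul_sum, ← Finset.sum_sub_distrib]
    refine Finset.sum_congr rfl fun i _ => ?_
    simp only [coeff, linCoeff, sub_mul _ (hs u x i _), Finset.sum_sub_distrib]
    simp
  rw [e2]
  linarith

/-- The equation differentiated twice. -/
lemma linearized_lap (h : Sol P u g b) (hx : x ∈ ball (0 : Fin 3 → ℝ) (3 / 4)) :
    ∑ i, ∑ j, coeff u g x i j * pd i (pd j (lap u)) x
      = (∑ i, ∑ j, ∑ k, pd k (pd i (pd j u)) x ^ 2 - ∑ k, pd k (lap u) x ^ 2)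
        + lap u x * lap g x + 2 * ∑ k, pd k g x * pd k (lap u) x := by
  have hF : ∀ i j, DifferentiableAt ℝ (fun y => coeff u g y i j) x := fun i j =>
    (contDiff_coeff h.u_smooth h.g_smooth i j).differentiable two_ne_zero x
  have hT : ∀ i j k, DifferentiableAt ℝ (pd k (pd i (pd j u))) x := fun i j k =>
    ((contDiff_hs h.u_smooth i j).pd k (m := 1) le_rfl).differentiable one_ne_zero x
  have hS := (contDiff_lap h.u_smooth).differentiable two_ne_zero x
  have hg : ∀ k, DifferentiableAt ℝ (pd k g) x := fun k =>
    (h.g_smooth.pd k (m := 1) le_rfl).differentiable one_ne_zero x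
  have key : ∀ k, ∑ i, ∑ j, coeff u g x i j * pd k (pd k (pd i (pd j u))) x
      + ((pd k (lap u) x - pd k g x) * pd k (lap u) x
        - ∑ i, ∑ j, pd k (pd i (pd j u)) x ^ 2)
      = pd k g x * pd k (lap u) x + lap u x * pd k (pd k g) x := fun k => by
    have e := pd_congr k isOpen_ball (f := fun y => ∑ i, ∑ j, coeff u g y i j
      * pd k (pd i (pd j u)) y) (g := fun y => pd k g y * lap u y)
      (fun y hy => h.linearized hy k) hx
    rw [pd_mul k (hg k) hS, pd_sum k fun i _ => DifferentiableAt.fun_sum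
      fun j _ => (hF i j).fun_mul (hT i j k)] at e
    have e1 : ∀ i, pd k (fun y => ∑ j, coeff u g y i j * pd k (pd i (pd j u)) y) x
        = ∑ j, coeff u g x i j * pd k (pd k (pd i (pd j u))) x
          + ((pd k (lap u) x - pd k g x) * pd k (pd i (pd i u)) x
            - ∑ j, pd k (pd i (pd j u)) x ^ 2) := fun i => by
      rw [pd_sum k fun j _ => (hF i j).fun_mul (hT i j k), ← sub_eq_zero]
      have e2 : ∀ j, pd k (fun y => coeff u g y i j * pd k (pd i (pd j u)) y) x
          = coeff u g x i j * pd k (pd k (pd i (pd j u))) x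
            + ((pd k (lap u) x - pd k g x) * (if i = j then pd k (pd i (pd j u)) x else 0)
              - pd k (pd i (pd j u)) x ^ 2) := fun j => by
        rw [pd_mul k (hF i j) (hT i j k), pd_coeff h.u_smooth h.g_smooth]
        split_ifs <;> ring
      simp only [e2, Finset.sum_add_distrib, Finset.sum_sub_distrib, ← Finset.mul_sum,
        Finset.sum_ite_eq, Finset.mem_univ, if_true]
      ring
    simp only [e1, Finset.sum_add_distrib, Finset.sum_sub_distrib, ← Finset.mul_sum] at e
    rw [← pd_lap h.u_smooth] at e
    linarith
  have hsum := Finset.sum_congr rfl fun k (_ : k ∈ Finset.univ) => key k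
  have e4 : ∑ i, ∑ j, coeff u g x i j * pd i (pd j (lap u)) x
      = ∑ k, ∑ i, ∑ j, coeff u g x i j * pd k (pd k (pd i (pd j u))) x := by
    rw [Finset.sum_comm]
    conv_rhs => rw [Finset.sum_comm]
    rw [Finset.sum_comm]
    refine Finset.sum_congr rfl fun i _ => ?_
    rw [Finset.sum_comm]
    refine Finset.sum_congr rfl fun j _ => ?_
    rw [← sum_fourth h.u_smooth, Finset.mul_sum]
  have e5 : ∑ i, ∑ j, ∑ k, pd k (pd i (pd j u)) x ^ 2
      = ∑ k, ∑ i, ∑ j, pd k (pd i (pd j u)) x ^ 2 := by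
    conv_rhs => rw [Finset.sum_comm]
    exact Finset.sum_congr rfl fun i _ => Finset.sum_comm
  rw [e4, e5]
  simp only [Finset.sum_add_distrib, Finset.sum_sub_distrib, sub_mul, ← Finset.mul_sum,
    ← sq] at hsum
  simp only [lap] at hsum ⊢
  linarith

/-- The Jacobi inequality for `b = log Δu`. -/
lemma jacobi (h : Sol P u g b) (hx : x ∈ ball (0 : Fin 3 → ℝ) (3 / 4)) :
    quadForm (coeff u g x) (grad b x) (grad b x) / 12 - 60019 * P ^ 4 * lap u x
      ≤ divF (coeff u g) b x := by
  have hS := (contDiff_lap h.u_smooth).differentiable two_ne_zero x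
  have hS0 := h.lap_pos x hx
  have hP := h.one_le
  have hd := h.hessData hx
  have hb : ∀ k, DifferentiableAt ℝ (pd k b) x := fun k =>
    (h.b_smooth.pd k (m := 1) le_rfl).differentiable one_ne_zero x
  set q := quadForm (coeff u g x) (grad b x) (grad b x) with hq
  set A := ∑ i, ∑ j, coeff u g x i j * pd i (pd j b) x with hA
  have e1 : ∀ i j, pd i (pd j (lap u)) x
      = lap u x * pd i (pd j b) x + lap u x * (pd i b x * pd j b x) := fun i j => by
    rw [pd_congr i isOpen_ball (fun y hy => h.b_grad y hy j) hx, pd_mul i hS (hb j),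
      h.b_grad x hx i]
    ring
  have e2 : ∑ i, ∑ j, coeff u g x i j * pd i (pd j (lap u)) x = lap u x * A + lap u x * q := by
    simp only [e1, hA, hq, quadForm, grad, Finset.mul_sum, ← Finset.sum_add_distrib]
    exact Finset.sum_congr rfl fun i _ => Finset.sum_congr rfl fun j _ => by ring
  have j := hd.jacobi hP (h.g_lower x hx) (h.g_grad x hx)
    (T := fun i j k => pd k (pd i (pd j u)) x) (third_swap₁₂ h.u_smooth x)
    (fun i j k => third_swap₂₃ h.u_smooth x i j k) (h.linearized hx)
    (w := fun k => pd k (lap u) x) (pd_lap h.u_smooth x)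
  have e3 : quadForm (linCoeff (lap u x) (g x) (hs u x)) (fun k => pd k (lap u) x)
      (fun k => pd k (lap u) x) = lap u x ^ 2 * q := by
    simp only [h.b_grad x hx, hq, quadForm, grad, Finset.mul_sum, coeff]
    exact Finset.sum_congr rfl fun i _ => Finset.sum_congr rfl fun j _ => by ring
  have e4 : ∑ k, pd k g x * pd k (lap u) x = lap u x * ∑ k, pd k g x * pd k b x := by
    simp only [h.b_grad x hx, Finset.mul_sum]
    exact Finset.sum_congr rfl fun i _ => by ring
  have e5 := h.linearized_lap hx
  rw [e2, e4] at e5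
  simp only [e3] at j
  have e6 : 7 / 6 * (lap u x ^ 2 * q) / lap u x = lap u x * (7 / 6 * q) := by
    field_simp
  rw [e6] at j
  have hgl := (abs_le.1 (h.g_lap x hx)).1
  have hA' : q / 6 - 60000 * P ^ 4 * lap u x - P * lap u x + 2 * ∑ k, pd k g x * pd k b x ≤ A := by
    refine le_of_mul_le_mul_left ?_ hS0
    have := mul_le_mul_of_nonneg_left hgl hS0.le
    linarith
  have hgb : ∀ k, |pd k g x * pd k b x| ≤ pd k b x ^ 2 / (24 * lap u x * P ^ 2)
      + 6 * P ^ 4 * lap u x := fun k => by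
    rw [abs_mul]
    have h1 := mul_le_mul_of_nonneg_right (h.g_grad x hx k) (abs_nonneg (pd k b x))
    refine h1.trans ?_
    have h2 : 0 < 24 * lap u x * P ^ 2 := by positivity
    rw [← sq_abs (pd k b x), ← sub_nonneg]
    have : |pd k b x| ^ 2 / (24 * lap u x * P ^ 2) + 6 * P ^ 4 * lap u x - P * |pd k b x|
        = (|pd k b x| - 12 * P ^ 3 * lap u x) ^ 2 / (24 * lap u x * P ^ 2) := by
      field_simp
      ring
    rw [this]
    positivity
  have hlow : ∑ k, pd k b x ^ 2 ≤ 2 * lap u x * P ^ 2 * q := by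
    have h1 : g x ^ 2 * ∑ i, grad b x i ^ 2 ≤ 2 * lap u x * q := hd.le_quadForm (grad b x)
    have h2 : 1 ≤ P ^ 2 * g x ^ 2 := by
      rw [← mul_pow]; exact one_le_pow₀ (h.g_lower x hx)
    have h3 : 0 ≤ ∑ k, pd k b x ^ 2 := Finset.sum_nonneg fun _ _ => sq_nonneg _
    have h4 := mul_le_mul_of_nonneg_left h1 (sq_nonneg P)
    have h5 := mul_le_mul_of_nonneg_right h2 h3
    calc _ ≤ P ^ 2 * g x ^ 2 * ∑ k, pd k b x ^ 2 := by linarith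
      _ = P ^ 2 * (g x ^ 2 * ∑ i, grad b x i ^ 2) := by simp only [grad]; ring
      _ ≤ _ := h4
      _ = _ := by ring
  have hgb' : -(q / 12 + 18 * P ^ 4 * lap u x) ≤ ∑ k, pd k g x * pd k b x := by
    have h1 : ∑ k, pd k b x ^ 2 / (24 * lap u x * P ^ 2) ≤ q / 12 := by
      rw [← Finset.sum_div, div_le_iff₀ (by positivity)]
      linarith
    have h2 : ∑ k : Fin 3, -(pd k b x ^ 2 / (24 * lap u x * P ^ 2) + 6 * P ^ 4 * lap u x)
        ≤ ∑ k, pd k g x * pd k b x :=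
      Finset.sum_le_sum fun k _ => (abs_le.1 (hgb k)).1
    rw [Finset.sum_neg_distrib, Finset.sum_add_distrib] at h2
    simp only [Finset.sum_const, Finset.card_univ, Fintype.card_fin, nsmul_eq_mul] at h2
    push_cast at h2
    linarith
  rw [divF_coeff_eq h.u_smooth h.g_smooth h.b_smooth, ← hA]
  have hP4 : P * lap u x ≤ P ^ 4 * lap u x :=
    mul_le_mul_of_nonneg_right (le_self_pow₀ hP (by norm_num)) hS0.le
  linarith

end Sol

/-- Half the square of a distance in the gradient graph of `u`, in coordinates sheared by `a`. -/
noncomputable def graphDist (f a : ℝ) (c : Fin 3 → ℝ) (u : (Fin 3 → ℝ) → ℝ) (x : Fin 3 → ℝ) : ℝ :=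
  f / 2 * ∑ k, x k ^ 2 + 1 / 2 * ∑ k, (pd k u x - c k - a * x k) ^ 2

/-- The volume density of the gradient graph. -/
noncomputable def vol (u g : (Fin 3 → ℝ) → ℝ) (x : Fin 3 → ℝ) : ℝ :=
  volDensity (lap u x) (g x) (hs u x)

section GraphDist

variable {u : (Fin 3 → ℝ) → ℝ} {f a : ℝ} {c : Fin 3 → ℝ}

lemma contDiff_shear (hu : ContDiff ℝ 4 u) (k : Fin 3) :
    ContDiff ℝ 3 fun x => pd k u x - c k - a * x k :=
  ((hu.pd k (by norm_num)).sub contDiff_const).sub (contDiff_const.mul (contDiff_apply ℝ ℝ k))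

lemma contDiff_graphDist (hu : ContDiff ℝ 4 u) : ContDiff ℝ 3 (graphDist f a c u) :=
  (contDiff_const.mul (ContDiff.sum fun k _ => (contDiff_apply ℝ ℝ k).pow 2)).add
    (contDiff_const.mul (ContDiff.sum fun k _ => (contDiff_shear hu k).pow 2))

lemma pd_sq {h : (Fin 3 → ℝ) → ℝ} {x : Fin 3 → ℝ} (hh : DifferentiableAt ℝ h x) (i : Fin 3) :
    pd i (fun y => h y ^ 2) x = 2 * (h x * pd i h x) := by
  simp only [sq]
  rw [pd_mul i hh hh]; ring

lemma pd_shear (hu : ContDiff ℝ 4 u) (x : Fin 3 → ℝ) (i k : Fin 3) :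
    pd i (fun y => pd k u y - c k - a * y k) x = hs u x i k - a * (if i = k then 1 else 0) := by
  have h1 : DifferentiableAt ℝ (pd k u) x :=
    (hu.pd k (m := 3) (by norm_num)).differentiable (by norm_num) x
  have h2 : DifferentiableAt ℝ (fun y : Fin 3 → ℝ => y k) x := differentiableAt_apply k x
  rw [pd_sub i (h1.fun_sub (differentiableAt_const _)) (h2.const_mul a),
    pd_sub i h1 (differentiableAt_const _), pd_const, pd_const_mul i h2, pd_coord]
  simp only [hs, sub_zero]

lemma pd_graphDist (hu : ContDiff ℝ 4 u) (x : Fin 3 → ℝ) (i : Fin 3) :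
    pd i (graphDist f a c u) x = f * x i + ∑ k, (pd k u x - c k - a * x k)
      * (hs u x i k - a * (if i = k then 1 else 0)) := by
  have h2 : ∀ k, DifferentiableAt ℝ (fun y : Fin 3 → ℝ => y k) x := fun k => differentiableAt_apply k x
  have h3 : ∀ k, DifferentiableAt ℝ (fun y => pd k u y - c k - a * y k) x := fun k =>
    (contDiff_shear hu k).differentiable (by norm_num) x
  have e1 : ∀ k, pd i (fun y : Fin 3 → ℝ => y k ^ 2) x = 2 * (x k * if i = k then 1 else 0) :=
    fun k => by rw [pd_sq (h2 k), pd_coord]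
  have e2 : ∀ k, pd i (fun y => (pd k u y - c k - a * y k) ^ 2) x
      = 2 * ((pd k u x - c k - a * x k) * (hs u x i k - a * (if i = k then 1 else 0))) := fun k => by
    rw [pd_sq (h3 k), pd_shear hu]
  unfold graphDist
  rw [pd_add i ((DifferentiableAt.fun_sum fun k _ => (h2 k).fun_pow 2).const_mul _)
    ((DifferentiableAt.fun_sum fun k _ => (h3 k).fun_pow 2).const_mul _),
    pd_const_mul i (DifferentiableAt.fun_sum fun k _ => (h2 k).fun_pow 2),
    pd_const_mul i (DifferentiableAt.fun_sum fun k _ => (h3 k).fun_pow 2),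
    pd_sum i fun k _ => (h2 k).fun_pow 2, pd_sum i fun k _ => (h3 k).fun_pow 2]
  simp only [e1, e2, ← Finset.mul_sum, mul_ite, mul_one, mul_zero, Finset.sum_ite_eq,
    Finset.mem_univ, if_true]
  ring

lemma pd_pd_graphDist (hu : ContDiff ℝ 4 u) (x : Fin 3 → ℝ) (i j : Fin 3) :
    pd i (pd j (graphDist f a c u)) x = f * (if i = j then 1 else 0)
      + ∑ k, ((pd k u x - c k - a * x k) * pd k (pd i (pd j u)) x
        + (hs u x j k - a * (if j = k then 1 else 0))
          * (hs u x i k - a * (if i = k then 1 else 0))) := by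
  have h2 : ∀ k, DifferentiableAt ℝ (fun y : Fin 3 → ℝ => y k) x := fun k => differentiableAt_apply k x
  have h3 : ∀ k, DifferentiableAt ℝ (fun y => pd k u y - c k - a * y k) x := fun k =>
    (contDiff_shear hu k).differentiable (by norm_num) x
  have h4 : ∀ k, DifferentiableAt ℝ (fun y => hs u y j k) x := fun k =>
    (contDiff_hs hu j k).differentiable two_ne_zero x
  have h5 : ∀ k, DifferentiableAt ℝ (fun y => hs u y j k - a * (if j = k then 1 else 0)) x :=
    fun k => (h4 k).fun_sub (differentiableAt_const _)
  have e : pd j (graphDist f a c u) = fun y => f * y j + ∑ k, (pd k u y - c k - a * y k)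
      * (hs u y j k - a * (if j = k then 1 else 0)) := funext fun y => pd_graphDist hu y j
  rw [e, pd_add i ((h2 j).const_mul f) (DifferentiableAt.fun_sum fun k _ => (h3 k).fun_mul (h5 k)),
    pd_const_mul i (h2 j), pd_coord, pd_sum i fun k _ => (h3 k).fun_mul (h5 k)]
  congr 1
  refine Finset.sum_congr rfl fun k _ => ?_
  have e3 : pd i (fun y => hs u y j k) x = pd k (pd i (pd j u)) x := by
    change pd i (pd j (pd k u)) x = _
    rw [third_swap₂₃ hu x j k i, third_swap₁₂ hu]
  rw [pd_mul i (h3 k) (h5 k), pd_sub i (h4 k) (differentiableAt_const _), pd_const, pd_shear hu, e3,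
    sub_zero]

end GraphDist

namespace Sol

variable {P : ℝ} {u g b : (Fin 3 → ℝ) → ℝ} {x : Fin 3 → ℝ}

lemma divF_graphDist (h : Sol P u g b) (hx : x ∈ ball (0 : Fin 3 → ℝ) (3 / 4)) (f a : ℝ)
    (c : Fin 3 → ℝ) :
    divF (coeff u g) (graphDist f a c u) x = traceFHH (lap u x) (g x) (hs u x)
      - 2 * a * g x * lap u x + (a ^ 2 + f) * (2 * lap u x - 3 * g x)
      + lap u x * ∑ k, pd k g x * (pd k u x - c k - a * x k)
      - ∑ j, pd j g x * pd j (graphDist f a c u) x := by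
  have hu := h.u_smooth
  rw [divF_coeff_eq hu h.g_smooth ((contDiff_graphDist hu).of_le (by norm_num))]
  congr 1
  have e1 : ∑ i, ∑ j, coeff u g x i j
      * ∑ k, (pd k u x - c k - a * x k) * pd k (pd i (pd j u)) x
      = lap u x * ∑ k, pd k g x * (pd k u x - c k - a * x k) := by
    have : ∀ k, (pd k u x - c k - a * x k) * ∑ i, ∑ j, coeff u g x i j * pd k (pd i (pd j u)) x
        = (pd k u x - c k - a * x k) * (pd k g x * lap u x) := fun k => by
      rw [h.linearized hx k]
    calc _ = ∑ k, (pd k u x - c k - a * x k)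
          * ∑ i, ∑ j, coeff u g x i j * pd k (pd i (pd j u)) x := by
          simp only [Finset.mul_sum]
          conv_rhs => rw [Finset.sum_comm]
          refine Finset.sum_congr rfl fun i _ => ?_
          rw [Finset.sum_comm]
          exact Finset.sum_congr rfl fun k _ => Finset.sum_congr rfl fun j _ => by ring
      _ = _ := by
          rw [Finset.sum_congr rfl fun k _ => this k, Finset.mul_sum]
          exact Finset.sum_congr rfl fun k _ => by ring
  have e2 : ∑ i, ∑ j, coeff u g x i j * (f * (if i = j then 1 else 0)
      + ∑ k, (hs u x j k - a * (if j = k then 1 else 0))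
          * (hs u x i k - a * (if i = k then 1 else 0)))
      = traceFHH (lap u x) (g x) (hs u x) - 2 * a * g x * lap u x
        + (a ^ 2 + f) * (2 * lap u x - 3 * g x) := by
    have s := hs_symm hu x
    have hE := h.eq x hx
    have hT : hs u x 0 0 + hs u x 1 1 + hs u x 2 2 = lap u x := by
      simp only [lap, Fin.sum_univ_three, hs]
    simp only [Fin.sum_univ_three] at hE ⊢
    simp only [traceFHH, quadForm, coeff, linCoeff, Fin.sum_univ_three]
    rw [s 1 0, s 2 0, s 2 1] at hE ⊢
    simp only [Fin.isValue, Fin.reduceEq, if_true, if_false, mul_one, mul_zero, sub_zero]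
    linear_combination (-2 * a * (lap u x - g x) - (a ^ 2 + f)) * hT - 2 * a * hE
  rw [← e1, ← e2, ← Finset.sum_add_distrib]
  refine Finset.sum_congr rfl fun i _ => ?_
  rw [← Finset.sum_add_distrib]
  refine Finset.sum_congr rfl fun j _ => ?_
  rw [pd_pd_graphDist hu, Finset.sum_add_distrib]
  ring

lemma abs_hs_le (h : Sol P u g b) (hx : x ∈ ball (0 : Fin 3 → ℝ) (3 / 4)) (i j : Fin 3) :
    |hs u x i j| ≤ lap u x := by
  have h1 := h.eq x hx
  have h2 := h.lap_pos x hx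
  have h3 := mul_pos (h.g_pos hx) h2
  have h4 : hs u x i j ^ 2 ≤ ∑ i, ∑ j, hs u x i j ^ 2 :=
    (Finset.single_le_sum (f := fun j => hs u x i j ^ 2) (fun _ _ => sq_nonneg _)
      (Finset.mem_univ j)).trans
    (Finset.single_le_sum (f := fun i => ∑ j, hs u x i j ^ 2)
      (fun _ _ => Finset.sum_nonneg fun _ _ => sq_nonneg _) (Finset.mem_univ i))
  exact abs_le_of_sq_le_sq (by linarith) h2.le

lemma one_le_lap (h : Sol P u g b) (hx : x ∈ ball (0 : Fin 3 → ℝ) (3 / 4)) : 1 ≤ P * lap u x := by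
  have h1 := (h.hessData hx).three_mul_le
  have h2 := h.g_lower x hx
  have := h.one_le
  nlinarith [h.g_pos hx]

lemma lap_le_vol (h : Sol P u g b) (hx : x ∈ ball (0 : Fin 3 → ℝ) (3 / 4)) :
    lap u x ≤ 4 * P ^ 2 * vol u g x := by
  have h1 := mul_le_mul_of_nonneg_left (h.hessData hx).volDensity_ge (sq_nonneg P)
  have h2 : 1 ≤ P ^ 2 * g x ^ 2 := by rw [← mul_pow]; exact one_le_pow₀ (h.g_lower x hx)
  have h3 := mul_le_mul_of_nonneg_right h2 (h.lap_pos x hx).le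
  unfold vol
  linarith

lemma vol_pos (h : Sol P u g b) (hx : x ∈ ball (0 : Fin 3 → ℝ) (3 / 4)) : 0 < vol u g x := by
  have h1 := h.lap_le_vol hx
  have h2 := h.lap_pos x hx
  have := h.one_le
  by_contra h3
  nlinarith [mul_nonneg (by positivity : 0 ≤ 4 * P ^ 2) (neg_nonneg.2 (not_lt.1 h3))]

lemma traceFHH_le (h : Sol P u g b) (hx : x ∈ ball (0 : Fin 3 → ℝ) (3 / 4)) :
    traceFHH (lap u x) (g x) (hs u x) ≤ 3 * vol u g x := by
  have := mul_le_mul_of_nonneg_left (h.hessData hx).three_mul_le (sq_nonneg (g x))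
  unfold vol volDensity
  linarith

lemma quadForm_nonneg (h : Sol P u g b) (hx : x ∈ ball (0 : Fin 3 → ℝ) (3 / 4))
    (ξ : Fin 3 → ℝ) : 0 ≤ quadForm (coeff u g x) ξ ξ := (h.hessData hx).quadForm_nonneg ξ

lemma abs_quadForm_le (h : Sol P u g b) (hx : x ∈ ball (0 : Fin 3 → ℝ) (3 / 4))
    (ξ η : Fin 3 → ℝ) : 2 * |quadForm (coeff u g x) ξ η|
      ≤ quadForm (coeff u g x) ξ ξ + quadForm (coeff u g x) η η := by
  have e1 := h.quadForm_nonneg hx (fun i => ξ i + η i)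
  have e2 := h.quadForm_nonneg hx (fun i => ξ i - η i)
  have hc := quadForm_comm (coeff_symm (g := g) h.u_smooth x) ξ η
  have e3 : quadForm (coeff u g x) (fun i => ξ i + η i) (fun i => ξ i + η i)
      = quadForm (coeff u g x) ξ ξ + quadForm (coeff u g x) ξ η + quadForm (coeff u g x) η ξ
        + quadForm (coeff u g x) η η := by
    simp only [quadForm, ← Finset.sum_add_distrib]
    exact Finset.sum_congr rfl fun i _ => Finset.sum_congr rfl fun j _ => by ring
  have e4 : quadForm (coeff u g x) (fun i => ξ i - η i) (fun i => ξ i - η i)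
      = quadForm (coeff u g x) ξ ξ - quadForm (coeff u g x) ξ η - quadForm (coeff u g x) η ξ
        + quadForm (coeff u g x) η η := by
    simp only [quadForm, ← Finset.sum_add_distrib, ← Finset.sum_sub_distrib]
    exact Finset.sum_congr rfl fun i _ => Finset.sum_congr rfl fun j _ => by ring
  rw [e3] at e1
  rw [e4] at e2
  rcases abs_cases (quadForm (coeff u g x) ξ η) with h | h <;> linarith

lemma abs_sum_three_le {v : Fin 3 → ℝ} {c : ℝ} (hv : ∀ i, |v i| ≤ c) : |∑ i, v i| ≤ 3 * c := by
  refine (Finset.abs_sum_le_sum_abs _ _).trans ((Finset.sum_le_sum fun i _ => hv i).trans ?_)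
  simp

/-- `|Du|² / 2` is a subsolution up to lower order terms, strictly with respect to volume. -/
lemma three_vol_le (h : Sol P u g b) (hx : x ∈ ball (0 : Fin 3 → ℝ) (3 / 4)) :
    3 * vol u g x ≤ divF (coeff u g) (graphDist 0 0 0 u) x + 13 * P ^ 2 * lap u x := by
  have hP := h.one_le
  have hS := h.lap_pos x hx
  rw [h.divF_graphDist hx]
  have e0 : ∀ k, pd k u x - (0 : Fin 3 → ℝ) k - 0 * x k = pd k u x := fun k => by simp
  have e1 : |∑ k, pd k g x * pd k u x| ≤ 3 * (P * P) := abs_sum_three_le fun k => by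
    rw [abs_mul]
    exact mul_le_mul (h.g_grad x hx k) (h.u_grad x hx k) (abs_nonneg _) (by linarith)
  have e2 : |∑ j, pd j g x * pd j (graphDist 0 0 0 u) x| ≤ 3 * (P * (3 * (P * lap u x))) :=
    abs_sum_three_le fun j => by
      rw [abs_mul]
      refine mul_le_mul (h.g_grad x hx j) ?_ (abs_nonneg _) (by linarith)
      rw [pd_graphDist h.u_smooth, zero_mul, zero_add]
      refine abs_sum_three_le fun k => ?_
      rw [e0, zero_mul, sub_zero, abs_mul]
      exact mul_le_mul (h.u_grad x hx k) (h.abs_hs_le hx j k) (abs_nonneg _) (by linarith)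
  simp only [e0]
  have e3 := mul_le_mul_of_nonneg_left (abs_le.1 e1).1 hS.le
  have e4 := (abs_le.1 e2).2
  have e5 : g x ^ 2 ≤ P ^ 2 := pow_le_pow_left₀ (h.g_pos hx).le (h.g_le x hx) 2
  have e6 := mul_le_mul_of_nonneg_right e5 hS.le
  have e7 : 0 ≤ g x ^ 3 := pow_nonneg (h.g_pos hx).le 3
  unfold vol volDensity
  linarith

lemma quadForm_energy_le (h : Sol P u g b) (hx : x ∈ ball (0 : Fin 3 → ℝ) (3 / 4)) :
    quadForm (coeff u g x) (grad (graphDist 0 0 0 u) x) (grad (graphDist 0 0 0 u) x)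
      ≤ 9 * P ^ 2 * vol u g x := by
  have e : grad (graphDist 0 0 0 u) x = fun i => ∑ k, hs u x i k * pd k u x := funext fun i => by
    rw [grad, pd_graphDist h.u_smooth]
    simp [mul_comm]
  rw [e]
  refine ((h.hessData hx).quadForm_mulVec_le _).trans ?_
  have e1 : ∑ i, pd i u x ^ 2 ≤ ∑ _i : Fin 3, P ^ 2 := Finset.sum_le_sum fun i _ => by
    rw [← sq_abs]; exact pow_le_pow_left₀ (abs_nonneg _) (h.u_grad x hx i) 2
  simp only [Finset.sum_const, Finset.card_univ, Fintype.card_fin, nsmul_eq_mul] at e1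
  push_cast at e1
  have h1 := mul_le_mul_of_nonneg_right (h.traceFHH_le hx)
    (Finset.sum_nonneg fun i (_ : i ∈ Finset.univ) => sq_nonneg (pd i u x))
  have h2 := mul_le_mul_of_nonneg_left e1 (h.vol_pos hx).le
  linarith

lemma zero_mem : (0 : Fin 3 → ℝ) ∈ ball (0 : Fin 3 → ℝ) (3 / 4) := mem_ball_self (by norm_num)

lemma abs_g_sub_le (h : Sol P u g b) (hx : x ∈ ball (0 : Fin 3 → ℝ) (3 / 4)) :
    |g x - g 0| ≤ 3 * P * ‖x‖ := by
  have hb : ∀ y ∈ ball (0 : Fin 3 → ℝ) (3 / 4), ‖fderiv ℝ g y‖ ≤ 3 * P := fun y hy => by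
    refine ContinuousLinearMap.opNorm_le_bound _ (by linarith [h.one_le]) fun v => ?_
    have e : v = ∑ i, v i • (Pi.single i 1 : Fin 3 → ℝ) := by
      ext j; simp [Finset.sum_apply, Pi.single_apply]
    have e2 : fderiv ℝ g y v = ∑ i, v i * pd i g y := by
      conv_lhs => rw [e]
      rw [map_sum]
      exact Finset.sum_congr rfl fun i _ => by rw [map_smul, smul_eq_mul, pd]
    rw [e2, Real.norm_eq_abs, mul_assoc]
    refine abs_sum_three_le fun i => ?_
    rw [abs_mul, mul_comm]
    exact mul_le_mul (h.g_grad y hy i) (norm_le_pi_norm v i) (abs_nonneg _) (by linarith [h.one_le])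
  have := (convex_ball (0 : Fin 3 → ℝ) (3 / 4)).norm_image_sub_le_of_norm_fderiv_le
    (fun y _ => h.g_smooth.differentiable two_ne_zero y) hb zero_mem hx
  simpa using this

/-- The graph distance to the origin adapted to the equation. -/
noncomputable def _root_.originDist (u g : (Fin 3 → ℝ) → ℝ) : (Fin 3 → ℝ) → ℝ :=
  graphDist (3 * g 0 ^ 2 / 4) (g 0 / 2) (grad u 0) u

lemma originDist_bounds (h : Sol P u g b) (x : Fin 3 → ℝ) {ρ : ℝ} (hρ : 0 ≤ ρ)
    (ht : 2 * originDist u g x ≤ ρ ^ 2) :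
    (∀ k, |pd k u x - grad u 0 k - g 0 / 2 * x k| ≤ ρ) ∧ ∀ k, |x k| ≤ 2 * P * ρ := by
  have h0 := h.g_lower 0 zero_mem
  have hP := h.one_le
  unfold originDist graphDist at ht
  have hx : ∀ k, x k ^ 2 ≤ ∑ k, x k ^ 2 := fun k =>
    Finset.single_le_sum (f := fun k => x k ^ 2) (fun _ _ => sq_nonneg _) (Finset.mem_univ k)
  have hY : ∀ k, (pd k u x - grad u 0 k - g 0 / 2 * x k) ^ 2
      ≤ ∑ k, (pd k u x - grad u 0 k - g 0 / 2 * x k) ^ 2 := fun k =>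
    Finset.single_le_sum (f := fun k => (pd k u x - grad u 0 k - g 0 / 2 * x k) ^ 2)
      (fun _ _ => sq_nonneg _) (Finset.mem_univ k)
  set X := ∑ k, x k ^ 2
  set Y := ∑ k, (pd k u x - grad u 0 k - g 0 / 2 * x k) ^ 2
  have hX0 : 0 ≤ X := Finset.sum_nonneg fun _ _ => sq_nonneg _
  have hY0 : 0 ≤ Y := Finset.sum_nonneg fun _ _ => sq_nonneg _
  have h1 : 1 ≤ P ^ 2 * g 0 ^ 2 := by rw [← mul_pow]; exact one_le_pow₀ h0
  refine ⟨fun k => abs_le_of_sq_le_sq ?_ hρ, fun k => abs_le_of_sq_le_sq ?_ (by positivity)⟩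
  · have : 0 ≤ g 0 ^ 2 * X := mul_nonneg (sq_nonneg _) hX0
    linarith [hY k]
  · have h2 := mul_le_mul_of_nonneg_right h1 hX0
    have h3 := mul_le_mul_of_nonneg_left ht (sq_nonneg P)
    have h4 : 0 ≤ P ^ 2 * Y := mul_nonneg (sq_nonneg _) hY0
    have h5 : 0 ≤ (P * ρ) ^ 2 := sq_nonneg _
    have h6 := hx k
    linarith

lemma norm_le_of_originDist (h : Sol P u g b) (x : Fin 3 → ℝ) {ρ : ℝ} (hρ : 0 ≤ ρ)
    (ht : 2 * originDist u g x ≤ ρ ^ 2) : ‖x‖ ≤ 2 * P * ρ :=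
  (pi_norm_le_iff_of_nonneg (by have := h.one_le; positivity)).2 fun k => by
    simpa using (h.originDist_bounds x hρ ht).2 k

lemma abs_g_sub_le_of_originDist (h : Sol P u g b) (hx : x ∈ ball (0 : Fin 3 → ℝ) (3 / 4)) {ρ : ℝ}
    (hρ : 0 ≤ ρ) (ht : 2 * originDist u g x ≤ ρ ^ 2) : |g x - g 0| ≤ 6 * P ^ 2 * ρ := by
  have h1 := h.abs_g_sub_le hx
  have h2 := mul_le_mul_of_nonneg_left (h.norm_le_of_originDist x hρ ht)
    (by linarith [h.one_le] : 0 ≤ 3 * P)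
  linarith

/-- The squared distance satisfies `div (F ∇t) ≈ 3 V`. -/
lemma abs_divF_originDist_sub_le (h : Sol P u g b) (hx : x ∈ ball (0 : Fin 3 → ℝ) (3 / 4)) {ρ : ℝ}
    (hρ : 0 ≤ ρ) (ht : 2 * originDist u g x ≤ ρ ^ 2) :
    |divF (coeff u g) (originDist u g) x - 3 * vol u g x| ≤ 2000 * P ^ 10 * ρ * vol u g x := by
  have hP := h.one_le
  have hP0 : 0 ≤ P := by linarith
  have hS := h.lap_pos x hx
  obtain ⟨hY, hX⟩ := h.originDist_bounds x hρ ht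
  have hg := h.abs_g_sub_le_of_originDist hx hρ ht
  have g1 := h.g_pos hx
  have g2 := h.g_le x hx
  have g3 := h.g_pos zero_mem
  have g4 := h.g_le 0 zero_mem
  have hSP := h.one_le_lap hx
  have h3g := (h.hessData hx).three_mul_le
  set Y : Fin 3 → ℝ := fun k => pd k u x - grad u 0 k - g 0 / 2 * x k with hYdef
  have e1 : |∑ k, pd k g x * Y k| ≤ 3 * (P * ρ) := abs_sum_three_le fun k => by
    rw [abs_mul]
    exact mul_le_mul (h.g_grad x hx k) (hY k) (abs_nonneg _) hP0
  have hρS : ρ ≤ P * lap u x * ρ := le_mul_of_one_le_left hρ hSP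
  have hgrad : ∀ j, |pd j (originDist u g) x| ≤ 6 * P ^ 4 * lap u x * ρ := fun j => by
    unfold originDist
    rw [pd_graphDist h.u_smooth]
    have s1 : |3 * g 0 ^ 2 / 4 * x j| ≤ 3 / 2 * P ^ 3 * ρ := by
      have : g 0 ^ 2 ≤ P ^ 2 := pow_le_pow_left₀ g3.le g4 2
      rw [abs_mul, abs_of_nonneg (by positivity)]
      calc 3 * g 0 ^ 2 / 4 * |x j| ≤ 3 * P ^ 2 / 4 * (2 * P * ρ) :=
            mul_le_mul (by linarith) (hX j) (abs_nonneg _) (by positivity)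
        _ = _ := by ring
    have s2 : |∑ k, Y k * (hs u x j k - g 0 / 2 * (if j = k then 1 else 0))|
        ≤ 3 * (ρ * (lap u x + P / 2)) := abs_sum_three_le fun k => by
      rw [abs_mul]
      refine mul_le_mul (hY k) ((abs_sub _ _).trans (add_le_add (h.abs_hs_le hx j k) ?_))
        (abs_nonneg _) hρ
      split_ifs
      · rw [mul_one, abs_of_pos (by linarith)]; linarith
      · simp; linarith
    refine (abs_add_le _ _).trans ((add_le_add s1 s2).trans ?_)
    have t1 : P ^ 3 * ρ ≤ P ^ 3 * (P * lap u x * ρ) := mul_le_mul_of_nonneg_left hρS (by positivity)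
    have t2 : P * ρ ≤ P * (P * lap u x * ρ) := mul_le_mul_of_nonneg_left hρS hP0
    have t3 : lap u x * ρ ≤ P ^ 4 * (lap u x * ρ) :=
      le_mul_of_one_le_left (by positivity) (one_le_pow₀ hP)
    have t4 : P ^ 2 * (lap u x * ρ) ≤ P ^ 4 * (lap u x * ρ) :=
      mul_le_mul_of_nonneg_right (pow_le_pow_right₀ hP (by norm_num)) (by positivity)
    have t5 : 0 ≤ P ^ 4 * (lap u x * ρ) := by positivity
    linarith
  have e2 : |∑ j, pd j g x * pd j (originDist u g) x| ≤ 3 * (P * (6 * P ^ 4 * lap u x * ρ)) :=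
    abs_sum_three_le fun j => by
      rw [abs_mul]
      exact mul_le_mul (h.g_grad x hx j) (hgrad j) (abs_nonneg _) hP0
  have key : divF (coeff u g) (originDist u g) x - 3 * vol u g x
      = (g x - g 0) * (3 * g x * (g x + g 0) - lap u x * (2 * g 0 + g x))
        + lap u x * ∑ k, pd k g x * Y k - ∑ j, pd j g x * pd j (originDist u g) x := by
    rw [originDist, h.divF_graphDist hx]
    unfold vol volDensity
    ring
  have e3 : |3 * g x * (g x + g 0) - lap u x * (2 * g 0 + g x)| ≤ 3 * P * lap u x := by
    have s1 : 3 * g x * (g x + g 0) ≤ lap u x * (g x + g 0) :=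
      mul_le_mul_of_nonneg_right h3g (by linarith)
    have s2 : 0 ≤ 3 * g x * (g x + g 0) := by positivity
    have s3 : lap u x * (2 * g 0 + g x) ≤ lap u x * (3 * P) :=
      mul_le_mul_of_nonneg_left (by linarith) hS.le
    have s4 : 0 ≤ lap u x * g 0 := by positivity
    have s5 : 0 ≤ lap u x * P := by positivity
    rw [abs_le]; constructor <;> linarith
  rw [key]
  have f1 : |(g x - g 0) * (3 * g x * (g x + g 0) - lap u x * (2 * g 0 + g x))|
      ≤ 6 * P ^ 2 * ρ * (3 * P * lap u x) := by
    rw [abs_mul]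
    exact mul_le_mul hg e3 (abs_nonneg _) (by positivity)
  have f2 : |lap u x * ∑ k, pd k g x * Y k| ≤ lap u x * (3 * (P * ρ)) := by
    rw [abs_mul, abs_of_pos hS]
    exact mul_le_mul_of_nonneg_left e1 hS.le
  have f3 := (abs_sub _ _).trans (add_le_add ((abs_add_le _ _).trans (add_le_add f1 f2)) e2)
  refine f3.trans ?_
  have hw : 0 ≤ lap u x * ρ := by positivity
  have p1 : P ^ 3 * (lap u x * ρ) ≤ P ^ 8 * (lap u x * ρ) :=
    mul_le_mul_of_nonneg_right (pow_le_pow_right₀ hP (by norm_num)) hw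
  have p2 : P * (lap u x * ρ) ≤ P ^ 8 * (lap u x * ρ) :=
    mul_le_mul_of_nonneg_right (le_self_pow₀ hP (by norm_num)) hw
  have p3 : P ^ 5 * (lap u x * ρ) ≤ P ^ 8 * (lap u x * ρ) :=
    mul_le_mul_of_nonneg_right (pow_le_pow_right₀ hP (by norm_num)) hw
  have p4 := mul_le_mul_of_nonneg_left (h.lap_le_vol hx) (by positivity : 0 ≤ P ^ 8 * ρ)
  have p5 : 0 ≤ P ^ 10 * ρ * vol u g x :=
    mul_nonneg (by positivity) (h.vol_pos hx).le
  linarith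

lemma quadForm_originDist_le (h : Sol P u g b) (hx : x ∈ ball (0 : Fin 3 → ℝ) (3 / 4)) {ρ : ℝ}
    (hρ : 0 ≤ ρ) (hρ1 : ρ ≤ 1) (ht : 2 * originDist u g x ≤ ρ ^ 2) :
    quadForm (coeff u g x) (grad (originDist u g) x) (grad (originDist u g) x)
      ≤ 2 * originDist u g x * vol u g x * (1 + 2000 * P ^ 10 * ρ) := by
  have hP := h.one_le
  have hP0 : 0 ≤ P := by linarith
  have hg := h.abs_g_sub_le_of_originDist hx hρ ht
  have g1 := h.g_pos hx
  have g2 := h.g_le x hx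
  have g3 := h.g_pos zero_mem
  have g4 := h.g_le 0 zero_mem
  have e : grad (originDist u g) x = fun i => 3 * g 0 ^ 2 / 4 * x i
      + (∑ k, hs u x i k * (pd k u x - grad u 0 k - g 0 / 2 * x k)
        - g 0 / 2 * (pd i u x - grad u 0 i - g 0 / 2 * x i)) := funext fun i => by
    rw [grad, originDist, pd_graphDist h.u_smooth]
    simp only [mul_sub _ (hs u x i _), Finset.sum_sub_distrib]
    simp only [mul_ite, mul_one, mul_zero, Finset.sum_ite_eq, Finset.mem_univ, if_true]
    rw [mul_comm (g 0 / 2) (pd i u x - _ - _)]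
    congr 2
    exact Finset.sum_congr rfl fun k _ => mul_comm _ _
  have hB1 : |g x - g 0| ≤ 12 * P ^ 3 * ρ := hg.trans <| by
    have : P ^ 2 * ρ ≤ P ^ 3 * ρ :=
      mul_le_mul_of_nonneg_right (pow_le_pow_right₀ hP (by norm_num)) hρ
    have : 0 ≤ P ^ 3 * ρ := by positivity
    linarith
  have hB2 : |g x ^ 2 - g 0 ^ 2| ≤ 12 * P ^ 3 * ρ := by
    rw [show g x ^ 2 - g 0 ^ 2 = (g x - g 0) * (g x + g 0) by ring, abs_mul,
      abs_of_pos (by linarith : 0 < g x + g 0)]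
    calc _ ≤ 6 * P ^ 2 * ρ * (2 * P) := mul_le_mul hg (by linarith) (by linarith) (by positivity)
      _ = _ := by ring
  have := (h.hessData hx).quadForm_grad_dist_le hP (h.g_lower x hx) (h.g_lower 0 zero_mem)
    (by positivity) hB1 hB2 x (fun k => pd k u x - grad u 0 k - g 0 / 2 * x k)
  rw [e]
  refine this.trans ?_
  have e2 : 3 * g 0 ^ 2 / 4 * ∑ i, x i ^ 2 + ∑ k, (pd k u x - grad u 0 k - g 0 / 2 * x k) ^ 2
      = 2 * originDist u g x := by
    unfold originDist graphDist
    ring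
  rw [e2, show volDensity (lap u x) (g x) (hs u x) = vol u g x from rfl,
    mul_comm (vol u g x)]
  have ht0 : 0 ≤ 2 * originDist u g x := by
    rw [← e2]; positivity
  refine mul_le_mul_of_nonneg_left ?_ (mul_nonneg ht0 (h.vol_pos hx).le)
  have r2 : ρ ^ 2 ≤ ρ := by nlinarith
  have q : ∀ n ≤ 10, P ^ n * ρ ≤ P ^ 10 * ρ := fun n hn =>
    mul_le_mul_of_nonneg_right (pow_le_pow_right₀ hP hn) hρ
  have q' : ∀ n ≤ 10, P ^ n * ρ ^ 2 ≤ P ^ 10 * ρ := fun n hn =>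
    mul_le_mul (pow_le_pow_right₀ hP hn) r2 (by positivity) (by positivity)
  have q0 : 0 ≤ P ^ 10 * ρ := by positivity
  linarith [q 3 (by norm_num), q 5 (by norm_num), q 7 (by norm_num), q' 8 (by norm_num),
    q' 10 (by norm_num)]

end Sol

section

open MeasureTheory

/-- A cutoff function between concentric closed balls with derivatives bounded by `A`. -/
structure IsCutoff (r R A : ℝ) (φ : (Fin 3 → ℝ) → ℝ) : Prop where
  smooth : ContDiff ℝ 2 φ
  nonneg : ∀ x, 0 ≤ φ x
  le_one : ∀ x, φ x ≤ 1
  eq_one : ∀ x ∈ closedBall (0 : Fin 3 → ℝ) r, φ x = 1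
  eq_zero : ∀ x ∉ closedBall (0 : Fin 3 → ℝ) R, φ x = 0
  one_le : 1 ≤ A
  abs_pd_le : ∀ i x, |pd i φ x| ≤ A
  abs_pd_pd_le : ∀ i j x, |pd i (pd j φ) x| ≤ A

lemma exists_isCutoff {r R : ℝ} (hr : 0 < r) (hR : r < R) : ∃ A φ, IsCutoff r R A φ := by
  let f : ContDiffBump (0 : Fin 3 → ℝ) := ⟨r, R, hr, hR⟩
  have hs : ContDiff ℝ 2 f := f.contDiff
  have h0 : ∀ x ∉ closedBall (0 : Fin 3 → ℝ) R, f x = 0 := fun x hx =>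
    f.zero_of_le_dist (not_le.1 hx).le
  have h1 := pd_eq_zero_of_support h0
  have h2 := fun j => pd_eq_zero_of_support (h1 j)
  have hK := isCompact_closedBall (0 : Fin 3 → ℝ) R
  have b1 : ∀ i, ∃ C, ∀ x, ‖pd i f x‖ ≤ C := fun i =>
    (continuous_pd i (hs.of_le one_le_two)).bounded_above_of_compact_support
      (HasCompactSupport.intro hK (h1 i))
  have b2 : ∀ i j, ∃ C, ∀ x, ‖pd i (pd j f) x‖ ≤ C := fun i j =>
    (continuous_pd i (hs.pd j le_rfl)).bounded_above_of_compact_support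
      (HasCompactSupport.intro hK (h2 j i))
  choose B1 hB1 using b1
  choose B2 hB2 using b2
  have hB1' : ∀ i, 0 ≤ B1 i := fun i => (norm_nonneg _).trans (hB1 i 0)
  have hB2' : ∀ i j, 0 ≤ B2 i j := fun i j => (norm_nonneg _).trans (hB2 i j 0)
  have t1 : ∀ i, B1 i ≤ ∑ i, B1 i := fun i =>
    Finset.single_le_sum (fun i _ => hB1' i) (Finset.mem_univ i)
  have t2 : ∀ i j, B2 i j ≤ ∑ i, ∑ j, B2 i j := fun i j =>
    (Finset.single_le_sum (f := fun j => B2 i j) (fun j _ => hB2' i j) (Finset.mem_univ j)).trans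
      (Finset.single_le_sum (f := fun i => ∑ j, B2 i j)
        (fun i _ => Finset.sum_nonneg fun j _ => hB2' i j) (Finset.mem_univ i))
  have p1 : 0 ≤ ∑ i, B1 i := Finset.sum_nonneg fun i _ => hB1' i
  have p2 : 0 ≤ ∑ i, ∑ j, B2 i j :=
    Finset.sum_nonneg fun i _ => Finset.sum_nonneg fun j _ => hB2' i j
  refine ⟨1 + ∑ i, B1 i + ∑ i, ∑ j, B2 i j, f, hs, fun _ => f.nonneg, fun _ => f.le_one,
    fun x hx => f.one_of_mem_closedBall hx, h0, by linarith, fun i x => ?_, fun i j x => ?_⟩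
  · have := hB1 i x
    rw [Real.norm_eq_abs] at this
    linarith [t1 i]
  · have := hB2 i j x
    rw [Real.norm_eq_abs] at this
    linarith [t2 i j]

lemma Continuous.integrableOn_ball' {f : (Fin 3 → ℝ) → ℝ} (hf : Continuous f) (r : ℝ) :
    IntegrableOn f (closedBall 0 r) :=
  hf.continuousOn.integrableOn_compact (isCompact_closedBall 0 r)

lemma setIntegral_le_of_le_add {r R C : ℝ} {f p N h : (Fin 3 → ℝ) → ℝ} (hrR : r ≤ R)
    (hf : Continuous f) (hp : Continuous p) (hN : Continuous N) (hh : Continuous h)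
    (h0 : ∀ x ∈ closedBall (0 : Fin 3 → ℝ) R, 0 ≤ p x)
    (h1 : ∀ x ∈ closedBall (0 : Fin 3 → ℝ) r, f x ≤ p x)
    (hle : ∀ x ∈ closedBall (0 : Fin 3 → ℝ) R, p x ≤ N x + h x)
    (hN0 : ∫ x in closedBall (0 : Fin 3 → ℝ) R, N x = 0)
    (hC : ∫ x in closedBall (0 : Fin 3 → ℝ) R, h x ≤ C) :
    ∫ x in closedBall (0 : Fin 3 → ℝ) r, f x ≤ C := by
  have hm : ∀ s : ℝ, MeasurableSet (closedBall (0 : Fin 3 → ℝ) s) := fun s =>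
    measurableSet_closedBall
  calc ∫ x in closedBall (0 : Fin 3 → ℝ) r, f x
      ≤ ∫ x in closedBall (0 : Fin 3 → ℝ) r, p x :=
        setIntegral_mono_on (hf.integrableOn_ball' r) (hp.integrableOn_ball' r) (hm r) h1
    _ ≤ ∫ x in closedBall (0 : Fin 3 → ℝ) R, p x :=
        setIntegral_mono_set (hp.integrableOn_ball' R)
          ((ae_restrict_iff' (hm R)).2 (.of_forall h0)) (closedBall_subset_closedBall hrR).eventuallyLE
    _ ≤ ∫ x in closedBall (0 : Fin 3 → ℝ) R, (N x + h x) :=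
        setIntegral_mono_on (hp.integrableOn_ball' R) ((hN.fun_add hh).integrableOn_ball' R) (hm R) hle
    _ ≤ C := by
        rw [integral_add (hN.integrableOn_ball' R) (hh.integrableOn_ball' R), hN0, zero_add]
        exact hC

lemma contDiff_delta (i j : Fin 3) :
    ContDiff ℝ 1 fun _ : Fin 3 → ℝ => if i = j then (1 : ℝ) else 0 := contDiff_const

lemma divF_delta (v : (Fin 3 → ℝ) → ℝ) (x : Fin 3 → ℝ) :
    divF (fun _ i j => if i = j then 1 else 0) v x = lap v x := by
  simp only [divF, lap, ite_mul, one_mul, zero_mul, Finset.sum_ite_eq, Finset.mem_univ, if_true]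

lemma quadForm_delta (ξ η : Fin 3 → ℝ) :
    quadForm (fun i j => if i = j then 1 else 0) ξ η = ∑ i, ξ i * η i := by
  simp only [quadForm, ite_mul, one_mul, zero_mul, Finset.sum_ite_eq, Finset.mem_univ, if_true]

lemma quadForm_smul_left (F : Fin 3 → Fin 3 → ℝ) (s : ℝ) (ξ η : Fin 3 → ℝ) :
    quadForm F (fun i => s * ξ i) η = s * quadForm F ξ η := by
  simp only [quadForm, Finset.mul_sum]
  exact Finset.sum_congr rfl fun i _ => Finset.sum_congr rfl fun j _ => by ring

lemma quadForm_smul_right (F : Fin 3 → Fin 3 → ℝ) (s : ℝ) (ξ η : Fin 3 → ℝ) :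
    quadForm F ξ (fun i => s * η i) = s * quadForm F ξ η := by
  simp only [quadForm, Finset.mul_sum]
  exact Finset.sum_congr rfl fun i _ => Finset.sum_congr rfl fun j _ => by ring

lemma quadForm_add_left (F : Fin 3 → Fin 3 → ℝ) (ξ ξ' η : Fin 3 → ℝ) :
    quadForm F (fun i => ξ i + ξ' i) η = quadForm F ξ η + quadForm F ξ' η := by
  simp only [quadForm, ← Finset.sum_add_distrib]
  exact Finset.sum_congr rfl fun i _ => Finset.sum_congr rfl fun j _ => by ring

lemma continuous_vol {u g : (Fin 3 → ℝ) → ℝ} (hu : ContDiff ℝ 4 u) (hg : ContDiff ℝ 2 g) :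
    Continuous (vol u g) := by
  have h1 := (contDiff_lap hu).continuous
  have h2 := hg.continuous
  have h3 := fun i j => (contDiff_hs hu i j).continuous
  unfold vol volDensity traceFHH quadForm linCoeff
  fun_prop

lemma closedBall_subset_three_quarters {R : ℝ} (hR : R ≤ 1 / 2) :
    closedBall (0 : Fin 3 → ℝ) R ⊆ ball 0 (3 / 4) := closedBall_subset_ball (by linarith)

namespace Sol

variable {P : ℝ} {u g b : (Fin 3 → ℝ) → ℝ} {x : Fin 3 → ℝ}

lemma coeff_smooth (h : Sol P u g b) (i j : Fin 3) : ContDiff ℝ 1 fun x => coeff u g x i j :=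
  (contDiff_coeff h.u_smooth h.g_smooth i j).of_le one_le_two

lemma abs_quadForm_smul_le (h : Sol P u g b) (hx : x ∈ ball (0 : Fin 3 → ℝ) (3 / 4)) (s t : ℝ)
    (ξ η : Fin 3 → ℝ) : 2 * |s * (t * quadForm (coeff u g x) ξ η)|
      ≤ s ^ 2 * quadForm (coeff u g x) ξ ξ + t ^ 2 * quadForm (coeff u g x) η η := by
  have := h.abs_quadForm_le hx (fun i => s * ξ i) (fun i => t * η i)
  simp only [quadForm_smul_left, quadForm_smul_right] at this
  rw [mul_left_comm t s] at this
  linarith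

lemma abs_divF_le (h : Sol P u g b) (hx : x ∈ ball (0 : Fin 3 → ℝ) (3 / 4)) {r R A : ℝ}
    {φ : (Fin 3 → ℝ) → ℝ} (hφ : IsCutoff r R A φ) :
    |divF (coeff u g) φ x| ≤ 21 * A * P ^ 2 * lap u x := by
  have hP := h.one_le
  have hA := hφ.one_le
  have hS := h.lap_pos x hx
  have hg := h.g_pos hx
  have h3 := (h.hessData hx).three_mul_le
  have hF : ∀ i j, |coeff u g x i j| ≤ 2 * lap u x := fun i j => by
    have h1 := abs_le.1 (h.abs_hs_le hx i j)
    unfold coeff linCoeff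
    rw [abs_le]
    split_ifs <;> constructor <;> linarith
  rw [divF_coeff_eq h.u_smooth h.g_smooth hφ.smooth]
  have e1 : |∑ i, ∑ j, coeff u g x i j * pd i (pd j φ) x| ≤ 3 * (3 * (2 * lap u x * A)) :=
    abs_sum_three_le fun i => abs_sum_three_le fun j => by
      rw [abs_mul]
      exact mul_le_mul (hF i j) (hφ.abs_pd_pd_le i j x) (abs_nonneg _) (by linarith)
  have e2 : |∑ j, pd j g x * pd j φ x| ≤ 3 * (P * A) := abs_sum_three_le fun j => by
    rw [abs_mul]
    exact mul_le_mul (h.g_grad x hx j) (hφ.abs_pd_le j x) (abs_nonneg _) (by linarith)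
  have e3 : P * A ≤ P * A * (P * lap u x) :=
    le_mul_of_one_le_right (by positivity) (h.one_le_lap hx)
  have e4 : A * lap u x ≤ P ^ 2 * (A * lap u x) :=
    le_mul_of_one_le_left (by positivity) (one_le_pow₀ hP)
  have := (abs_sub _ _).trans (add_le_add e1 e2)
  linarith

lemma quadForm_cutoff_le (h : Sol P u g b) (hx : x ∈ ball (0 : Fin 3 → ℝ) (3 / 4)) {r R A : ℝ}
    {φ : (Fin 3 → ℝ) → ℝ} (hφ : IsCutoff r R A φ) :
    quadForm (coeff u g x) (grad φ x) (grad φ x) ≤ 6 * A ^ 2 * lap u x := by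
  refine ((h.hessData hx).quadForm_le _).trans ?_
  have e1 : ∑ i, grad φ x i ^ 2 ≤ ∑ _i : Fin 3, A ^ 2 := Finset.sum_le_sum fun i _ => by
    rw [← sq_abs]; exact pow_le_pow_left₀ (abs_nonneg _) (hφ.abs_pd_le i x) 2
  simp only [Finset.sum_const, Finset.card_univ, Fintype.card_fin, nsmul_eq_mul] at e1
  push_cast at e1
  have := mul_le_mul_of_nonneg_left e1 (h.lap_pos x hx).le
  linarith

lemma abs_pd_b_le (h : Sol P u g b) (hx : x ∈ ball (0 : Fin 3 → ℝ) (3 / 4)) (i : Fin 3) :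
    |pd i b x| ≤ P * (lap u x + quadForm (coeff u g x) (grad b x) (grad b x)) := by
  have hP := h.one_le
  have hS := h.lap_pos x hx
  have hq := h.quadForm_nonneg hx (grad b x)
  have h1 := (h.hessData hx).le_quadForm (grad b x)
  change _ ≤ 2 * lap u x * quadForm (coeff u g x) (grad b x) (grad b x) at h1
  have h2 : 1 ≤ P ^ 2 * g x ^ 2 := by rw [← mul_pow]; exact one_le_pow₀ (h.g_lower x hx)
  have h3 : grad b x i ^ 2 ≤ ∑ i, grad b x i ^ 2 :=
    Finset.single_le_sum (fun _ _ => sq_nonneg _) (Finset.mem_univ i)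
  have h4 : 0 ≤ ∑ i, grad b x i ^ 2 := Finset.sum_nonneg fun _ _ => sq_nonneg _
  have h5 := mul_le_mul_of_nonneg_left h1 (sq_nonneg P)
  have h6 := mul_le_mul_of_nonneg_right h2 h4
  refine abs_le_of_sq_le_sq ?_ (by positivity)
  change grad b x i ^ 2 ≤ _
  have h7 : 0 ≤ P ^ 2 * lap u x ^ 2 := by positivity
  have h8 : 0 ≤ P ^ 2 * quadForm (coeff u g x) (grad b x) (grad b x) ^ 2 := by positivity
  linarith

lemma continuous_energy (h : Sol P u g b) {v w : (Fin 3 → ℝ) → ℝ} (hv : ContDiff ℝ 1 v)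
    (hw : ContDiff ℝ 1 w) : Continuous fun x => quadForm (coeff u g x) (grad v x) (grad w x) :=
  continuous_quadForm (fun i j => (h.coeff_smooth i j).continuous) hv hw

end Sol

lemma exists_integral_lap_le (P : ℝ) : ∃ C, ∀ u g b, Sol P u g b →
    ∫ x in closedBall (0 : Fin 3 → ℝ) (9 / 20), lap u x ≤ C := by
  obtain ⟨A, φ, hφ⟩ := exists_isCutoff (show (0 : ℝ) < 9 / 20 by norm_num)
    (show (9 / 20 : ℝ) < 1 / 2 by norm_num)
  refine ⟨∫ x in closedBall (0 : Fin 3 → ℝ) (1 / 2), 3 * (A * P), fun u g b h => ?_⟩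
  have hu : ContDiff ℝ 2 u := h.u_smooth.of_le (by norm_num)
  have hφ1 := hφ.smooth.of_le one_le_two
  have hS := (contDiff_lap h.u_smooth).continuous
  refine setIntegral_le_of_le_add (by norm_num) hS (hφ.smooth.continuous.fun_mul hS)
    ((hφ.smooth.continuous.fun_mul (continuous_divF contDiff_delta hu)).fun_add
      (continuous_quadForm (fun i j => (contDiff_delta i j).continuous) hφ1
        (hu.of_le one_le_two))) continuous_const (fun x hx => ?_) (fun x hx => ?_)
    (fun x hx => ?_) (integral_divF contDiff_delta hu hφ1 (.inl hφ.eq_zero)) le_rfl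
  · exact mul_nonneg (hφ.nonneg x) (h.lap_pos x (closedBall_subset_three_quarters le_rfl hx)).le
  · rw [hφ.eq_one x hx, one_mul]
  · have hx' := closedBall_subset_three_quarters le_rfl hx
    rw [divF_delta, quadForm_delta]
    have : |∑ i, grad φ x i * grad u x i| ≤ 3 * (A * P) := Sol.abs_sum_three_le fun i => by
      rw [abs_mul]
      exact mul_le_mul (hφ.abs_pd_le i x) (h.u_grad x hx' i) (abs_nonneg _)
        (by linarith [hφ.one_le])
    linarith [(abs_le.1 this).1]

lemma integral_const_mul_le {r c C : ℝ} {f : (Fin 3 → ℝ) → ℝ} (hc : 0 ≤ c)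
    (h : ∫ x in closedBall (0 : Fin 3 → ℝ) r, f x ≤ C) :
    ∫ x in closedBall (0 : Fin 3 → ℝ) r, c * f x ≤ c * C := by
  rw [integral_const_mul]
  exact mul_le_mul_of_nonneg_left h hc

lemma integral_add_le {r C₁ C₂ : ℝ} {f₁ f₂ : (Fin 3 → ℝ) → ℝ} (hf₁ : Continuous f₁)
    (hf₂ : Continuous f₂) (h₁ : ∫ x in closedBall (0 : Fin 3 → ℝ) r, f₁ x ≤ C₁)
    (h₂ : ∫ x in closedBall (0 : Fin 3 → ℝ) r, f₂ x ≤ C₂) :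
    ∫ x in closedBall (0 : Fin 3 → ℝ) r, (f₁ x + f₂ x) ≤ C₁ + C₂ := by
  rw [integral_add (hf₁.integrableOn_ball' r) (hf₂.integrableOn_ball' r)]
  exact add_le_add h₁ h₂

lemma integral_le_of_subset {r R C : ℝ} {f : (Fin 3 → ℝ) → ℝ} (hf : Continuous f) (hrR : r ≤ R)
    (h0 : ∀ x ∈ closedBall (0 : Fin 3 → ℝ) R, 0 ≤ f x)
    (h : ∫ x in closedBall (0 : Fin 3 → ℝ) R, f x ≤ C) :
    ∫ x in closedBall (0 : Fin 3 → ℝ) r, f x ≤ C :=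
  setIntegral_le_of_le_add (N := fun _ => 0) hrR hf hf continuous_const hf h0 (fun _ _ => le_rfl)
    (fun x _ => by simp) (by simp) h

lemma exists_integral_energy_le (P : ℝ) : ∃ C, ∀ u g b, Sol P u g b →
    ∫ x in closedBall (0 : Fin 3 → ℝ) (8 / 20),
      quadForm (coeff u g x) (grad b x) (grad b x) ≤ C := by
  obtain ⟨A, φ, hφ⟩ := exists_isCutoff (show (0 : ℝ) < 8 / 20 by norm_num)
    (show (8 / 20 : ℝ) < 9 / 20 by norm_num)
  obtain ⟨C, hC⟩ := exists_integral_lap_le P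
  refine ⟨24 * (144 * A ^ 2 + 60019 * P ^ 4) * C, fun u g b h => ?_⟩
  have hφ1 := hφ.smooth.of_le one_le_two
  have hb1 := h.b_smooth.of_le one_le_two
  have hφ2 : ContDiff ℝ 1 fun x => φ x * φ x := hφ1.mul hφ1
  have hS := (contDiff_lap h.u_smooth).continuous
  have hE := h.continuous_energy hb1 hb1
  refine setIntegral_le_of_le_add (by norm_num) hE ((hφ.smooth.continuous.fun_pow 2).fun_mul hE)
    ((continuous_const (y := (24 : ℝ))).fun_mul ((hφ2.continuous.fun_mul (continuous_divF h.coeff_smooth h.b_smooth)).fun_add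
      (h.continuous_energy hφ2 hb1))) (continuous_const.fun_mul hS) (fun x hx => ?_) (fun x hx => ?_)
    (fun x hx => ?_) ?_
    (integral_const_mul_le (c := 24 * (144 * A ^ 2 + 60019 * P ^ 4)) (by positivity) (hC u g b h))
  · exact mul_nonneg (sq_nonneg _)
      (h.quadForm_nonneg (closedBall_subset_three_quarters (by norm_num) hx) _)
  · rw [hφ.eq_one x hx, one_pow, one_mul]
  · have hx' := closedBall_subset_three_quarters (by norm_num) hx
    have e : grad (fun y => φ y * φ y) x = fun i => (2 * φ x) * grad φ x i := by
      rw [grad_mul hφ1 hφ1]; funext i; ring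
    rw [e, quadForm_smul_left]
    have j := mul_le_mul_of_nonneg_left (h.jacobi hx') (mul_self_nonneg (φ x))
    have k := h.abs_quadForm_smul_le hx' 24 (φ x) (grad φ x) (grad b x)
    have k' := neg_abs_le (24 * (φ x * quadForm (coeff u g x) (grad φ x) (grad b x)))
    have l := h.quadForm_cutoff_le hx' hφ
    have m : φ x * φ x * (60019 * P ^ 4 * lap u x) ≤ 60019 * P ^ 4 * lap u x :=
      mul_le_of_le_one_left (mul_nonneg (by positivity) (h.lap_pos x hx').le)
        (mul_le_one₀ (hφ.le_one x) (hφ.nonneg x) (hφ.le_one x))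
    linarith
  · rw [integral_const_mul, integral_divF h.coeff_smooth h.b_smooth hφ2 (.inl fun x hx => ?_),
      mul_zero]
    simp [hφ.eq_zero x hx]

lemma exists_integral_lap_mul_le (P : ℝ) : ∃ C, ∀ u g b, Sol P u g b →
    ∫ x in closedBall (0 : Fin 3 → ℝ) (7 / 20), b x * lap u x ≤ C := by
  obtain ⟨A, φ, hφ⟩ := exists_isCutoff (show (0 : ℝ) < 7 / 20 by norm_num)
    (show (7 / 20 : ℝ) < 8 / 20 by norm_num)
  obtain ⟨C₁, hC₁⟩ := exists_integral_lap_le P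
  obtain ⟨C₂, hC₂⟩ := exists_integral_energy_le P
  refine ⟨(3 * A * P ^ 2 + 3 * P ^ 2) * C₁ + 3 * P ^ 2 * C₂, fun u g b h => ?_⟩
  have hA := hφ.one_le
  have hP := h.one_le
  have hu : ContDiff ℝ 2 u := h.u_smooth.of_le (by norm_num)
  have hφ1 := hφ.smooth.of_le one_le_two
  have hb1 := h.b_smooth.of_le one_le_two
  have hφb : ContDiff ℝ 1 fun x => φ x * b x := hφ1.mul hb1
  have hS := (contDiff_lap h.u_smooth).continuous
  have hE := h.continuous_energy hb1 hb1
  have hSb := hb1.continuous.fun_mul hS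
  have hC₁' := integral_le_of_subset hS (show (8 / 20 : ℝ) ≤ 9 / 20 by norm_num)
    (fun x hx => (h.lap_pos x (closedBall_subset_three_quarters (by norm_num) hx)).le) (hC₁ u g b h)
  refine setIntegral_le_of_le_add (by norm_num) hSb (hφ.smooth.continuous.fun_mul hSb)
    ((hφb.continuous.fun_mul (continuous_divF contDiff_delta hu)).fun_add
      (continuous_quadForm (fun i j => (contDiff_delta i j).continuous) hφb
        (hu.of_le one_le_two))) ((continuous_const.fun_mul hS).fun_add (continuous_const.fun_mul hE))
    (fun x hx => ?_) (fun x hx => ?_)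
    (fun x hx => ?_) (integral_divF contDiff_delta hu hφb (.inl fun x hx => ?_))
    (integral_add_le (continuous_const.fun_mul hS) (continuous_const.fun_mul hE)
      (integral_const_mul_le (c := 3 * A * P ^ 2 + 3 * P ^ 2) (by positivity) hC₁')
      (integral_const_mul_le (by positivity) (hC₂ u g b h)))
  · have hx' := closedBall_subset_three_quarters (by norm_num) hx
    exact mul_nonneg (hφ.nonneg x) (mul_nonneg (by linarith [h.one_le_b x hx'])
      (h.lap_pos x hx').le)
  · rw [hφ.eq_one x hx, one_mul]
  · have hx' := closedBall_subset_three_quarters (by norm_num) hx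
    have hS0 := h.lap_pos x hx'
    have hq := h.quadForm_nonneg hx' (grad b x)
    have hb := h.one_le_b x hx'
    rw [divF_delta, quadForm_delta, grad_mul hφ1 hb1]
    set E := quadForm (coeff u g x) (grad b x) (grad b x)
    have e1 : |∑ i, (φ x * grad b x i + b x * grad φ x i) * grad u x i|
        ≤ 3 * ((P * (lap u x + E) + P * lap u x * A) * P) := Sol.abs_sum_three_le fun i => by
      rw [abs_mul]
      refine mul_le_mul ((abs_add_le _ _).trans (add_le_add ?_ ?_)) (h.u_grad x hx' i)
        (abs_nonneg _) (by positivity)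
      · rw [abs_mul, abs_of_nonneg (hφ.nonneg x)]
        exact (mul_le_of_le_one_left (abs_nonneg _) (hφ.le_one x)).trans (h.abs_pd_b_le hx' i)
      · rw [abs_mul, abs_of_nonneg (by linarith)]
        exact mul_le_mul (h.b_le x hx') (hφ.abs_pd_le i x) (abs_nonneg _) (by positivity)
    linarith [(abs_le.1 e1).1]
  · simp [hφ.eq_zero x hx]

lemma graphDist_nonneg (u : (Fin 3 → ℝ) → ℝ) (x : Fin 3 → ℝ) : 0 ≤ graphDist 0 0 0 u x := by
  unfold graphDist
  have : 0 ≤ ∑ k, (pd k u x - (0 : Fin 3 → ℝ) k - 0 * x k) ^ 2 :=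
    Finset.sum_nonneg fun _ _ => sq_nonneg _
  linarith

lemma Sol.graphDist_le {P : ℝ} {u g b : (Fin 3 → ℝ) → ℝ} {x : Fin 3 → ℝ} (h : Sol P u g b)
    (hx : x ∈ ball (0 : Fin 3 → ℝ) (3 / 4)) : graphDist 0 0 0 u x ≤ 3 / 2 * P ^ 2 := by
  unfold graphDist
  have e1 : ∑ k, (pd k u x - (0 : Fin 3 → ℝ) k - 0 * x k) ^ 2 ≤ ∑ _i : Fin 3, P ^ 2 :=
    Finset.sum_le_sum fun i _ => by
      rw [Pi.zero_apply, zero_mul, sub_zero, sub_zero, ← sq_abs]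
      exact pow_le_pow_left₀ (abs_nonneg _) (h.u_grad x hx i) 2
  simp only [Finset.sum_const, Finset.card_univ, Fintype.card_fin, nsmul_eq_mul] at e1
  push_cast at e1
  linarith

lemma exists_integral_vol_le (P : ℝ) : ∃ C, ∀ u g b, Sol P u g b →
    ∫ x in closedBall (0 : Fin 3 → ℝ) (7 / 20), vol u g x ≤ C := by
  obtain ⟨A, φ, hφ⟩ := exists_isCutoff (show (0 : ℝ) < 7 / 20 by norm_num)
    (show (7 / 20 : ℝ) < 9 / 20 by norm_num)
  obtain ⟨C, hC⟩ := exists_integral_lap_le P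
  refine ⟨(32 * A * P ^ 4 + 13 * P ^ 2) * C, fun u g b h => ?_⟩
  have hA := hφ.one_le
  have hS := (contDiff_lap h.u_smooth).continuous
  have hV := continuous_vol h.u_smooth h.g_smooth
  have hq : ContDiff ℝ 2 (graphDist 0 0 0 u) :=
    (contDiff_graphDist h.u_smooth).of_le (by norm_num)
  refine setIntegral_le_of_le_add (by norm_num) hV (hφ.smooth.continuous.fun_mul hV)
    ((hφ.smooth.continuous.fun_mul (continuous_divF h.coeff_smooth hq)).fun_sub
      (hq.continuous.fun_mul (continuous_divF h.coeff_smooth hφ.smooth)))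
    (continuous_const.fun_mul hS) (fun x hx => ?_) (fun x hx => ?_) (fun x hx => ?_)
    (integral_divF_comm h.coeff_smooth (coeff_symm h.u_smooth) hq hφ.smooth hφ.eq_zero)
    (integral_const_mul_le (c := 32 * A * P ^ 4 + 13 * P ^ 2) (by positivity) (hC u g b h))
  · exact mul_nonneg (hφ.nonneg x) (h.vol_pos (closedBall_subset_three_quarters (by norm_num) hx)).le
  · rw [hφ.eq_one x hx, one_mul]
  · have hx' := closedBall_subset_three_quarters (by norm_num) hx
    have hS0 := h.lap_pos x hx'
    have e1 := mul_le_mul_of_nonneg_left (h.three_vol_le hx') (hφ.nonneg x)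
    have e2 : φ x * (13 * P ^ 2 * lap u x) ≤ 13 * P ^ 2 * lap u x :=
      mul_le_of_le_one_left (by positivity) (hφ.le_one x)
    have e3 : graphDist 0 0 0 u x * divF (coeff u g) φ x
        ≤ 3 / 2 * P ^ 2 * (21 * A * P ^ 2 * lap u x) :=
      (mul_le_mul_of_nonneg_left ((le_abs_self _).trans (h.abs_divF_le hx' hφ))
        (graphDist_nonneg u x)).trans
        (mul_le_mul_of_nonneg_right (h.graphDist_le hx') (by positivity))
    have e4 := mul_nonneg (hφ.nonneg x) (h.vol_pos hx').le
    have e5 : 0 ≤ A * P ^ 4 * lap u x := by positivity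
    linarith

lemma exists_integral_vol_mul_le (P : ℝ) : ∃ C, ∀ u g b, Sol P u g b →
    ∫ x in closedBall (0 : Fin 3 → ℝ) (3 / 10), b x * vol u g x ≤ C := by
  obtain ⟨A, φ, hφ⟩ := exists_isCutoff (show (0 : ℝ) < 3 / 10 by norm_num)
    (show (3 / 10 : ℝ) < 7 / 20 by norm_num)
  obtain ⟨C₁, hC₁⟩ := exists_integral_lap_le P
  obtain ⟨C₂, hC₂⟩ := exists_integral_energy_le P
  obtain ⟨C₃, hC₃⟩ := exists_integral_lap_mul_le P
  obtain ⟨C₄, hC₄⟩ := exists_integral_vol_le P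
  refine ⟨(32 * A * P ^ 4 + 13 * P ^ 2) * C₃ + (P ^ 2 + 1) * C₂ + 6 * A ^ 2 * P ^ 2 * C₁
    + 9 * P ^ 2 * C₄, fun u g b h => ?_⟩
  have hA := hφ.one_le
  have hP := h.one_le
  have hφ1 := hφ.smooth.of_le one_le_two
  have hb1 := h.b_smooth.of_le one_le_two
  have hφb : ContDiff ℝ 1 fun x => φ x * b x := hφ1.mul hb1
  have hS := (contDiff_lap h.u_smooth).continuous
  have hE := h.continuous_energy hb1 hb1
  have hSb := hb1.continuous.fun_mul hS
  have hV := continuous_vol h.u_smooth h.g_smooth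
  have hq : ContDiff ℝ 2 (graphDist 0 0 0 u) :=
    (contDiff_graphDist h.u_smooth).of_le (by norm_num)
  have hq1 := hq.of_le one_le_two
  have hqb : ContDiff ℝ 1 fun x => graphDist 0 0 0 u x * b x := hq1.mul hb1
  have hC₁' := integral_le_of_subset hS (show (7 / 20 : ℝ) ≤ 9 / 20 by norm_num)
    (fun x hx => (h.lap_pos x (closedBall_subset_three_quarters (by norm_num) hx)).le) (hC₁ u g b h)
  have hC₂' := integral_le_of_subset hE (show (7 / 20 : ℝ) ≤ 8 / 20 by norm_num)
    (fun x hx => h.quadForm_nonneg (closedBall_subset_three_quarters (by norm_num) hx) _)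
    (hC₂ u g b h)
  have c1 := continuous_const (y := 32 * A * P ^ 4 + 13 * P ^ 2) |>.fun_mul hSb
  have c2 := continuous_const (y := P ^ 2 + 1) |>.fun_mul hE
  have c3 := continuous_const (y := 6 * A ^ 2 * P ^ 2) |>.fun_mul hS
  have c4 := continuous_const (y := 9 * P ^ 2) |>.fun_mul hV
  have n1 := (hφb.continuous.fun_mul (continuous_divF h.coeff_smooth hq)).fun_add
    (h.continuous_energy hφb hq1)
  have n2 := (hqb.continuous.fun_mul (continuous_divF h.coeff_smooth hφ.smooth)).fun_add
    (h.continuous_energy hqb hφ1)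
  refine setIntegral_le_of_le_add (by norm_num) (hb1.continuous.fun_mul hV)
    (hφ.smooth.continuous.fun_mul (hb1.continuous.fun_mul hV)) (n1.fun_sub n2)
    (((c1.fun_add c2).fun_add c3).fun_add c4) (fun x hx => ?_) (fun x hx => ?_) (fun x hx => ?_) ?_
    (integral_add_le ((c1.fun_add c2).fun_add c3) c4 (integral_add_le (c1.fun_add c2) c3
      (integral_add_le c1 c2 (integral_const_mul_le (by positivity) (hC₃ u g b h))
      (integral_const_mul_le (by positivity) hC₂')) (integral_const_mul_le (by positivity) hC₁'))
      (integral_const_mul_le (by positivity) (hC₄ u g b h)))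
  · have hx' := closedBall_subset_three_quarters (by norm_num) hx
    exact mul_nonneg (hφ.nonneg x) (mul_nonneg (by linarith [h.one_le_b x hx'])
      (h.vol_pos hx').le)
  · rw [hφ.eq_one x hx, one_mul]
  · have hx' := closedBall_subset_three_quarters (by norm_num) hx
    have hS0 := h.lap_pos x hx'
    have hV0 := h.vol_pos hx'
    have hb := h.one_le_b x hx'
    have hE0 := h.quadForm_nonneg hx' (grad b x)
    have hφ0 := hφ.nonneg x
    have hq0 := graphDist_nonneg u x
    have hq2 := h.graphDist_le hx'
    rw [grad_mul hφ1 hb1, grad_mul hq1 hb1]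
    simp only [quadForm_add_left, quadForm_smul_left]
    rw [quadForm_comm (coeff_symm h.u_smooth x) (grad (graphDist 0 0 0 u) x) (grad φ x)]
    have e1 := mul_le_mul_of_nonneg_left (h.three_vol_le hx')
      (mul_nonneg hφ0 (zero_le_one.trans hb))
    have e2 : φ x * b x * (13 * P ^ 2 * lap u x) ≤ 13 * P ^ 2 * (b x * lap u x) := by
      rw [show φ x * b x * (13 * P ^ 2 * lap u x) = φ x * (13 * P ^ 2 * (b x * lap u x)) by ring]
      exact mul_le_of_le_one_left (by positivity) (hφ.le_one x)
    have e3 : graphDist 0 0 0 u x * b x * divF (coeff u g) φ x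
        ≤ 3 / 2 * P ^ 2 * b x * (21 * A * P ^ 2 * lap u x) :=
      (mul_le_mul_of_nonneg_left ((le_abs_self _).trans (h.abs_divF_le hx' hφ))
        (by positivity)).trans (mul_le_mul_of_nonneg_right
          (mul_le_mul_of_nonneg_right hq2 (by positivity)) (by positivity))
    have e4 : 2 * |quadForm (coeff u g x) (grad b x) (grad φ x)|
        ≤ quadForm (coeff u g x) (grad b x) (grad b x) + 6 * A ^ 2 * lap u x :=
      (h.abs_quadForm_le hx' _ _).trans (by linarith [h.quadForm_cutoff_le hx' hφ])
    have e5 : graphDist 0 0 0 u x * quadForm (coeff u g x) (grad b x) (grad φ x)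
        ≤ P ^ 2 * (quadForm (coeff u g x) (grad b x) (grad b x) + 6 * A ^ 2 * lap u x) :=
      calc _ ≤ graphDist 0 0 0 u x * |quadForm (coeff u g x) (grad b x) (grad φ x)| :=
            mul_le_mul_of_nonneg_left (le_abs_self _) hq0
        _ ≤ (3 / 2 * P ^ 2) * |quadForm (coeff u g x) (grad b x) (grad φ x)| :=
            mul_le_mul_of_nonneg_right hq2 (abs_nonneg _)
        _ ≤ _ := by
            have := mul_le_mul_of_nonneg_left e4 (sq_nonneg P)
            have : 0 ≤ P ^ 2 * |quadForm (coeff u g x) (grad b x) (grad φ x)| := by positivity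
            linarith
    have e6 : -(φ x * quadForm (coeff u g x) (grad b x) (grad (graphDist 0 0 0 u) x))
        ≤ quadForm (coeff u g x) (grad b x) (grad b x) + 9 * P ^ 2 * vol u g x := by
      have s1 := h.abs_quadForm_le hx' (grad b x) (grad (graphDist 0 0 0 u) x)
      have s2 := h.quadForm_energy_le hx'
      have s3 : φ x * |quadForm (coeff u g x) (grad b x) (grad (graphDist 0 0 0 u) x)|
          ≤ |quadForm (coeff u g x) (grad b x) (grad (graphDist 0 0 0 u) x)| :=
        mul_le_of_le_one_left (abs_nonneg _) (hφ.le_one x)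
      have s4 := mul_le_mul_of_nonneg_left (neg_abs_le
        (quadForm (coeff u g x) (grad b x) (grad (graphDist 0 0 0 u) x))) hφ0
      have s5 := abs_nonneg (quadForm (coeff u g x) (grad b x) (grad (graphDist 0 0 0 u) x))
      linarith
    have e7 : 0 ≤ φ x * (b x * vol u g x) := by positivity
    have e8 : 0 ≤ A * P ^ 4 * (b x * lap u x) := by positivity
    linarith
  · rw [integral_sub (n1.integrableOn_ball' _) (n2.integrableOn_ball' _),
      integral_divF h.coeff_smooth hq hφb (.inl fun x hx => by simp [hφ.eq_zero x hx]),
      integral_divF h.coeff_smooth hφ.smooth hqb (.inr hφ.eq_zero), sub_zero]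

end

section

open MeasureTheory Filter Topology Matrix

lemma originDist_nonneg (u g : (Fin 3 → ℝ) → ℝ) (x : Fin 3 → ℝ) : 0 ≤ originDist u g x := by
  unfold originDist graphDist
  positivity

lemma fderiv_eq_sum_pd (f : (Fin 3 → ℝ) → ℝ) (x v : Fin 3 → ℝ) :
    fderiv ℝ f x v = ∑ i, v i * pd i f x := by
  have e : v = ∑ i, v i • (Pi.single i 1 : Fin 3 → ℝ) := by
    ext j; simp [Finset.sum_apply, Pi.single_apply]
  conv_lhs => rw [e]
  rw [map_sum]
  exact Finset.sum_congr rfl fun i _ => by rw [map_smul, smul_eq_mul, pd]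

lemma measureReal_preimage_ball (Q : Matrix (Fin 3) (Fin 3) ℝ) (hQ : Q.det ≠ 0) {r : ℝ}
    (hr : 0 ≤ r) :
    volume.real (Matrix.toLin' Q ⁻¹' ball (0 : Fin 3 → ℝ) r) = (2 * r) ^ 3 / |Q.det| := by
  have hd : LinearMap.det (Matrix.toLin' Q) ≠ 0 := by rwa [LinearMap.det_toLin']
  rw [measureReal_def, Measure.addHaar_preimage_linearMap _ hd, LinearMap.det_toLin',
    ENNReal.toReal_mul, ENNReal.toReal_ofReal (abs_nonneg _)]
  rcases hr.eq_or_lt with rfl | hr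
  · simp
  · rw [Real.volume_pi_ball _ hr, ENNReal.toReal_ofReal (by positivity), Fintype.card_fin, abs_inv]
    ring

lemma Sol.exists_density_set {P : ℝ} {u g b : (Fin 3 → ℝ) → ℝ} (h : Sol P u g b) {ε₀ : ℝ}
    (hε₀ : 0 < ε₀) : ∃ ε, 0 < ε ∧ ε ≤ ε₀ ∧ ∃ A : Set (Fin 3 → ℝ), MeasurableSet A ∧
      A ⊆ closedBall 0 (3 / 10) ∧
      (∀ x ∈ A, 2 * originDist u g x < ε ^ 2 ∧ b 0 / 2 ≤ b x ∧ vol u g 0 / 2 ≤ vol u g x) ∧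
      volume.real A = 8 * ε ^ 3 / (27 * vol u g 0) := by
  have g0 := h.g_pos zero_mem
  have b0 := h.one_le_b 0 zero_mem
  have V0 := h.vol_pos zero_mem
  obtain ⟨Q, hQd, hQ⟩ := (h.hessData zero_mem).exists_sqrt_metric
  have hdet : Q.det ≠ 0 := fun e => by
    rw [e, abs_zero] at hQd
    exact V0.ne hQd
  have ev1 : ∀ᶠ x in 𝓝 (0 : Fin 3 → ℝ), b 0 / 2 ≤ b x :=
    (h.b_smooth.continuous.continuousAt.eventually (lt_mem_nhds (by linarith))).mono
      fun x hx => le_of_lt hx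
  have ev2 : ∀ᶠ x in 𝓝 (0 : Fin 3 → ℝ), vol u g 0 / 2 ≤ vol u g x :=
    ((continuous_vol h.u_smooth h.g_smooth).continuousAt.eventually
      (lt_mem_nhds (by linarith))).mono fun x hx => le_of_lt hx
  have ev3 : ∀ᶠ x in 𝓝 (0 : Fin 3 → ℝ), ∀ k,
      |pd k u x - pd k u 0 - ∑ j, hs u 0 k j * x j| ≤ g 0 / 4 * ‖x‖ := by
    rw [eventually_all]
    intro k
    have hd : DifferentiableAt ℝ (pd k u) 0 :=
      (h.u_smooth.pd k (m := 3) (by norm_num)).differentiable (by norm_num) 0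
    filter_upwards [hd.hasFDerivAt.isLittleO.bound (by positivity : 0 < g 0 / 4)] with x hx
    simp only [sub_zero, Real.norm_eq_abs] at hx
    convert hx using 3
    rw [fderiv_eq_sum_pd]
    exact Finset.sum_congr rfl fun j _ => by rw [mul_comm, hs_symm h.u_smooth]; rfl
  obtain ⟨δ, hδ, hball⟩ := Metric.eventually_nhds_iff_ball.1 (ev1.and (ev2.and ev3))
  set δ' := min δ (3 / 10) with hδ'
  have hδ'0 : 0 < δ' := lt_min hδ (by norm_num)
  refine ⟨min ε₀ (δ' * g 0), lt_min hε₀ (by positivity), min_le_left _ _,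
    Matrix.toLin' Q ⁻¹' ball 0 (min ε₀ (δ' * g 0) / 3), ?_, ?_⟩
  · exact (LinearMap.continuous_of_finiteDimensional _).measurable measurableSet_ball
  set ε := min ε₀ (δ' * g 0) with hε
  have hε0 : 0 < ε := lt_min hε₀ (by positivity)
  have hεδ : ε ≤ δ' * g 0 := min_le_right _ _
  have hA : ∀ x ∈ Matrix.toLin' Q ⁻¹' ball (0 : Fin 3 → ℝ) (ε / 3),
      ∑ i, (Q *ᵥ x) i ^ 2 ≤ ε ^ 2 / 3 := fun x hx => by
    have hx' : ‖Q *ᵥ x‖ < ε / 3 := by simpa using hx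
    have : ∀ i, (Q *ᵥ x) i ^ 2 ≤ (ε / 3) ^ 2 := fun i => by
      rw [← sq_abs]
      exact pow_le_pow_left₀ (abs_nonneg _) ((norm_le_pi_norm _ i).trans hx'.le) 2
    calc _ ≤ ∑ _i : Fin 3, (ε / 3) ^ 2 := Finset.sum_le_sum fun i _ => this i
      _ = _ := by simp; ring
  have hnorm : ∀ x : Fin 3 → ℝ, ‖x‖ ^ 2 ≤ ∑ i, x i ^ 2 := fun x => by
    have h1 : ‖x‖ ≤ √(∑ i, x i ^ 2) := (pi_norm_le_iff_of_nonneg (Real.sqrt_nonneg _)).2 fun i =>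
      Real.abs_le_sqrt (Finset.single_le_sum (f := fun i => x i ^ 2) (fun _ _ => sq_nonneg _)
        (Finset.mem_univ i))
    calc _ ≤ √(∑ i, x i ^ 2) ^ 2 := pow_le_pow_left₀ (norm_nonneg _) h1 2
      _ = _ := Real.sq_sqrt (Finset.sum_nonneg fun _ _ => sq_nonneg _)
  have hQn : ∀ x : Fin 3 → ℝ, 3 * g 0 ^ 2 / 4 * ‖x‖ ^ 2 ≤ ∑ i, (Q *ᵥ x) i ^ 2 := fun x => by
    have h1 := mul_le_mul_of_nonneg_left (hnorm x) (by positivity : 0 ≤ 3 * g 0 ^ 2 / 4)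
    have h2 : 0 ≤ ∑ i, (∑ k, hs u 0 i k * x k - g 0 / 2 * x i) ^ 2 :=
      Finset.sum_nonneg fun _ _ => sq_nonneg _
    rw [hQ]
    linarith
  have hAδ : ∀ x ∈ Matrix.toLin' Q ⁻¹' ball (0 : Fin 3 → ℝ) (ε / 3), ‖x‖ < δ' := fun x hx => by
    have h1 := (hQn x).trans (hA x hx)
    by_contra! hc
    have h2 := mul_le_mul_of_nonneg_right hc g0.le
    have h3 : ε ^ 2 ≤ (‖x‖ * g 0) ^ 2 := pow_le_pow_left₀ hε0.le (hεδ.trans h2) 2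
    have h4 : 0 < ε ^ 2 := by positivity
    linarith
  refine ⟨fun x hx => ?_, fun x hx => ?_, ?_⟩
  · rw [mem_closedBall_zero_iff]
    exact ((hAδ x hx).trans_le (min_le_right _ _)).le
  · obtain ⟨h1, h2, h3⟩ := hball x (by
      rw [mem_ball_zero_iff]; exact (hAδ x hx).trans_le (min_le_left _ _))
    refine ⟨?_, h1, h2⟩
    have h4 : ∀ k, (pd k u x - grad u 0 k - g 0 / 2 * x k) ^ 2
        ≤ 3 / 2 * (∑ j, hs u 0 k j * x j - g 0 / 2 * x k) ^ 2 + 3 * (g 0 / 4 * ‖x‖) ^ 2 :=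
        fun k => by
      have h5 := pow_le_pow_left₀ (abs_nonneg _) (h3 k) 2
      rw [sq_abs] at h5
      change (pd k u x - pd k u 0 - g 0 / 2 * x k) ^ 2 ≤ _
      set a := pd k u x - pd k u 0
      set c := ∑ j, hs u 0 k j * x j
      linarith [sq_nonneg ((c - g 0 / 2 * x k) - 2 * (a - c))]
    have h5 := Finset.sum_le_sum fun k (_ : k ∈ Finset.univ) => h4 k
    rw [Finset.sum_add_distrib, ← Finset.mul_sum] at h5
    simp only [Finset.sum_const, Finset.card_univ, Fintype.card_fin, nsmul_eq_mul] at h5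
    push_cast at h5
    have h6 := hA x hx
    have h7 := hQn x
    have h8 := hQ x
    have h9 : 0 ≤ 3 * g 0 ^ 2 / 4 * ∑ i, x i ^ 2 := by positivity
    have h10 : 0 < ε ^ 2 := by positivity
    unfold originDist graphDist
    linarith
  · rw [measureReal_preimage_ball Q hdet (by positivity), hQd]
    change _ / vol u g 0 = _
    field_simp
    ring

end

section

open MeasureTheory Filter Topology

lemma rpow_neg_div_four {W : ℝ} (hW : 0 ≤ W) (n : ℕ) :
    W ^ (-(n / 4 : ℝ)) = ((W ^ (1 / 4 : ℝ)) ^ n)⁻¹ := by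
  rw [Real.rpow_neg hW, ← Real.rpow_natCast, ← Real.rpow_mul hW]
  congr 2
  ring

lemma exists_cutoff_real {T : ℝ} (hT : 0 < T) : ∃ (B : ℝ) (χ χ' χ'' : ℝ → ℝ), 1 ≤ B ∧
    ContDiff ℝ 2 χ ∧ (∀ τ, HasDerivAt χ (χ' τ) τ) ∧ (∀ τ, HasDerivAt χ' (χ'' τ) τ) ∧
    (∀ τ, 0 ≤ χ τ ∧ χ τ ≤ 1) ∧ (∀ τ, |χ' τ| ≤ B ∧ |χ'' τ| ≤ B) ∧
    (∀ τ, 0 ≤ τ → τ ≤ T / 4 → χ τ = 1 ∧ χ' τ = 0 ∧ χ'' τ = 0) ∧ ∀ τ, T ≤ τ → χ τ = 0 := by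
  let f : ContDiffBump (0 : ℝ) := ⟨T / 2, T, by linarith, by linarith⟩
  have hs : ContDiff ℝ 2 f := f.contDiff
  have hs' : ContDiff ℝ 1 (deriv f) := by
    have := (contDiff_succ_iff_deriv (n := 1)).1 hs
    exact this.2.2
  have h1 : ∀ τ, |τ| < T / 2 → f =ᶠ[𝓝 τ] fun _ => 1 := fun τ hτ => by
    filter_upwards [isOpen_ball.mem_nhds (mem_ball_zero_iff.2 hτ)] with y hy
    exact f.one_of_mem_closedBall (ball_subset_closedBall hy)
  have h1' : ∀ τ, |τ| < T / 2 → deriv f =ᶠ[𝓝 τ] fun _ => 0 := fun τ hτ => by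
    filter_upwards [(h1 τ hτ).eventuallyEq_nhds] with y hy
    rw [hy.deriv_eq, deriv_const]
  have b1 : ∃ C, ∀ x, ‖deriv f x‖ ≤ C :=
    hs'.continuous.bounded_above_of_compact_support f.hasCompactSupport.deriv
  have b2 : ∃ C, ∀ x, ‖deriv (deriv f) x‖ ≤ C :=
    (hs'.continuous_deriv le_rfl).bounded_above_of_compact_support f.hasCompactSupport.deriv.deriv
  obtain ⟨B1, hB1⟩ := b1
  obtain ⟨B2, hB2⟩ := b2
  refine ⟨max 1 (max B1 B2), f, deriv f, deriv (deriv f), le_max_left _ _, hs,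
    fun τ => (hs.differentiable two_ne_zero τ).hasDerivAt,
    fun τ => (hs'.differentiable one_ne_zero τ).hasDerivAt, fun τ => ⟨f.nonneg, f.le_one⟩,
    fun τ => ⟨(hB1 τ).trans ((le_max_left _ _).trans (le_max_right _ _)),
      (hB2 τ).trans ((le_max_right _ _).trans (le_max_right _ _))⟩, fun τ h0 hτ => ?_, fun τ hτ => ?_⟩
  · have : |τ| < T / 2 := by rw [abs_of_nonneg h0]; linarith
    exact ⟨(h1 τ this).eq_of_nhds, (h1' τ this).eq_of_nhds, by
      rw [(h1' τ this).deriv_eq, deriv_const]⟩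
  · refine f.zero_of_le_dist ?_
    rw [dist_zero_right, Real.norm_eq_abs]
    exact hτ.trans (le_abs_self τ)

/-- The regularized radial kernel, cut off away from the origin. -/
lemma exists_kernel {T : ℝ} (hT : 0 < T) : ∃ B, 1 ≤ B ∧ ∀ ε : ℝ, 0 < ε →
    ∃ φ φ' φ'' : ℝ → ℝ, (∀ τ, 0 ≤ τ → HasDerivAt φ (φ' τ) τ ∧ HasDerivAt φ' (φ'' τ) τ ∧
      ContDiffAt ℝ 2 φ τ ∧ 0 ≤ φ τ) ∧ (∀ τ, T ≤ τ → φ τ = 0) ∧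
      (∀ τ, T / 4 ≤ τ → |φ' τ| ≤ B ∧ |φ'' τ| ≤ B) ∧
      ∀ τ, 0 ≤ τ → τ ≤ T / 4 → ∃ s, 0 < s ∧ s ^ 4 = 2 * τ + ε ^ 2 ∧
        φ' τ = -(s ^ 6)⁻¹ - 1 / 2 * (s ^ 5)⁻¹ ∧ φ'' τ = 3 * (s ^ 10)⁻¹ + 5 / 4 * (s ^ 9)⁻¹ := by
  obtain ⟨B, χ, χ', χ'', hB, hχ, hd, hd', h01, hbd, hone, hzero⟩ := exists_cutoff_real hT
  set s₀ := (T / 2) ^ (1 / 4 : ℝ) with hs₀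
  have hs₀0 : 0 < s₀ := by positivity
  set L := 1 + (s₀ ^ 2)⁻¹ + (s₀ ^ 1)⁻¹ + (s₀ ^ 6)⁻¹ + (s₀ ^ 5)⁻¹ + (s₀ ^ 10)⁻¹ + (s₀ ^ 9)⁻¹ with hL
  have hi : ∀ n : ℕ, 0 ≤ (s₀ ^ n)⁻¹ := fun n => by positivity
  have hL1 : 1 ≤ L := by linarith [hi 2, hi 1, hi 6, hi 5, hi 10, hi 9]
  refine ⟨20 * (B * L), by nlinarith, fun ε hε => ?_⟩
  let p : ℕ → ℝ → ℝ := fun n τ => (2 * τ + ε ^ 2) ^ (-(n / 4 : ℝ))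
  have hW : ∀ τ : ℝ, 0 ≤ τ → 0 < 2 * τ + ε ^ 2 := fun τ h => by positivity
  have hp : ∀ n τ, 0 ≤ τ → HasDerivAt (p n) (-(n / 2 : ℝ) * p (n + 4) τ) τ := fun n τ h => by
    have e := ((((hasDerivAt_id τ).const_mul 2).add_const (ε ^ 2)).rpow_const
      (p := -(n / 4 : ℝ)) (.inl (hW τ h).ne'))
    refine e.congr_deriv ?_
    change 2 * 1 * -(n / 4 : ℝ) * (2 * τ + ε ^ 2) ^ (-(n / 4 : ℝ) - 1)
      = -(n / 2 : ℝ) * (2 * τ + ε ^ 2) ^ (-((n + 4 : ℕ) / 4 : ℝ))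
    rw [show -(n / 4 : ℝ) - 1 = -((n + 4 : ℕ) / 4 : ℝ) by push_cast; ring]
    ring
  have hpc : ∀ n τ, 0 ≤ τ → ContDiffAt ℝ 2 (p n) τ := fun n τ h =>
    ((contDiffAt_const.mul contDiffAt_id).add contDiffAt_const).rpow_const_of_ne (hW τ h).ne'
  have hp0 : ∀ n τ, 0 ≤ τ → 0 ≤ p n τ := fun n τ h => Real.rpow_nonneg (hW τ h).le _
  have hps : ∀ n τ, 0 ≤ τ → p n τ = (((2 * τ + ε ^ 2) ^ (1 / 4 : ℝ)) ^ n)⁻¹ := fun n τ h =>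
    rpow_neg_div_four (hW τ h).le n
  have hpb : ∀ n τ, T / 4 ≤ τ → p n τ ≤ (s₀ ^ n)⁻¹ := fun n τ h => by
    rw [hs₀, ← rpow_neg_div_four (by positivity)]
    exact Real.rpow_le_rpow_of_nonpos (by positivity) (by nlinarith [sq_nonneg ε])
      (by simp only [Left.neg_nonpos_iff]; positivity)
  refine ⟨fun τ => χ τ * (p 2 τ + p 1 τ),
    fun τ => χ' τ * (p 2 τ + p 1 τ) + χ τ * (-p 6 τ - 1 / 2 * p 5 τ),
    fun τ => χ'' τ * (p 2 τ + p 1 τ) + 2 * (χ' τ * (-p 6 τ - 1 / 2 * p 5 τ))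
      + χ τ * (3 * p 10 τ + 5 / 4 * p 9 τ), fun τ h => ⟨?_, ?_, ?_, ?_⟩, fun τ h => ?_,
    fun τ h => ?_, fun τ h0 h => ?_⟩
  · refine ((hd τ).fun_mul ((hp 2 τ h).fun_add (hp 1 τ h))).congr_deriv ?_
    push_cast; ring
  · refine (((hd' τ).fun_mul ((hp 2 τ h).fun_add (hp 1 τ h))).fun_add
      ((hd τ).fun_mul (((hp 6 τ h).fun_neg).fun_sub ((hp 5 τ h).const_mul (1 / 2))))).congr_deriv ?_
    push_cast; ring
  · exact hχ.contDiffAt.mul ((hpc 2 τ h).add (hpc 1 τ h))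
  · exact mul_nonneg (h01 τ).1 (add_nonneg (hp0 2 τ h) (hp0 1 τ h))
  · simp [hzero τ h]
  · have h0 : 0 ≤ τ := by linarith
    have k0 : |p 2 τ + p 1 τ| ≤ L := by
      rw [abs_of_nonneg (add_nonneg (hp0 2 τ h0) (hp0 1 τ h0))]
      linarith [hpb 2 τ h, hpb 1 τ h, hi 6, hi 5, hi 10, hi 9]
    have k1 : |-p 6 τ - 1 / 2 * p 5 τ| ≤ L := by
      rw [show -p 6 τ - 1 / 2 * p 5 τ = -(p 6 τ + 1 / 2 * p 5 τ) by ring, abs_neg,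
        abs_of_nonneg (by linarith [hp0 6 τ h0, hp0 5 τ h0])]
      linarith [hpb 6 τ h, hpb 5 τ h, hi 2, hi 1, hi 10, hi 9, hi 5]
    have k2 : |3 * p 10 τ + 5 / 4 * p 9 τ| ≤ 3 * L := by
      rw [abs_of_nonneg (by linarith [hp0 10 τ h0, hp0 9 τ h0])]
      linarith [hpb 10 τ h, hpb 9 τ h, hi 2, hi 1, hi 6, hi 5, hi 9]
    have m : ∀ {a c A C : ℝ}, |a| ≤ A → |c| ≤ C → |a * c| ≤ A * C := fun ha hc => by
      rw [abs_mul]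
      exact mul_le_mul ha hc (abs_nonneg _) ((abs_nonneg _).trans ha)
    have hc : |χ τ| ≤ B := by rw [abs_of_nonneg (h01 τ).1]; exact (h01 τ).2.trans hB
    have hBL : 0 ≤ B * L := by positivity
    have m1 := m (hbd τ).1 k0
    have m2 := m hc k1
    have m3 := m (hbd τ).2 k0
    have m4 := m (hbd τ).1 k1
    have m5 := m hc k2
    constructor
    · refine (abs_add_le _ _).trans ?_
      linarith
    · refine (abs_add_three _ _ _).trans ?_
      rw [abs_mul 2, abs_two]
      linarith
  · obtain ⟨e1, e2, e3⟩ := hone τ h0 h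
    have hw := hW τ h0
    refine ⟨(2 * τ + ε ^ 2) ^ (1 / 4 : ℝ), by positivity, ?_, ?_, ?_⟩
    · rw [← Real.rpow_natCast, ← Real.rpow_mul hw.le]
      norm_num
    · simp only [e1, e2, hps _ τ h0]; ring
    · simp only [e1, e2, e3, hps _ τ h0]; ring

end

section

open MeasureTheory

lemma kernel_bound {c s e D Q V : ℝ} (hc : 0 ≤ c) (hs : 0 < s) (hcs : 32 * c * s ≤ 1)
    (hs1 : s ≤ 1) (hV : 0 ≤ V) (hD : 3 * V - c * s ^ 2 * V ≤ D)
    (hQ : Q ≤ (s ^ 4 - e) * V * (1 + c * s ^ 2)) (he : 0 ≤ e) :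
    (-(s ^ 6)⁻¹ - 1 / 2 * (s ^ 5)⁻¹) * D + (3 * (s ^ 10)⁻¹ + 5 / 4 * (s ^ 9)⁻¹) * Q
      ≤ -(3 * e * (s ^ 10)⁻¹ * V) := by
  have h1 := mul_le_mul_of_nonneg_left hD (by positivity : 0 ≤ (s ^ 6)⁻¹ + 1 / 2 * (s ^ 5)⁻¹)
  have h2 := mul_le_mul_of_nonneg_left hQ
    (by positivity : 0 ≤ 3 * (s ^ 10)⁻¹ + 5 / 4 * (s ^ 9)⁻¹)
  have h3 : (3 * (s ^ 10)⁻¹ + 5 / 4 * (s ^ 9)⁻¹) * ((s ^ 4 - e) * V * (1 + c * s ^ 2))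
      - ((s ^ 6)⁻¹ + 1 / 2 * (s ^ 5)⁻¹) * (3 * V - c * s ^ 2 * V) + 3 * e * (s ^ 10)⁻¹ * V
      = (s ^ 10)⁻¹ * V * (s ^ 5 * (4 * c * s - 1 / 4 + 7 / 4 * c * s ^ 2)
        - e * (3 * c * s ^ 2 + 5 / 4 * s * (1 + c * s ^ 2))) := by
    field_simp
    ring
  have h4 : s ^ 5 * (4 * c * s - 1 / 4 + 7 / 4 * c * s ^ 2) ≤ 0 :=
    mul_nonpos_of_nonneg_of_nonpos (by positivity) (by
      have : c * s ^ 2 ≤ c * s := by rw [sq]; exact mul_le_mul_of_nonneg_left (by nlinarith) hc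
      linarith)
  have h5 : 0 ≤ e * (3 * c * s ^ 2 + 5 / 4 * s * (1 + c * s ^ 2)) := by positivity
  have h6 : 0 ≤ (s ^ 10)⁻¹ * V := by positivity
  have h7 := mul_nonneg h6 (by linarith : 0 ≤ -(s ^ 5 * (4 * c * s - 1 / 4 + 7 / 4 * c * s ^ 2)
        - e * (3 * c * s ^ 2 + 5 / 4 * s * (1 + c * s ^ 2))))
  linarith

lemma inv_pow_ten_lower {s ε τ : ℝ} (hs : 0 < s) (hε : 0 < ε) (h4 : s ^ 4 = 2 * τ + ε ^ 2)
    (hτ : 2 * τ < ε ^ 2) : 1 / (6 * ε ^ 3) ≤ ε ^ 2 * (s ^ 10)⁻¹ := by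
  have h1 : s ^ 2 ≤ 3 / 2 * ε := by
    refine le_of_sq_le_sq ?_ (by positivity)
    nlinarith
  have h2 : (s ^ 4) ^ 2 ≤ (2 * ε ^ 2) ^ 2 := pow_le_pow_left₀ (by positivity) (by linarith) 2
  have h3 : s ^ 10 ≤ 6 * ε ^ 5 :=
    calc s ^ 10 = (s ^ 4) ^ 2 * s ^ 2 := by ring
      _ ≤ (2 * ε ^ 2) ^ 2 * (3 / 2 * ε) := mul_le_mul h2 h1 (by positivity) (by positivity)
      _ = _ := by ring
  rw [← div_eq_mul_inv, div_le_div_iff₀ (by positivity) (by positivity)]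
  nlinarith [pow_pos hε 2]

lemma divF_add_const_mul {F : (Fin 3 → ℝ) → Fin 3 → Fin 3 → ℝ} {v w : (Fin 3 → ℝ) → ℝ}
    (hF : ∀ i j, ContDiff ℝ 1 (fun x => F x i j)) (hv : ContDiff ℝ 2 v) (hw : ContDiff ℝ 2 w)
    (c : ℝ) (x : Fin 3 → ℝ) :
    divF F (fun x => v x + c * w x) x = divF F v x + c * divF F w x := by
  have d1 : ∀ j y, pd j (fun x => v x + c * w x) y = pd j v y + c * pd j w y := fun j y => by
    have hw' : DifferentiableAt ℝ w y := hw.differentiable (by norm_num) y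
    rw [pd_add j (hv.differentiable (by norm_num) y) (hw'.const_mul c), pd_const_mul j hw']
  have d2 : ∀ i y, ∑ j, F y i j * pd j (fun x => v x + c * w x) y
      = (∑ j, F y i j * pd j v y) + c * ∑ j, F y i j * pd j w y := fun i y => by
    rw [Finset.mul_sum, ← Finset.sum_add_distrib]
    exact Finset.sum_congr rfl fun j _ => by rw [d1]; ring
  unfold divF
  rw [Finset.mul_sum, ← Finset.sum_add_distrib]
  refine Finset.sum_congr rfl fun i _ => ?_
  have hw' := (contDiff_flux hF hw i).differentiable (by norm_num) x
  simp only [d2]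
  rw [pd_add i ((contDiff_flux hF hv i).differentiable (by norm_num) x) (hw'.const_mul c),
    pd_const_mul i hw']

/-- A mean value inequality for the subsolution `b` at the origin. -/
lemma exists_mean_value (P : ℝ) : ∃ C, 0 ≤ C ∧ ∀ u g b, Sol P u g b →
    b 0 ≤ C * ∫ x in closedBall (0 : Fin 3 → ℝ) (3 / 10), b x * vol u g x := by
  by_cases hP : 1 ≤ P
  swap
  · exact ⟨0, le_rfl, fun u g b h => (hP h.one_le).elim⟩
  set c := 2000 * P ^ 10 with hc
  have hc1 : 2000 ≤ c := by nlinarith [one_le_pow₀ (n := 10) hP]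
  have hcP : 2000 * P ≤ c := by
    have := le_self_pow₀ hP (show (10 : ℕ) ≠ 0 by norm_num)
    linarith
  set σ := 1 / (32 * c) with hσ
  have hσ0 : 0 < σ := by positivity
  have hcσ : 32 * c * σ = 1 := by rw [hσ]; field_simp
  have hσ1 : σ ≤ 1 / 64000 := by nlinarith
  have hPσ : P * σ ≤ 1 / 64000 := by nlinarith
  have hσ2 : σ ^ 2 ≤ σ := by nlinarith
  set T := σ ^ 4 with hT
  have hT0 : 0 < T := by positivity
  have hT1 : T ≤ 1 := pow_le_one₀ hσ0.le (by linarith)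
  obtain ⟨B, hB, hker⟩ := exists_kernel hT0
  set Λ := 120038 * P ^ 6 with hΛ
  have hΛ0 : 0 ≤ Λ := by positivity
  refine ⟨27 * (8 * B * (1 + Λ)), by positivity, fun u g b h => ?_⟩
  set t := originDist u g with ht
  have b0 := h.one_le_b 0 Sol.zero_mem
  have V0 := h.vol_pos Sol.zero_mem
  have ht0 : ∀ x, 0 ≤ t x := originDist_nonneg u g
  obtain ⟨ε, hε, hεσ, A, hAm, hAs, hA, hAv⟩ := h.exists_density_set (show 0 < σ ^ 2 / 2 by positivity)
  have hε2 : ε ^ 2 ≤ T / 4 := by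
    calc ε ^ 2 ≤ (σ ^ 2 / 2) ^ 2 := pow_le_pow_left₀ hε.le hεσ 2
      _ = _ := by rw [hT]; ring
  obtain ⟨φ, φ', φ'', hφ, hφT, hφb, hφs⟩ := hker ε hε
  have hts : ContDiff ℝ 2 t := (contDiff_graphDist h.u_smooth).of_le (by norm_num)
  have hw : ContDiff ℝ 2 fun x => φ (t x) := contDiff_iff_contDiffAt.2 fun x =>
    ((hφ _ (ht0 x)).2.2.1).comp x hts.contDiffAt
  have hb' : ContDiff ℝ 2 fun x => b x + Λ * t x := h.b_smooth.add (contDiff_const.mul hts)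
  have hTball : ∀ x, t x ≤ T → x ∈ closedBall (0 : Fin 3 → ℝ) (3 / 10) := fun x hx => by
    rw [mem_closedBall_zero_iff]
    have := h.norm_le_of_originDist x (ρ := 2 * σ ^ 2) (by positivity)
      (by change 2 * t x ≤ _; nlinarith)
    nlinarith
  have hw0 : ∀ x ∉ closedBall (0 : Fin 3 → ℝ) (3 / 10), φ (t x) = 0 := fun x hx =>
    hφT _ (not_le.1 fun hle => hx (hTball x hle)).le
  have hDw : ∀ x, divF (coeff u g) (fun x => φ (t x)) x = φ' (t x) * divF (coeff u g) t x
      + φ'' (t x) * quadForm (coeff u g x) (grad t x) (grad t x) := fun x =>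
    divF_comp h.coeff_smooth hts (fun x => (hφ _ (ht0 x)).1) (fun x => (hφ _ (ht0 x)).2.1) hw x
  have hDb : ∀ x, divF (coeff u g) (fun x => b x + Λ * t x) x
      = divF (coeff u g) b x + Λ * divF (coeff u g) t x :=
    divF_add_const_mul h.coeff_smooth h.b_smooth hts Λ
  have hcρ : c * (2 * σ ^ 2) ≤ 1 := by nlinarith
  have hball : ∀ x ∈ closedBall (0 : Fin 3 → ℝ) (3 / 10), x ∈ ball (0 : Fin 3 → ℝ) (3 / 4) :=
    fun x hx => closedBall_subset_three_quarters (by norm_num) hx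
  have hDt : ∀ x, t x ≤ T → |divF (coeff u g) t x - 3 * vol u g x| ≤ vol u g x := fun x hx => by
    have hV := (h.vol_pos (hball x (hTball x hx))).le
    refine (h.abs_divF_originDist_sub_le (hball x (hTball x hx)) (ρ := 2 * σ ^ 2) (by positivity)
      (by change 2 * t x ≤ _; nlinarith)).trans (mul_le_of_le_one_left hV hcρ)
  have hQt : ∀ x, t x ≤ T → quadForm (coeff u g x) (grad t x) (grad t x) ≤ 4 * vol u g x :=
      fun x hx => by
    have hV := (h.vol_pos (hball x (hTball x hx))).le
    refine (h.quadForm_originDist_le (hball x (hTball x hx)) (ρ := 2 * σ ^ 2) (by positivity)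
      (by linarith) (by change 2 * t x ≤ _; nlinarith)).trans ?_
    change 2 * t x * vol u g x * (1 + c * (2 * σ ^ 2)) ≤ _
    calc 2 * t x * vol u g x * (1 + c * (2 * σ ^ 2)) ≤ 2 * 1 * vol u g x * (1 + 1) := by
          gcongr
          exact hx.trans hT1
      _ = _ := by ring
  have hDb0 : ∀ x, t x ≤ T → 0 ≤ divF (coeff u g) (fun x => b x + Λ * t x) x := fun x hx => by
    have hx' := hball x (hTball x hx)
    have hV := (h.vol_pos hx').le
    have j := h.jacobi hx'
    have q := h.quadForm_nonneg hx' (grad b x)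
    have s := mul_le_mul_of_nonneg_left (h.lap_le_vol hx') (by positivity : 0 ≤ 60019 * P ^ 4)
    have d := mul_le_mul_of_nonneg_left (abs_le.1 (hDt x hx)).1 hΛ0
    rw [hDb]
    have e : 60019 * P ^ 4 * (4 * P ^ 2 * vol u g x) = Λ * (2 * vol u g x) := by rw [hΛ]; ring
    linarith
  have hsmall : ∀ x, t x ≤ T / 4 → divF (coeff u g) (fun x => φ (t x)) x ≤ 0 ∧
      (2 * t x < ε ^ 2 → divF (coeff u g) (fun x => φ (t x)) x
        ≤ -(1 / (2 * ε ^ 3) * vol u g x)) := fun x hx => by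
    have hx' := hball x (hTball x (by linarith))
    have hV := (h.vol_pos hx').le
    obtain ⟨s, hs, hs4, e1, e2⟩ := hφs _ (ht0 x) hx
    have hsσ : s ≤ σ := by
      refine le_of_not_gt fun hc => ?_
      have := pow_lt_pow_left₀ hc hσ0.le (show (4 : ℕ) ≠ 0 by norm_num)
      linarith
    have h2t : 2 * t x ≤ (s ^ 2) ^ 2 := by
      rw [← pow_mul]; norm_num; rw [hs4]; linarith [sq_nonneg ε]
    have hs1 : s ≤ 1 := by linarith
    have k := kernel_bound (c := c) (s := s) (e := ε ^ 2) (V := vol u g x)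
      (D := divF (coeff u g) t x) (Q := quadForm (coeff u g x) (grad t x) (grad t x))
      (by linarith) hs (by nlinarith) hs1 hV
      (by
        have := (abs_le.1 (h.abs_divF_originDist_sub_le hx' (by positivity) h2t)).1
        change _ ≤ divF (coeff u g) t x - _ at this
        linarith)
      (by
        have := h.quadForm_originDist_le hx' (sq_nonneg s) (pow_le_one₀ hs.le hs1) h2t
        rw [show s ^ 4 - ε ^ 2 = 2 * t x by linarith]
        exact this) (sq_nonneg ε)
    rw [hDw, e1, e2]
    refine ⟨k.trans (neg_nonpos.2 (by positivity)), fun hlt => k.trans (neg_le_neg ?_)⟩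
    have i := mul_le_mul_of_nonneg_right (inv_pow_ten_lower hs hε hs4 hlt) hV
    have e3 : 1 / (2 * ε ^ 3) * vol u g x = 3 * (1 / (6 * ε ^ 3) * vol u g x) := by
      field_simp; ring
    rw [e3]
    linarith
  have hlarge : ∀ x, T / 4 ≤ t x → t x ≤ T →
      divF (coeff u g) (fun x => φ (t x)) x ≤ 8 * B * vol u g x := fun x h1 h2 => by
    have hx' := hball x (hTball x h2)
    have hV := (h.vol_pos hx').le
    have d : |divF (coeff u g) t x| ≤ 4 * vol u g x := by
      have := abs_le.1 (hDt x h2)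
      rw [abs_le]; constructor <;> linarith
    rw [hDw]
    have m1 : φ' (t x) * divF (coeff u g) t x ≤ B * (4 * vol u g x) :=
      (le_abs_self _).trans (by
        rw [abs_mul]
        exact mul_le_mul (hφb _ h1).1 d (abs_nonneg _) (by linarith))
    have m2 : φ'' (t x) * quadForm (coeff u g x) (grad t x) (grad t x) ≤ B * (4 * vol u g x) :=
      mul_le_mul ((le_abs_self _).trans (hφb _ h1).2) (hQt x h2) (h.quadForm_nonneg hx' _)
        (by linarith)
    linarith
  have hfar : ∀ x, T < t x → φ (t x) = 0 ∧ divF (coeff u g) (fun x => φ (t x)) x = 0 :=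
      fun x hx => by
    have hopen : IsOpen {y | T < t y} := isOpen_lt continuous_const hts.continuous
    have hz : ∀ y ∈ {y | T < t y}, φ (t y) = 0 := fun y hy => hφT _ (le_of_lt hy)
    have hz1 : ∀ i, ∀ y ∈ {y | T < t y}, pd i (fun x => φ (t x)) y = 0 := fun i y hy => by
      rw [pd_congr i (g := fun _ => 0) hopen hz hy, pd_const]
    refine ⟨hz x hx, Finset.sum_eq_zero fun i _ => ?_⟩
    rw [pd_congr i (g := fun _ => 0) hopen (fun y hy => Finset.sum_eq_zero fun j _ => by
      rw [hz1 j y hy, mul_zero]) hx, pd_const]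
  set m := b 0 * vol u g 0 / (8 * ε ^ 3) with hm
  have hm0 : 0 ≤ m := by positivity
  have hcomm := integral_divF_comm h.coeff_smooth (coeff_symm h.u_smooth) hb' hw hw0
  have hbV : Continuous fun x => b x * vol u g x :=
    h.b_smooth.continuous.mul (continuous_vol h.u_smooth h.g_smooth)
  have hpt : ∀ x ∈ closedBall (0 : Fin 3 → ℝ) (3 / 10),
      A.indicator (fun _ => m) x + (0 * (φ (t x)) - 0) ≤ 8 * B * (1 + Λ) * (b x * vol u g x)
        + (φ (t x) * divF (coeff u g) (fun x => b x + Λ * t x) x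
          - (b x + Λ * t x) * divF (coeff u g) (fun x => φ (t x)) x) := fun x hx => by
    have hx' := hball x hx
    have hV := (h.vol_pos hx').le
    have hb := h.one_le_b x hx'
    have hbΛ : 0 ≤ b x + Λ * t x := by have := ht0 x; positivity
    have hBV : 0 ≤ 8 * B * (1 + Λ) * (b x * vol u g x) := by positivity
    by_cases hxA : x ∈ A
    · obtain ⟨a1, a2, a3⟩ := hA x hxA
      have hxT : t x ≤ T / 4 := by linarith
      have d1 := (hsmall x hxT).2 a1
      have d2 := mul_nonneg (hφ _ (ht0 x)).2.2.2 (hDb0 x (by linarith))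
      have d3 := mul_le_mul_of_nonneg_left d1 hbΛ
      have d4 : m ≤ (b x + Λ * t x) * (1 / (2 * ε ^ 3) * vol u g x) := by
        calc m = b 0 / 2 * (1 / (2 * ε ^ 3) * (vol u g 0 / 2)) := by
              rw [hm]; field_simp; norm_num
          _ ≤ _ := by
              gcongr
              linarith [mul_nonneg hΛ0 (ht0 x)]
      rw [indicator_of_mem hxA]
      linarith
    · rw [indicator_of_notMem hxA]
      rcases le_or_gt (t x) T with hxT | hxT
      · have d2 := mul_nonneg (hφ _ (ht0 x)).2.2.2 (hDb0 x hxT)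
        rcases le_or_gt (t x) (T / 4) with hx4 | hx4
        · have := mul_nonneg hbΛ (neg_nonneg.2 (hsmall x hx4).1)
          linarith
        · have d3 := mul_le_mul_of_nonneg_left (hlarge x hx4.le hxT) hbΛ
          have d4 : b x + Λ * t x ≤ (1 + Λ) * b x := by
            have := mul_le_mul_of_nonneg_left (hxT.trans (hT1.trans hb)) hΛ0
            linarith
          have d5 := mul_le_mul_of_nonneg_right d4 (by positivity : 0 ≤ 8 * B * vol u g x)
          linarith
      · obtain ⟨z1, z2⟩ := hfar x hxT
        rw [z1, z2]
        linarith
  have hAi : IntegrableOn (A.indicator fun _ => m) (closedBall (0 : Fin 3 → ℝ) (3 / 10)) :=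
    (continuous_const.integrableOn_ball' _).indicator hAm
  have hNc : Continuous fun x => φ (t x) * divF (coeff u g) (fun x => b x + Λ * t x) x
      - (b x + Λ * t x) * divF (coeff u g) (fun x => φ (t x)) x :=
    (hw.continuous.mul (continuous_divF h.coeff_smooth hb')).sub
      (hb'.continuous.mul (continuous_divF h.coeff_smooth hw))
  have hint := setIntegral_mono_on hAi
    (((continuous_const.fun_mul hbV).fun_add hNc).integrableOn_ball' (3 / 10))
    measurableSet_closedBall fun x hx => by simpa using hpt x hx
  rw [integral_add ((continuous_const.fun_mul hbV).integrableOn_ball' _)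
    (hNc.integrableOn_ball' _), hcomm, add_zero, integral_const_mul,
    setIntegral_indicator hAm, inter_eq_self_of_subset_right hAs, setIntegral_const, hAv,
    smul_eq_mul] at hint
  have e : 8 * ε ^ 3 / (27 * vol u g 0) * m = b 0 / 27 := by
    rw [hm]; field_simp
  rw [e] at hint
  linarith

end

/-- A smooth function on a ball agrees on any smaller ball with a smooth function on the whole
space. -/
lemma exists_contDiff_extension {n : ℕ} {r R : ℝ} (hr : 0 < r) (hR : r < R)
    {f : (Fin 3 → ℝ) → ℝ} (hf : ContDiffOn ℝ n f (ball 0 R)) :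
    ∃ F : (Fin 3 → ℝ) → ℝ, ContDiff ℝ n F ∧ ∀ x ∈ ball (0 : Fin 3 → ℝ) r, F x = f x := by
  let η : ContDiffBump (0 : Fin 3 → ℝ) := ⟨r, (r + R) / 2, hr, by linarith⟩
  refine ⟨fun x => η x * f x, contDiff_iff_contDiffAt.2 fun x => ?_, fun x hx => ?_⟩
  · by_cases hx : x ∈ ball (0 : Fin 3 → ℝ) R
    · exact η.contDiffAt.mul (hf.contDiffAt (isOpen_ball.mem_nhds hx))
    · have hx' : x ∈ (closedBall (0 : Fin 3 → ℝ) ((r + R) / 2))ᶜ := fun h =>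
        hx (closedBall_subset_ball (by linarith) h)
      refine contDiffAt_const (c := (0 : ℝ)) |>.congr_of_eventuallyEq ?_
      filter_upwards [(isOpen_compl_closedBall' _).mem_nhds hx'] with y hy
      rw [η.zero_of_le_dist (le_of_lt (not_le.1 hy)), zero_mul]
  · change η x * f x = f x
    rw [η.one_of_mem_closedBall (ball_subset_closedBall hx), one_mul]

lemma hessian_eq_hs {u U : (Fin 3 → ℝ) → ℝ} {r : ℝ} (hU : ContDiff ℝ 4 U)
    (h : ∀ y ∈ ball (0 : Fin 3 → ℝ) r, U y = u y) {x : Fin 3 → ℝ}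
    (hx : x ∈ ball (0 : Fin 3 → ℝ) r) : hessian 3 u x = hs U x := by
  have he : u =ᶠ[nhds x] U := by
    filter_upwards [isOpen_ball.mem_nhds hx] with y hy using (h y hy).symm
  have hd : DifferentiableAt ℝ (fderiv ℝ U) x :=
    (hU.fderiv_right (m := 1) (by norm_num)).differentiable one_ne_zero x
  have hc : ∀ v w, fderiv ℝ (fun y => fderiv ℝ U y v) x w = fderiv ℝ (fderiv ℝ U) x w v :=
    fun v w => by
      rw [fderiv_clm_apply hd (differentiableAt_const _)]
      simp
  ext i j
  rw [hessian, (he.iteratedFDeriv ℝ 2).eq_of_nhds, iteratedFDeriv_two_apply]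
  exact (hc _ _).symm

lemma norm_single_one (i : Fin 3) : ‖(Pi.single i 1 : Fin 3 → ℝ)‖ = 1 :=
  (Pi.norm_single (G := fun _ : Fin 3 => ℝ) (1 : ℝ)).trans norm_one

lemma abs_pd_le_norm (i : Fin 3) (f : (Fin 3 → ℝ) → ℝ) (x : Fin 3 → ℝ) :
    |pd i f x| ≤ ‖fderiv ℝ f x‖ := by
  have := (fderiv ℝ f x).le_opNorm (Pi.single i 1)
  rwa [norm_single_one, mul_one] at this

lemma norm_fderiv_le_of_pd {f : (Fin 3 → ℝ) → ℝ} {x : Fin 3 → ℝ} {S : ℝ}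
    (h : ∀ i, |pd i f x| ≤ S) : ‖fderiv ℝ f x‖ ≤ 3 * S := by
  have hS : 0 ≤ S := (abs_nonneg _).trans (h 0)
  refine ContinuousLinearMap.opNorm_le_bound _ (by positivity) fun v => ?_
  rw [fderiv_eq_sum_pd, Real.norm_eq_abs, mul_assoc]
  refine Sol.abs_sum_three_le fun i => ?_
  rw [abs_mul, mul_comm]
  exact mul_le_mul (h i) (norm_le_pi_norm v i) (abs_nonneg _) hS

section Composite

variable {M K R S : ℝ} {u G : (Fin 3 → ℝ) → ℝ} {Ψ : (Fin 3 → ℝ) × ℝ → ℝ} {x : Fin 3 → ℝ}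

lemma pd_graph_comp (hu : ContDiff ℝ 4 u)
    (hΨ : ∀ p ∈ ball (0 : Fin 3 → ℝ) R ×ˢ (univ : Set ℝ), DifferentiableAt ℝ Ψ p)
    (hG : ∀ x ∈ ball (0 : Fin 3 → ℝ) R, G x = Ψ (x, u x))
    (hx : x ∈ ball (0 : Fin 3 → ℝ) R) (i : Fin 3) :
    pd i G x = fderiv ℝ Ψ (x, u x) (Pi.single i 1, pd i u x) := by
  rw [pd_congr i isOpen_ball hG hx]
  have hd : HasFDerivAt (fun y => (y, u y)) _ x :=
    (hasFDerivAt_id x).prodMk (hu.differentiable (by norm_num) x).hasFDerivAt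
  have := ((hΨ (x, u x) ⟨hx, mem_univ _⟩).hasFDerivAt.comp x hd).fderiv
  rw [pd, show (fun y => Ψ (y, u y)) = Ψ ∘ fun y => (y, u y) from rfl, this]
  rfl

lemma norm_single_prod_le (hM : 0 ≤ M) {a : ℝ} (ha : |a| ≤ M) (i : Fin 3) :
    ‖((Pi.single i 1 : Fin 3 → ℝ), a)‖ ≤ 1 + M := by
  rw [Prod.norm_def, norm_single_one]
  exact max_le (by linarith) (by rw [Real.norm_eq_abs]; linarith)

lemma abs_pd_graph_comp_le (hu : ContDiff ℝ 4 u) (hM : 0 ≤ M) (hK : 0 ≤ K)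
    (hΨ : ∀ p ∈ ball (0 : Fin 3 → ℝ) R ×ˢ (univ : Set ℝ), DifferentiableAt ℝ Ψ p)
    (hΨ' : ∀ p ∈ ball (0 : Fin 3 → ℝ) R ×ˢ (univ : Set ℝ), ‖fderiv ℝ Ψ p‖ ≤ K)
    (hG : ∀ x ∈ ball (0 : Fin 3 → ℝ) R, G x = Ψ (x, u x))
    (huM : ∀ x ∈ ball (0 : Fin 3 → ℝ) R, ‖fderiv ℝ u x‖ ≤ M)
    (hx : x ∈ ball (0 : Fin 3 → ℝ) R) (i : Fin 3) : |pd i G x| ≤ K * (1 + M) := by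
  rw [pd_graph_comp hu hΨ hG hx i, ← Real.norm_eq_abs]
  exact (ContinuousLinearMap.le_opNorm _ _).trans (mul_le_mul (hΨ' _ ⟨hx, mem_univ _⟩)
    (norm_single_prod_le hM ((abs_pd_le_norm i u x).trans (huM x hx)) i) (norm_nonneg _) hK)

lemma norm_graph_sub_le (hu : ContDiff ℝ 4 u) (hM : 0 ≤ M)
    (huM : ∀ x ∈ ball (0 : Fin 3 → ℝ) R, ‖fderiv ℝ u x‖ ≤ M)
    (hx : x ∈ ball (0 : Fin 3 → ℝ) R) {y : Fin 3 → ℝ} (hy : y ∈ ball (0 : Fin 3 → ℝ) R) :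
    ‖(y, u y) - (x, u x)‖ ≤ (1 + M) * ‖y - x‖ := by
  have h := (convex_ball (0 : Fin 3 → ℝ) R).norm_image_sub_le_of_norm_fderiv_le
    (fun z _ => hu.differentiable (by norm_num) z) huM hx hy
  rw [Prod.mk_sub_mk, Prod.norm_def]
  have := norm_nonneg (y - x)
  exact max_le (by nlinarith) (by nlinarith)

lemma abs_lap_graph_comp_le (hu : ContDiff ℝ 4 u) (hGs : ContDiff ℝ 2 G) (hM : 0 ≤ M)
    (hK : 0 ≤ K)
    (hΨ : ∀ p ∈ ball (0 : Fin 3 → ℝ) R ×ˢ (univ : Set ℝ), DifferentiableAt ℝ Ψ p)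
    (hΨ' : ∀ p ∈ ball (0 : Fin 3 → ℝ) R ×ˢ (univ : Set ℝ), ‖fderiv ℝ Ψ p‖ ≤ K)
    (hL : ∀ p ∈ ball (0 : Fin 3 → ℝ) R ×ˢ (univ : Set ℝ),
      ∀ q ∈ ball (0 : Fin 3 → ℝ) R ×ˢ (univ : Set ℝ),
      ‖fderiv ℝ Ψ p - fderiv ℝ Ψ q‖ ≤ K * ‖p - q‖)
    (hG : ∀ x ∈ ball (0 : Fin 3 → ℝ) R, G x = Ψ (x, u x))
    (huM : ∀ x ∈ ball (0 : Fin 3 → ℝ) R, ‖fderiv ℝ u x‖ ≤ M)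
    (hx : x ∈ ball (0 : Fin 3 → ℝ) R) (hS : ∀ i j, |hs u x i j| ≤ S) :
    |lap G x| ≤ 3 * (K * (1 + M) ^ 2 + K * (3 * S + 1)) := by
  have hS0 : 0 ≤ S := (abs_nonneg _).trans (hS 0 0)
  refine Sol.abs_sum_three_le fun i => (abs_pd_le_norm i _ x).trans ?_
  have hdG : DifferentiableAt ℝ (pd i G) x :=
    (hGs.pd i (m := 1) le_rfl).differentiable one_ne_zero x
  have hdu : DifferentiableAt ℝ (pd i u) x :=
    (hu.pd i (m := 3) (by norm_num)).differentiable (by norm_num) x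
  refine hdG.hasFDerivAt.le_of_lip' (by positivity) ?_
  filter_upwards [isOpen_ball.mem_nhds hx, hdu.hasFDerivAt.isLittleO.def one_pos] with y hy hyo
  have hux : ‖fderiv ℝ (pd i u) x‖ ≤ 3 * S := norm_fderiv_le_of_pd fun j => hS j i
  have hd : ‖pd i u y - pd i u x‖ ≤ (3 * S + 1) * ‖y - x‖ := by
    have h1 := (fderiv ℝ (pd i u) x).le_opNorm (y - x)
    have h2 := mul_le_mul_of_nonneg_right hux (norm_nonneg (y - x))
    have h3 := norm_add_le (pd i u y - pd i u x - fderiv ℝ (pd i u) x (y - x))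
      (fderiv ℝ (pd i u) x (y - x))
    rw [sub_add_cancel] at h3
    linarith
  set p := (y, u y)
  set q := (x, u x)
  have hp : p ∈ ball (0 : Fin 3 → ℝ) R ×ˢ (univ : Set ℝ) := ⟨hy, mem_univ _⟩
  have hq : q ∈ ball (0 : Fin 3 → ℝ) R ×ˢ (univ : Set ℝ) := ⟨hx, mem_univ _⟩
  have e : pd i G y - pd i G x
      = (fderiv ℝ Ψ p - fderiv ℝ Ψ q) (Pi.single i 1, pd i u y)
        + fderiv ℝ Ψ q (0, pd i u y - pd i u x) := by
    rw [pd_graph_comp hu hΨ hG hy i, pd_graph_comp hu hΨ hG hx i, _root_.sub_apply,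
      show ((0 : Fin 3 → ℝ), pd i u y - pd i u x)
        = (Pi.single i 1, pd i u y) - (Pi.single i 1, pd i u x) by simp, map_sub]
    ring
  have h1 : ‖(fderiv ℝ Ψ p - fderiv ℝ Ψ q) (Pi.single i 1, pd i u y)‖
      ≤ K * ((1 + M) * ‖y - x‖) * (1 + M) :=
    (ContinuousLinearMap.le_opNorm _ _).trans (mul_le_mul ((hL p hp q hq).trans
      (mul_le_mul_of_nonneg_left (norm_graph_sub_le hu hM huM hx hy) hK))
      (norm_single_prod_le hM ((abs_pd_le_norm i u y).trans (huM y hy)) i) (norm_nonneg _)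
      (by positivity))
  have h2 : ‖fderiv ℝ Ψ q (0, pd i u y - pd i u x)‖ ≤ K * ((3 * S + 1) * ‖y - x‖) :=
    (ContinuousLinearMap.le_opNorm _ _).trans (mul_le_mul (hΨ' q hq) (by
      rw [Prod.norm_def, norm_zero]
      exact max_le (by positivity) hd) (norm_nonneg _) hK)
  rw [e]
  refine (norm_add_le _ _).trans ((add_le_add h1 h2).trans (le_of_eq ?_))
  ring

end Composite

/-- The a priori bound for `b` at the origin. -/
lemma exists_b_zero_le (P : ℝ) : ∃ C, ∀ u g b, Sol P u g b → b 0 ≤ C := by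
  obtain ⟨C₁, hC₁, h₁⟩ := exists_mean_value P
  obtain ⟨C₂, h₂⟩ := exists_integral_vol_mul_le P
  exact ⟨C₁ * C₂, fun u g b h => (h₁ u g b h).trans (mul_le_mul_of_nonneg_left (h₂ u g b h) hC₁)⟩

lemma pd_log_const_mul {f : (Fin 3 → ℝ) → ℝ} {x : Fin 3 → ℝ} {K : ℝ} (hK : K ≠ 0)
    (hf : DifferentiableAt ℝ f x) (hx : f x ≠ 0) (i : Fin 3) :
    f x * pd i (fun y => Real.log (K * f y)) x = pd i f x := by
  rw [pd_comp (φ := Real.log) (f := fun y => K * f y) i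
    (Real.hasDerivAt_log (mul_ne_zero hK hx)) (hf.const_mul K), pd_const_mul i hf]
  field_simp

/-- Normalization of the data: a solution on the unit ball is smooth on the whole space after
modification outside a smaller ball. -/
lemma exists_sol (M K : ℝ) (hM : 0 < M) : ∃ P, ∀ (u : (Fin 3 → ℝ) → ℝ)
    (ψ : (Fin 3 → ℝ) → ℝ → ℝ), ContDiffOn ℝ 4 u (ball 0 1) →
    ContDiffOn ℝ 1 (Function.uncurry ψ) (ball (0 : Fin 3 → ℝ) 1 ×ˢ (univ : Set ℝ)) →
    (∀ x ∈ ball (0 : Fin 3 → ℝ) 1, ∀ s : ℝ, 0 < ψ x s) →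
    (∀ p ∈ ball (0 : Fin 3 → ℝ) 1 ×ˢ (univ : Set ℝ), |Function.uncurry ψ p| ≤ K ∧
      ‖fderiv ℝ (Function.uncurry ψ) p‖ ≤ K) →
    (∀ p ∈ ball (0 : Fin 3 → ℝ) 1 ×ˢ (univ : Set ℝ),
      ∀ q ∈ ball (0 : Fin 3 → ℝ) 1 ×ˢ (univ : Set ℝ),
      ‖fderiv ℝ (Function.uncurry ψ) p - fderiv ℝ (Function.uncurry ψ) q‖ ≤ K * ‖p - q‖) →
    (∀ x ∈ ball (0 : Fin 3 → ℝ) 1, ∀ s : ℝ, 1 / ψ x s ≤ K) →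
    (∀ x ∈ ball (0 : Fin 3 → ℝ) 1, ‖fderiv ℝ u x‖ ≤ M) →
    (∀ x ∈ ball (0 : Fin 3 → ℝ) 1,
      0 < lapl 3 u x ∧ sigma2 3 u x / lapl 3 u x = ψ x (u x)) →
    ∃ U g b, Sol P U g b ∧ hessian 3 u 0 = hs U 0 ∧ b 0 = Real.log (K * lap U 0) := by
  refine ⟨1 + M + K + K * (1 + M) + 3 * (K * ((1 + M) ^ 2 + 1) * K + 3 * K),
    fun u ψ hu hψ hψ0 hψK hψL hψinv huM heq => ?_⟩
  have hsub : ∀ {x : Fin 3 → ℝ} {r : ℝ}, r ≤ 1 → x ∈ ball (0 : Fin 3 → ℝ) r →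
      x ∈ ball (0 : Fin 3 → ℝ) 1 := fun hr hx => ball_subset_ball hr hx
  have h45 : ∀ x ∈ ball (0 : Fin 3 → ℝ) (3 / 4), x ∈ ball (0 : Fin 3 → ℝ) (4 / 5) :=
    fun x hx => ball_subset_ball (by norm_num) hx
  have hpK : ∀ x ∈ ball (0 : Fin 3 → ℝ) 1, ∀ s, 1 ≤ K * ψ x s := fun x hx s => by
    have := hψinv x hx s
    rwa [div_le_iff₀ (hψ0 x hx s)] at this
  have hK : 1 ≤ K := by
    have h0 : (0 : Fin 3 → ℝ) ∈ ball (0 : Fin 3 → ℝ) 1 := mem_ball_self one_pos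
    have h1 := (le_abs_self _).trans (hψK (0, 0) ⟨h0, mem_univ _⟩).1
    have h2 := hpK 0 h0 0
    have h3 := hψ0 0 h0 0
    change ψ 0 0 ≤ K at h1
    nlinarith
  obtain ⟨U, hU, hUu⟩ := exists_contDiff_extension (n := 4) (r := 4 / 5) (by norm_num)
    (by norm_num) hu
  replace hU : ContDiff ℝ 4 U := hU
  have hH : ∀ x ∈ ball (0 : Fin 3 → ℝ) (4 / 5), hessian 3 u x = hs U x := fun x hx =>
    hessian_eq_hs hU hUu hx
  have hlap : ∀ x ∈ ball (0 : Fin 3 → ℝ) (4 / 5), lapl 3 u x = lap U x := fun x hx => by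
    rw [lapl, hH x hx]; rfl
  have hpos : ∀ x ∈ ball (0 : Fin 3 → ℝ) (4 / 5), 0 < lap U x := fun x hx => by
    rw [← hlap x hx]; exact (heq x (hsub (by norm_num) hx)).1
  have hsig : ∀ x ∈ ball (0 : Fin 3 → ℝ) (4 / 5),
      (lap U x ^ 2 - ∑ i, ∑ j, hs U x i j ^ 2) / 2 / lap U x = ψ x (U x) := fun x hx => by
    rw [hUu x hx, ← (heq x (hsub (by norm_num) hx)).2, sigma2, hlap x hx, hH x hx]
    congr 4 with i
    exact Finset.sum_congr rfl fun j _ => by rw [hs_symm hU x j i, sq]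
  have hlapC : ContDiff ℝ 2 (lap U) := contDiff_lap hU
  obtain ⟨g, hg, hgu⟩ := exists_contDiff_extension (n := 2) (r := 3 / 4) (R := 4 / 5)
    (f := fun x => (lap U x ^ 2 - ∑ i, ∑ j, hs U x i j ^ 2) / 2 / lap U x)
    (by norm_num) (by norm_num) (by
      refine ContDiffOn.div (ContDiff.contDiffOn ?_) hlapC.contDiffOn fun x hx => (hpos x hx).ne'
      exact (((hlapC.pow 2).sub (ContDiff.sum fun i _ => ContDiff.sum fun j _ =>
        (contDiff_hs hU i j).pow 2)).div_const 2))
  obtain ⟨b, hb, hbu⟩ := exists_contDiff_extension (n := 2) (r := 3 / 4) (R := 4 / 5)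
    (f := fun x => Real.log (K * lap U x)) (by norm_num) (by norm_num)
    ((contDiff_const.mul hlapC).contDiffOn.log fun x hx =>
      (mul_pos (by linarith) (hpos x hx)).ne')
  have hgψ : ∀ x ∈ ball (0 : Fin 3 → ℝ) (3 / 4), g x = Function.uncurry ψ (x, U x) :=
    fun x hx => (hgu x hx).trans (hsig x (h45 x hx))
  have hgeq : ∀ x ∈ ball (0 : Fin 3 → ℝ) (3 / 4),
      lap U x ^ 2 - ∑ i, ∑ j, hs U x i j ^ 2 = 2 * g x * lap U x := fun x hx => by
    have := (hpos x (h45 x hx)).ne'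
    rw [hgu x hx]
    field_simp
  have hgK : ∀ x ∈ ball (0 : Fin 3 → ℝ) (3 / 4), 1 ≤ K * g x := fun x hx => by
    rw [hgψ x hx]; exact hpK x (hsub (by norm_num) hx) _
  have hS : ∀ x ∈ ball (0 : Fin 3 → ℝ) (3 / 4), 3 ≤ K * lap U x := fun x hx => by
    have hd : HessData (lap U x) (g x) (hs U x) :=
      { symm := hs_symm hU x
        S_pos := hpos x (h45 x hx)
        g_pos := pos_of_mul_pos_right (one_pos.trans_le (hgK x hx)) (by linarith)
        trace_eq := rfl
        sq_eq := hgeq x hx }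
    have := hgK x hx
    nlinarith [hd.three_mul_le]
  have hsS : ∀ x ∈ ball (0 : Fin 3 → ℝ) (3 / 4), ∀ i j, |hs U x i j| ≤ lap U x :=
    fun x hx i j => by
      have h1 := hgeq x hx
      have h2 := hpos x (h45 x hx)
      have h3 := hgK x hx
      have h4 : 0 < g x := pos_of_mul_pos_right (one_pos.trans_le h3) (by linarith)
      have h5 : 0 ≤ 2 * g x * lap U x := by positivity
      have h6 : hs U x i j ^ 2 ≤ ∑ i, ∑ j, hs U x i j ^ 2 :=
        (Finset.single_le_sum (f := fun j => hs U x i j ^ 2) (fun _ _ => sq_nonneg _)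
          (Finset.mem_univ j)).trans
        (Finset.single_le_sum (f := fun i => ∑ j, hs U x i j ^ 2)
          (fun _ _ => Finset.sum_nonneg fun _ _ => sq_nonneg _) (Finset.mem_univ i))
      exact abs_le_of_sq_le_sq (by linarith) h2.le
  have hΨd : ∀ p ∈ ball (0 : Fin 3 → ℝ) (3 / 4) ×ˢ (univ : Set ℝ),
      p ∈ ball (0 : Fin 3 → ℝ) 1 ×ˢ (univ : Set ℝ) := fun p hp =>
    ⟨hsub (by norm_num) hp.1, hp.2⟩
  have hΨ : ∀ p ∈ ball (0 : Fin 3 → ℝ) (3 / 4) ×ˢ (univ : Set ℝ),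
      DifferentiableAt ℝ (Function.uncurry ψ) p := fun p hp =>
    (hψ.contDiffAt ((isOpen_ball.prod isOpen_univ).mem_nhds (hΨd p hp))).differentiableAt
      one_ne_zero
  have hUM : ∀ x ∈ ball (0 : Fin 3 → ℝ) (3 / 4), ‖fderiv ℝ U x‖ ≤ M := fun x hx => by
    have e : U =ᶠ[nhds x] u := by
      filter_upwards [isOpen_ball.mem_nhds (h45 x hx)] with y hy using hUu y hy
    rw [e.fderiv_eq]
    exact huM x (hsub (by norm_num) hx)
  have hK0 : 0 ≤ K := by linarith
  have hpos1 : 0 ≤ 3 * (K * ((1 + M) ^ 2 + 1) * K + 3 * K) := by positivity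
  have hpos2 : 0 ≤ K * (1 + M) := by positivity
  refine ⟨U, g, b, ?_, hH 0 (mem_ball_self (by norm_num)), hbu 0 (mem_ball_self (by norm_num))⟩
  refine ⟨by linarith, hU, hg, hb, fun x hx => hpos x (h45 x hx), hgeq, ?_, ?_, ?_, ?_, ?_, ?_,
    ?_, ?_⟩ <;> intro x hx
  · have h1 := hgK x hx
    have : 0 < g x := pos_of_mul_pos_right (one_pos.trans_le h1) hK0
    exact h1.trans (mul_le_mul_of_nonneg_right (by linarith) this.le)
  · rw [hgψ x hx]
    have := (le_abs_self _).trans (hψK _ (hΨd (x, U x) ⟨hx, mem_univ _⟩)).1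
    linarith
  · intro i
    have := abs_pd_graph_comp_le hU hM.le hK0 hΨ (fun p hp => (hψK p (hΨd p hp)).2) hgψ hUM hx i
    linarith
  · have h1 := abs_lap_graph_comp_le hU hg hM.le hK0 hΨ (fun p hp => (hψK p (hΨd p hp)).2)
      (fun p hp q hq => hψL p (hΨd p hp) q (hΨd q hq)) hgψ hUM hx (hsS x hx)
    have h2 := hS x hx
    have h3 := mul_le_mul_of_nonneg_left (show 1 ≤ K * lap U x by linarith)
      (by positivity : 0 ≤ K * ((1 + M) ^ 2 + 1))
    have h4 := (hpos x (h45 x hx)).le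
    have h5 := mul_nonneg (by positivity : 0 ≤ 1 + M + K + K * (1 + M)) h4
    nlinarith
  · intro i
    have := (abs_pd_le_norm i U x).trans (hUM x hx)
    linarith
  · intro i
    rw [pd_congr i isOpen_ball hbu hx]
    exact (pd_log_const_mul (by linarith) (hlapC.differentiable (by norm_num) x)
      (hpos x (h45 x hx)).ne' i).symm
  · rw [hbu x hx, Real.le_log_iff_exp_le (by linarith [hS x hx])]
    linarith [hS x hx, Real.exp_one_lt_d9]
  · rw [hbu x hx]
    have h1 := Real.log_le_sub_one_of_pos (show 0 < K * lap U x by linarith [hS x hx])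
    have h2 := mul_nonneg (by linarith : 0 ≤ 1 + M + K * (1 + M)
      + 3 * (K * ((1 + M) ^ 2 + 1) * K + 3 * K)) (hpos x (h45 x hx)).le
    linarith

/-- interior Hessian estimate for 2-convex solutions of
`(σ₂/σ₁)(λ(D²u)) = ψ(x,u)` in `B₁(0) ⊂ ℝ³`, with a constant depending only on bounds `K` on
`‖ψ‖_{C^{1,1}}`, `‖1/ψ‖_{L^∞}` and `M` on `‖u‖_{C¹(B₁(0))}`. -/
theorem stmt0 (M K : ℝ) (hM : 0 < M) (hK : 0 < K) :
    ∃ C : ℝ, 0 < C ∧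
      ∀ (u : (Fin 3 → ℝ) → ℝ) (ψ : (Fin 3 → ℝ) → ℝ → ℝ),
        -- u ∈ C⁴(B₁)
        ContDiffOn ℝ 4 u (ball 0 1) →
        -- ψ : B₁ × ℝ → (0, ∞) of class C^{1,1}
        (∀ x ∈ ball (0 : Fin 3 → ℝ) 1, ∀ s : ℝ, 0 < ψ x s) →
        ContDiffOn ℝ 1 (Function.uncurry ψ) (ball (0 : Fin 3 → ℝ) 1 ×ˢ (univ : Set ℝ)) →
        -- ‖ψ‖_{C^{1,1}} ≤ K : the values and first derivatives are bounded by K,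
        -- and the first derivatives are K-Lipschitz
        (∀ p ∈ ball (0 : Fin 3 → ℝ) 1 ×ˢ (univ : Set ℝ),
          |Function.uncurry ψ p| ≤ K ∧
          ‖fderivWithin ℝ (Function.uncurry ψ)
              (ball (0 : Fin 3 → ℝ) 1 ×ˢ (univ : Set ℝ)) p‖ ≤ K) →
        LipschitzOnWith (Real.toNNReal K)
          (fderivWithin ℝ (Function.uncurry ψ) (ball (0 : Fin 3 → ℝ) 1 ×ˢ (univ : Set ℝ)))
          (ball (0 : Fin 3 → ℝ) 1 ×ˢ (univ : Set ℝ)) →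
        -- ‖1/ψ‖_{L^∞} ≤ K
        (∀ x ∈ ball (0 : Fin 3 → ℝ) 1, ∀ s : ℝ, 1 / ψ x s ≤ K) →
        -- ‖u‖_{C¹(B₁)} ≤ M
        (∀ x ∈ ball (0 : Fin 3 → ℝ) 1, |u x| + ‖fderiv ℝ u x‖ ≤ M) →
        -- u is 2-convex (λ(D²u) ∈ Γ₂, i.e. σ₁ > 0 and σ₂ > 0) and solves (σ₂/σ₁)(D²u) = ψ(x,u)
        (∀ x ∈ ball (0 : Fin 3 → ℝ) 1,
          0 < lapl 3 u x ∧ 0 < sigma2 3 u x ∧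
            sigma2 3 u x / lapl 3 u x = ψ x (u x)) →
        -- conclusion: |D²u(0)| ≤ C (entrywise bound on the Hessian at the origin)
        ∀ i j, |hessian 3 u 0 i j| ≤ C := by
  obtain ⟨P, hP⟩ := exists_sol M K hM
  obtain ⟨C, hC⟩ := exists_b_zero_le P
  refine ⟨Real.exp C / K, by positivity, fun u ψ hu hψ0 hψ hψK hψL hψinv huM heq i j => ?_⟩
  have hw : ∀ p ∈ ball (0 : Fin 3 → ℝ) 1 ×ˢ (univ : Set ℝ),
      fderivWithin ℝ (Function.uncurry ψ) (ball (0 : Fin 3 → ℝ) 1 ×ˢ (univ : Set ℝ)) p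
        = fderiv ℝ (Function.uncurry ψ) p := fun p hp =>
    fderivWithin_of_isOpen (isOpen_ball.prod isOpen_univ) hp
  obtain ⟨U, g, b, h, hH, hb⟩ := hP u ψ hu hψ hψ0
    (fun p hp => ⟨(hψK p hp).1, hw p hp ▸ (hψK p hp).2⟩)
    (fun p hp q hq => by
      have := hψL.norm_sub_le hp hq
      rwa [hw p hp, hw q hq, Real.coe_toNNReal K hK.le] at this)
    hψinv (fun x hx => by linarith [huM x hx, abs_nonneg (u x)])
    (fun x hx => ⟨(heq x hx).1, (heq x hx).2.2⟩)
  have h1 := hC U g b h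
  have h2 := h.lap_pos 0 Sol.zero_mem
  rw [hb, Real.log_le_iff_le_exp (by positivity)] at h1
  rw [hH]
  refine (h.abs_hs_le Sol.zero_mem i j).trans ?_
  rw [le_div_iff₀ hK]
  linarith
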